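/- arXiv:0710.3032 — 7 statements merged into one kernel-verified Lean document; each statement's English description precedes it below -/
import Mathlib

section
/- For every constant a > 0 there exists a constant c > 0 with the following property: if H is any 3-uniform hypergraph with n vertices that contains at most c·n^4 simplices, then it is possible to remove at most a·n^3 edges from H so that the resulting hypergraph contains no simplex. (Theorem 1.6, the Frankl–Rödl simplex removal lemma for 3-uniform hypergraphs.) -/
open Finset

namespace SimplexRemoval

section FiberAverage

variable {Ω κ κ' : Type*} [Fintype Ω] [DecidableEq κ] [DecidableEq κ']

/-- The average of `f` over the fibre of `π` through a point. -/
noncomputable def fiberAvg (π : Ω → κ) (f : Ω → ℝ) (ω : Ω) : ℝ :=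
  (∑ ω' with π ω' = π ω, f ω') / #{ω' | π ω' = π ω}

lemma fiberAvg_congr {π : Ω → κ} (f : Ω → ℝ) {ω ω' : Ω} (h : π ω = π ω') :
    fiberAvg π f ω = fiberAvg π f ω' := by
  simp only [fiberAvg, h]

lemma card_fiber_pos (π : Ω → κ) (ω : Ω) : (0 : ℝ) < #{ω' | π ω' = π ω} := by
  exact_mod_cast Finset.card_pos.2 ⟨ω, by simp⟩

lemma fiberAvg_mul_card (π : Ω → κ) (f : Ω → ℝ) (ω : Ω) :
    fiberAvg π f ω * #{ω' | π ω' = π ω} = ∑ ω' with π ω' = π ω, f ω' :=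
  div_mul_cancel₀ _ (card_fiber_pos π ω).ne'

lemma fiberAvg_nonneg (π : Ω → κ) {f : Ω → ℝ} (hf : ∀ ω, 0 ≤ f ω) (ω : Ω) :
    0 ≤ fiberAvg π f ω :=
  div_nonneg (sum_nonneg fun _ _ => hf _) (Nat.cast_nonneg _)

lemma fiberAvg_le_one (π : Ω → κ) {f : Ω → ℝ} (hf : ∀ ω, f ω ≤ 1) (ω : Ω) :
    fiberAvg π f ω ≤ 1 := by
  refine div_le_one_of_le₀ ?_ (Nat.cast_nonneg _)
  calc ∑ ω' with π ω' = π ω, f ω' ≤ ∑ ω' with π ω' = π ω, (1 : ℝ) := sum_le_sum fun _ _ => hf _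
    _ = _ := by simp

lemma sum_fiberAvg_mul (π : Ω → κ) (f : Ω → ℝ) {h : Ω → ℝ}
    (hh : ∀ ω ω', π ω = π ω' → h ω = h ω') :
    ∑ ω, fiberAvg π f ω * h ω = ∑ ω, f ω * h ω := by
  have h1 : ∀ ω, fiberAvg π f ω * h ω =
      ∑ ω', if π ω' = π ω then f ω' * (h ω' / #{ω'' | π ω'' = π ω'}) else 0 := by
    intro ω
    rw [← sum_filter, fiberAvg, div_mul_eq_mul_div, sum_mul, sum_div]
    refine sum_congr rfl fun ω' hω' => ?_
    have h2 := (mem_filter.1 hω').2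
    rw [hh ω' ω h2, h2, mul_div_assoc]
  simp_rw [h1]
  rw [sum_comm]
  refine sum_congr rfl fun ω' _ => ?_
  rw [← sum_filter, sum_const, nsmul_eq_mul]
  have h2 : #{ω | π ω' = π ω} = #{ω'' | π ω'' = π ω'} := by
    congr 1; ext; simp [eq_comm]
  rw [h2]
  have h3 := (card_fiber_pos π ω').ne'
  field_simp

lemma sum_fiberAvg (π : Ω → κ) (f : Ω → ℝ) : ∑ ω, fiberAvg π f ω = ∑ ω, f ω := by
  simpa using sum_fiberAvg_mul π f (h := fun _ => 1) (fun _ _ _ => rfl)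

/-- The energy of `f` with respect to the partition into fibres of `π`. -/
noncomputable def energy (π : Ω → κ) (f : Ω → ℝ) : ℝ := ∑ ω, fiberAvg π f ω ^ 2

lemma energy_nonneg (π : Ω → κ) (f : Ω → ℝ) : 0 ≤ energy π f :=
  sum_nonneg fun _ _ => sq_nonneg _

lemma energy_le_card (π : Ω → κ) {f : Ω → ℝ} (h0 : ∀ ω, 0 ≤ f ω) (h1 : ∀ ω, f ω ≤ 1) :
    energy π f ≤ Fintype.card Ω := by
  calc energy π f ≤ ∑ _ω : Ω, (1 : ℝ) := sum_le_sum fun ω _ =>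
        pow_le_one₀ (fiberAvg_nonneg π h0 ω) (fiberAvg_le_one π h1 ω)
    _ = _ := by simp

lemma sum_sq_fiberAvg_sub {π : Ω → κ} {π' : Ω → κ'}
    (hr : ∀ ω ω', π' ω = π' ω' → π ω = π ω') (f : Ω → ℝ) :
    ∑ ω, (fiberAvg π' f ω - fiberAvg π f ω) ^ 2 = energy π' f - energy π f := by
  have h1 : ∑ ω, fiberAvg π' f ω * fiberAvg π f ω = ∑ ω, f ω * fiberAvg π f ω :=
    sum_fiberAvg_mul π' f fun ω ω' h => fiberAvg_congr f (hr ω ω' h)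
  have h2 : ∑ ω, fiberAvg π f ω * fiberAvg π f ω = ∑ ω, f ω * fiberAvg π f ω :=
    sum_fiberAvg_mul π f fun ω ω' h => fiberAvg_congr f h
  have h3 : ∀ ω, (fiberAvg π' f ω - fiberAvg π f ω) ^ 2 = fiberAvg π' f ω ^ 2
      - 2 * (fiberAvg π' f ω * fiberAvg π f ω) + fiberAvg π f ω * fiberAvg π f ω := by
    intro ω; ring
  simp_rw [h3, sum_add_distrib, sum_sub_distrib, ← mul_sum, h1, h2, energy]
  have h4 : ∑ ω, fiberAvg π f ω ^ 2 = ∑ ω, f ω * fiberAvg π f ω := by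
    rw [← h2]; exact sum_congr rfl fun _ _ => sq _
  linarith

lemma energy_mono {π : Ω → κ} {π' : Ω → κ'}
    (hr : ∀ ω ω', π' ω = π' ω' → π ω = π ω') (f : Ω → ℝ) : energy π f ≤ energy π' f := by
  have h := sum_sq_fiberAvg_sub hr f
  have : 0 ≤ ∑ ω, (fiberAvg π' f ω - fiberAvg π f ω) ^ 2 := sum_nonneg fun _ _ => sq_nonneg _
  linarith

/-- Correlation of `f - fiberAvg π f` with a `π'`-measurable set forces an energy increment. -/
lemma sq_sum_le_energy_sub {π : Ω → κ} {π' : Ω → κ'}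
    (hr : ∀ ω ω', π' ω = π' ω' → π ω = π ω') (f : Ω → ℝ) {h : Ω → ℝ}
    (hh : ∀ ω ω', π' ω = π' ω' → h ω = h ω') (h0 : ∀ ω, 0 ≤ h ω) (h1 : ∀ ω, h ω ≤ 1) :
    (∑ ω, (f ω - fiberAvg π f ω) * h ω) ^ 2 ≤
      (energy π' f - energy π f) * Fintype.card Ω := by
  have e : ∑ ω, (f ω - fiberAvg π f ω) * h ω =
      ∑ ω, (fiberAvg π' f ω - fiberAvg π f ω) * h ω := by
    simp_rw [sub_mul, sum_sub_distrib, sum_fiberAvg_mul π' f hh]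
  rw [e, ← sum_sq_fiberAvg_sub hr f]
  refine (sum_mul_sq_le_sq_mul_sq _ _ _).trans ?_
  refine mul_le_mul_of_nonneg_left ?_ (sum_nonneg fun _ _ => sq_nonneg _)
  calc ∑ ω, h ω ^ 2 ≤ ∑ _ω : Ω, (1 : ℝ) := sum_le_sum fun ω _ => pow_le_one₀ (h0 ω) (h1 ω)
    _ = _ := by simp

/-- Markov's inequality for fibre averages. -/
lemma card_lt_fiberAvg_mul_le (π : Ω → κ) {f : Ω → ℝ} (h0 : ∀ ω, 0 ≤ f ω) (t : ℝ) :
    (#{ω | t < fiberAvg π f ω} : ℝ) * t ≤ ∑ ω, f ω := by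
  rw [← sum_fiberAvg π f]
  calc (#{ω | t < fiberAvg π f ω} : ℝ) * t = ∑ ω with t < fiberAvg π f ω, t := by simp
    _ ≤ ∑ ω with t < fiberAvg π f ω, fiberAvg π f ω :=
        sum_le_sum fun ω hω => (mem_filter.1 hω).2.le
    _ ≤ _ := sum_le_sum_of_subset_of_nonneg (filter_subset _ _)
        fun ω _ _ => fiberAvg_nonneg π h0 ω

lemma sum_fiberAvg_lt_le (π : Ω → κ) (f : Ω → ℝ) {t : ℝ} (ht : 0 ≤ t) :
    ∑ ω with fiberAvg π f ω < t, f ω ≤ t * Fintype.card Ω := by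
  have h := sum_fiberAvg_mul π f (h := fun ω => if fiberAvg π f ω < t then 1 else 0)
    (fun ω ω' e => by simp only [fiberAvg_congr f e])
  simp only [mul_ite, mul_one, mul_zero, ← sum_filter] at h
  rw [← h]
  calc ∑ ω with fiberAvg π f ω < t, fiberAvg π f ω ≤ ∑ ω with fiberAvg π f ω < t, t :=
        sum_le_sum fun ω hω => (mem_filter.1 hω).2.le
    _ ≤ ∑ _ω : Ω, t := sum_le_sum_of_subset_of_nonneg (filter_subset _ _) fun _ _ _ => ht
    _ = _ := by simp [mul_comm]

end FiberAverage

/-- If every colouring can be refined boundedly with relation `Rel`, then some pair of related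
colourings has a small increment of a bounded functional. -/
lemma exists_small_increment (G : ℕ → ℕ) (k₀ t : ℕ) : ∃ K : ℕ, ∀ (X : Type)
    (E : ∀ k, (X → Fin k) → ℝ) (η : ℝ) (Rel : ∀ k k', (X → Fin k) → (X → Fin k') → Prop),
    0 ≤ η → (∀ k Q, 0 ≤ E k Q) → (∀ k Q, E k Q ≤ t * η) →
    (∀ k (Q : X → Fin k), ∃ Q' : X → Fin (G k), Rel k (G k) Q Q' ∧
      ∀ x y, Q' x = Q' y → Q x = Q y) →
    ∀ Q₀ : X → Fin k₀, ∃ k ≤ K, ∃ Q : X → Fin k, (∀ x y, Q x = Q y → Q₀ x = Q₀ y) ∧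
      ∃ Q' : X → Fin (G k), Rel k (G k) Q Q' ∧ (∀ x y, Q' x = Q' y → Q x = Q y) ∧
        E (G k) Q' ≤ E k Q + η := by
  refine ⟨(range (t + 1)).sup fun i => G^[i] k₀, ?_⟩
  intro X E η Rel hη h0 h1 step Q₀
  by_contra! hcon
  have key : ∀ s ≤ t + 1, ∃ Q : X → Fin (G^[s] k₀), (∀ x y, Q x = Q y → Q₀ x = Q₀ y) ∧
      s * η ≤ E _ Q ∧ (0 < s → s * η < E _ Q) := by
    intro s
    induction s with
    | zero => intro _; exact ⟨Q₀, fun _ _ h => h, by simpa using h0 _ _, by simp⟩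
    | succ s ih =>
      intro hs
      obtain ⟨Q, hQ, hE, -⟩ := ih (by omega)
      obtain ⟨Q', hR, hr⟩ := step _ Q
      have hk : G^[s] k₀ ≤ (range (t + 1)).sup fun i => G^[i] k₀ :=
        le_sup (f := fun i => G^[i] k₀) (mem_range.2 (by omega))
      have h2 := hcon _ hk Q hQ Q' hR hr
      have h3 : ((s + 1 : ℕ) : ℝ) * η < E _ Q' := by push_cast; linarith
      rw [Function.iterate_succ_apply']
      exact ⟨Q', fun x y h => hQ x y (hr x y h), h3.le, fun _ => h3⟩
  obtain ⟨Q, -, -, h⟩ := key (t + 1) le_rfl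
  have h2 := h (by omega)
  have h3 := h1 _ Q
  push_cast at h2
  linarith

lemma fiberAvg_eq_of_iff {Ω κ κ' : Type*} [Fintype Ω] [DecidableEq κ] [DecidableEq κ']
    {π : Ω → κ} {π' : Ω → κ'} (h : ∀ ω ω', π ω = π ω' ↔ π' ω = π' ω') (f : Ω → ℝ) :
    fiberAvg π f = fiberAvg π' f := by
  funext ω
  simp only [fiberAvg, h]

section Uniformity

variable {X Ω : Type} {r k : ℕ}

/-- The colouring of `Ω` induced by a colouring of `X` through the projections `p`. -/
def label {κ : Type*} (p : Fin r → Ω → X) (Q : X → κ) (ω : Ω) (i : Fin r) : κ := Q (p i ω)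

lemma label_eq_iff {κ : Type*} {p : Fin r → Ω → X} {Q : X → κ} {ω ω' : Ω} :
    label p Q ω = label p Q ω' ↔ ∀ i, Q (p i ω) = Q (p i ω') := funext_iff

variable [Fintype Ω]

/-- `f` minus its average over the colour classes induced by `Q` correlates with no product of
functions of the single coordinates. -/
def Uniform (p : Fin r → Ω → X) (Q : X → Fin k) (f : Ω → ℝ) (ε : ℝ) : Prop :=
  ∀ u : Fin r → X → ℝ, (∀ i x, 0 ≤ u i x ∧ u i x ≤ 1) →
    |∑ ω, (f ω - fiberAvg (label p Q) f ω) * ∏ i, u i (p i ω)| ≤ ε * Fintype.card Ω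

lemma sum_mul_prod_le_of_indicator [Fintype X] (p : Fin r → Ω → X) (h : Ω → ℝ) (C : ℝ)
    (H : ∀ u : Fin r → X → ℝ, (∀ i x, u i x = 0 ∨ u i x = 1) →
      ∑ ω, h ω * ∏ i, u i (p i ω) ≤ C)
    (u : Fin r → X → ℝ) (hu : ∀ i x, 0 ≤ u i x ∧ u i x ≤ 1) :
    ∑ ω, h ω * ∏ i, u i (p i ω) ≤ C := by
  classical
  suffices key : ∀ (s : Finset (Fin r)) (u : Fin r → X → ℝ),
      (∀ i x, 0 ≤ u i x ∧ u i x ≤ 1) → (∀ i ∉ s, ∀ x, u i x = 0 ∨ u i x = 1) →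
      ∑ ω, h ω * ∏ i, u i (p i ω) ≤ C from key univ u hu (by simp)
  intro s
  induction s using Finset.induction_on with
  | empty => intro u _ hu; exact H u fun i x => hu i (by simp) x
  | insert i s _ ih =>
    intro u hu hs
    set K : X → ℝ := fun x =>
      ∑ ω with p i ω = x, h ω * ∏ j ∈ univ.erase i, u j (p j ω) with hK
    have expand : ∀ v : X → ℝ,
        ∑ ω, h ω * ∏ j, Function.update u i v j (p j ω) = ∑ x, v x * K x := by
      intro v
      rw [← sum_fiberwise univ (p i)]
      refine sum_congr rfl fun x _ => ?_
      rw [hK, mul_sum]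
      refine sum_congr rfl fun ω hω => ?_
      have hω' := (mem_filter.1 hω).2
      rw [← mul_prod_erase univ _ (mem_univ i), Function.update_self, hω']
      have : ∏ j ∈ univ.erase i, Function.update u i v j (p j ω) =
          ∏ j ∈ univ.erase i, u j (p j ω) :=
        prod_congr rfl fun j hj => by rw [Function.update_of_ne (ne_of_mem_erase hj)]
      rw [this]; ring
    have h1 := expand (u i)
    rw [Function.update_eq_self] at h1
    have h2 := expand fun x => if 0 < K x then 1 else 0
    rw [h1]
    calc ∑ x, u i x * K x ≤ ∑ x, (if 0 < K x then 1 else 0) * K x := by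
          refine sum_le_sum fun x _ => ?_
          split_ifs with hx
          · exact mul_le_mul_of_nonneg_right (hu i x).2 hx.le
          · rw [zero_mul]
            exact mul_nonpos_of_nonneg_of_nonpos (hu i x).1 (not_lt.1 hx)
      _ ≤ C := by
          rw [← h2]
          apply ih
          · intro j x
            by_cases hj : j = i
            · subst hj
              rw [Function.update_self]
              split_ifs <;> norm_num
            · rw [Function.update_of_ne hj]; exact hu j x
          · intro j hj x
            by_cases hji : j = i
            · subst hji
              rw [Function.update_self]
              split_ifs <;> simp
            · rw [Function.update_of_ne hji]
              exact hs j (by simp [hji, hj]) x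

lemma uniform_of_indicator [Fintype X] {p : Fin r → Ω → X} {Q : X → Fin k} {f : Ω → ℝ} {ε : ℝ}
    (H : ∀ u : Fin r → X → ℝ, (∀ i x, u i x = 0 ∨ u i x = 1) →
      |∑ ω, (f ω - fiberAvg (label p Q) f ω) * ∏ i, u i (p i ω)| ≤ ε * Fintype.card Ω) :
    Uniform p Q f ε := by
  intro u hu
  rw [abs_le']
  constructor
  · exact sum_mul_prod_le_of_indicator p _ _ (fun u hu => (abs_le'.1 (H u hu)).1) u hu
  · rw [← sum_neg_distrib]
    simp_rw [← neg_mul]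
    refine sum_mul_prod_le_of_indicator p _ _ (fun u hu => ?_) u hu
    simp_rw [neg_mul, sum_neg_distrib]
    exact (abs_le'.1 (H u hu)).2

lemma Uniform.of_iff {k' : ℕ} {p : Fin r → Ω → X} {Q : X → Fin k} {Q' : X → Fin k'} {f : Ω → ℝ}
    {ε : ℝ} (h : Uniform p Q f ε) (hQ : ∀ x y, Q x = Q y ↔ Q' x = Q' y) : Uniform p Q' f ε := by
  have : fiberAvg (label p Q) f = fiberAvg (label p Q') f :=
    fiberAvg_eq_of_iff (fun ω ω' => by simp only [label_eq_iff, hQ]) f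
  intro u hu
  rw [← this]
  exact h u hu

end Uniformity

/-- Weak regularity: every colouring has a bounded refinement for which finitely many given
functions are `ε`-uniform. -/
lemma exists_uniform_refinement (r m k₀ : ℕ) {ε : ℝ} (hε : 0 < ε) : ∃ K : ℕ,
    ∀ (X Ω : Type) [Fintype X] [Fintype Ω] (p : Fin r → Ω → X) (f : Fin m → Ω → ℝ),
      (∀ c ω, 0 ≤ f c ω) → (∀ c ω, f c ω ≤ 1) → ∀ Q₀ : X → Fin k₀,
      ∃ Q : X → Fin K, (∀ x y, Q x = Q y → Q₀ x = Q₀ y) ∧ ∀ c, Uniform p Q (f c) ε := by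
  obtain ⟨K, hK⟩ := exists_small_increment (fun k => k * 2 ^ r) k₀ ⌈m / ε ^ 2⌉₊
  refine ⟨K, ?_⟩
  intro X Ω _ _ p f h0 h1 Q₀
  have hN : (0 : ℝ) ≤ Fintype.card Ω := Nat.cast_nonneg _
  obtain ⟨k, hk, Q, hQ, Q', hR, -, hE⟩ := hK X
    (fun k Q => ∑ c, energy (label p Q) (f c)) (ε ^ 2 * Fintype.card Ω)
    (fun k k' Q Q' => (∃ c, ¬ Uniform p Q (f c) ε) →
      ∑ c, energy (label p Q) (f c) + ε ^ 2 * Fintype.card Ω < ∑ c, energy (label p Q') (f c))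
    (by positivity) (fun k Q => sum_nonneg fun _ _ => energy_nonneg _ _)
    (fun k Q => by
      calc ∑ c, energy (label p Q) (f c) ≤ ∑ _c : Fin m, (Fintype.card Ω : ℝ) :=
            sum_le_sum fun c _ => energy_le_card _ (h0 c) (h1 c)
        _ = m / ε ^ 2 * (ε ^ 2 * Fintype.card Ω) := by
            simp only [sum_const, card_univ, Fintype.card_fin, nsmul_eq_mul]; field_simp
        _ ≤ _ := mul_le_mul_of_nonneg_right (Nat.le_ceil _) (by positivity))
    (fun k Q => by
      let e : Fin k × (Fin r → Bool) ≃ Fin (k * 2 ^ r) := Fintype.equivFinOfCardEq (by simp)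
      by_cases hU : ∃ c, ¬ Uniform p Q (f c) ε
      · obtain ⟨c, hc⟩ := hU
        have hc' := mt uniform_of_indicator hc
        push Not at hc'
        obtain ⟨u, hu, hlt⟩ := hc'
        have hr : ∀ x y, e (Q x, fun i => decide (u i x = 1)) =
            e (Q y, fun i => decide (u i y = 1)) → Q x = Q y ∧ ∀ i, u i x = u i y := by
          intro x y h
          have h2 := Prod.ext_iff.1 (e.injective h)
          refine ⟨h2.1, fun i => ?_⟩
          have h3 := congrFun h2.2 i
          simp only [decide_eq_decide] at h3
          rcases hu i x with hx | hx <;> rcases hu i y with hy | hy <;> simp_all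
        refine ⟨fun x => e (Q x, fun i => decide (u i x = 1)), fun _ => ?_,
          fun x y h => (hr x y h).1⟩
        set Q' : X → Fin (k * 2 ^ r) := fun x => e (Q x, fun i => decide (u i x = 1))
        have hrl : ∀ ω ω', label p Q' ω = label p Q' ω' → label p Q ω = label p Q ω' := by
          intro ω ω' h
          rw [label_eq_iff] at h ⊢
          exact fun i => (hr _ _ (h i)).1
        have hu01 : ∀ i x, 0 ≤ u i x ∧ u i x ≤ 1 := by
          intro i x
          rcases hu i x with h | h <;> rw [h] <;> norm_num
        have h4 := sq_sum_le_energy_sub hrl (f c) (h := fun ω => ∏ i, u i (p i ω))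
          (fun ω ω' h => prod_congr rfl fun i _ => (hr _ _ (label_eq_iff.1 h i)).2 i)
          (fun ω => prod_nonneg fun i _ => (hu01 _ _).1)
          (fun ω => prod_le_one (fun i _ => (hu01 _ _).1) fun i _ => (hu01 _ _).2)
        have h5 : (ε * Fintype.card Ω) ^ 2 <
            (energy (label p Q') (f c) - energy (label p Q) (f c)) * Fintype.card Ω := by
          refine lt_of_lt_of_le ?_ h4
          rw [← sq_abs (∑ ω, _)]
          exact pow_lt_pow_left₀ hlt (by positivity) two_ne_zero
        have h6 : ε ^ 2 * Fintype.card Ω <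
            energy (label p Q') (f c) - energy (label p Q) (f c) := by
          refine lt_of_mul_lt_mul_right ?_ hN
          linarith
        have h7 : energy (label p Q') (f c) - energy (label p Q) (f c) ≤
            ∑ c, (energy (label p Q') (f c) - energy (label p Q) (f c)) :=
          single_le_sum (f := fun c => energy (label p Q') (f c) - energy (label p Q) (f c))
            (fun c _ => sub_nonneg.2 (energy_mono hrl (f c))) (mem_univ c)
        rw [sum_sub_distrib] at h7
        linarith
      · exact ⟨fun x => e (Q x, fun _ => true), fun h => absurd h hU,
          fun x y h => (Prod.ext_iff.1 (e.injective h)).1⟩) Q₀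
  refine ⟨Fin.castLE hk ∘ Q, fun x y h => hQ x y (Fin.castLE_injective hk h), fun c => ?_⟩
  have : Uniform p Q (f c) ε := by
    by_contra hc
    exact absurd (hR ⟨c, hc⟩) (not_lt.2 hE)
  exact this.of_iff fun x y => (Fin.castLE_injective hk).eq_iff.symm

section RegularPairs

variable {V : Type}

/-- `D` is `ε`-close to the constant `e` on `A × B` in relative cut norm. -/
def RegOn (ε : ℝ) (A B : Finset V) (D : V → V → ℝ) (e : ℝ) : Prop :=
  ∀ u w : V → ℝ, (∀ x, 0 ≤ u x ∧ u x ≤ 1) → (∀ x, 0 ≤ w x ∧ w x ≤ 1) →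
    |∑ x ∈ A, ∑ y ∈ B, (D x y - e) * (u x * w y)| ≤ ε * (#A * #B)

lemma RegOn.flip {ε : ℝ} {A B : Finset V} {D : V → V → ℝ} {e : ℝ} (h : RegOn ε A B D e) :
    RegOn ε B A (fun x y => D y x) e := by
  intro u w hu hw
  rw [sum_comm, mul_comm (#B : ℝ)]
  simpa only [mul_comm (u _)] using h w u hw hu

variable [Fintype V]

/-- The colour class of `i`. -/
def cell {k : ℕ} (Q : V → Fin k) (i : Fin k) : Finset V := {x | Q x = i}

lemma mem_cell {k : ℕ} {Q : V → Fin k} {i : Fin k} {x : V} : x ∈ cell Q i ↔ Q x = i := by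
  simp [cell]

/-- The cells of `x` and `y` are large and form a regular pair of density at least `τ` for the
colour of `(x, y)`. -/
def GoodPair {m k : ℕ} (ε τ β : ℝ) (P : V × V → Fin m) (Q : V → Fin k) (x y : V) : Prop :=
  β * Fintype.card V ≤ #(cell Q (Q x)) ∧ β * Fintype.card V ≤ #(cell Q (Q y)) ∧
    ∃ e, τ ≤ e ∧ e ≤ 1 ∧
      RegOn ε (cell Q (Q x)) (cell Q (Q y)) (fun x' y' => if P (x', y') = P (x, y) then 1 else 0) e

lemma card_small_cell_le {k : ℕ} (Q : V → Fin k) {b : ℝ} (hb : 0 ≤ b) :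
    (#{x | (#(cell Q (Q x)) : ℝ) < b} : ℝ) ≤ k * b := by
  classical
  rw [card_eq_sum_card_fiberwise (f := Q) (t := univ) (fun _ _ => by simp)]
  push_cast
  calc ∑ i : Fin k, (#{x ∈ ({x | (#(cell Q (Q x)) : ℝ) < b} : Finset V) | Q x = i} : ℝ)
      ≤ ∑ _i : Fin k, b := by
        refine sum_le_sum fun i _ => ?_
        by_cases h : (#(cell Q i) : ℝ) < b
        · refine le_trans ?_ h.le
          exact_mod_cast card_le_card fun x hx => mem_cell.2 (mem_filter.1 hx).2
        · rw [filter_filter, filter_false_of_mem]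
          · simpa using hb
          · rintro x - ⟨h1, rfl⟩
            exact h h1
    _ = k * b := by simp

lemma fiber_pair_eq {k : ℕ} (Q : V → Fin k) (ω : V × V) :
    ({ω' | label ![Prod.fst, Prod.snd] Q ω' = label ![Prod.fst, Prod.snd] Q ω} : Finset (V × V)) =
      cell Q (Q ω.1) ×ˢ cell Q (Q ω.2) := by
  ext ω'
  simp [label_eq_iff, Fin.forall_fin_two, mem_cell]

/-- A function whose fine average is uniform and close in mean square to its coarse average is
regular on the cells of the coarse partition. -/
lemma regOn_of_uniform {k k' : ℕ} {ε η : ℝ} (hε : 0 < ε) {Q : V → Fin k} {Q' : V → Fin k'}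
    {f : V × V → ℝ} (hU : Uniform ![Prod.fst, Prod.snd] Q' f η) (ω : V × V)
    (hη : η * Fintype.card V ^ 2 ≤ ε / 2 * (#(cell Q (Q ω.1)) * #(cell Q (Q ω.2))))
    (hs : fiberAvg (label ![Prod.fst, Prod.snd] Q)
      (fun ω => (fiberAvg (label ![Prod.fst, Prod.snd] Q') f ω -
        fiberAvg (label ![Prod.fst, Prod.snd] Q) f ω) ^ 2) ω ≤ ε ^ 2 / 4) :
    RegOn ε (cell Q (Q ω.1)) (cell Q (Q ω.2)) (fun x y => f (x, y))
      (fiberAvg (label ![Prod.fst, Prod.snd] Q) f ω) := by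
  classical
  set π := label ![Prod.fst, Prod.snd] Q with hπ
  set π' := label ![Prod.fst, Prod.snd] Q'
  set A := cell Q (Q ω.1)
  set B := cell Q (Q ω.2)
  intro u w hu hw
  have hfib := fiber_pair_eq Q ω
  have hsum : ∑ ω' ∈ A ×ˢ B, (fiberAvg π' f ω' - fiberAvg π f ω') ^ 2 ≤
      ε ^ 2 / 4 * (#A * #B) := by
    rw [← hfib, ← fiberAvg_mul_card, hfib, card_product]
    push_cast
    exact mul_le_mul_of_nonneg_right hs (by positivity)
  have h1 : |∑ ω' ∈ A ×ˢ B, (f ω' - fiberAvg π' f ω') * (u ω'.1 * w ω'.2)| ≤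
      ε / 2 * (#A * #B) := by
    refine le_trans ?_ hη
    have h := hU ![fun x => if x ∈ A then u x else 0, fun y => if y ∈ B then w y else 0] (by
      intro i x
      fin_cases i
      · simp only [Fin.zero_eta, Matrix.cons_val_zero]; split_ifs
        · exact hu x
        · norm_num
      · simp only [Fin.mk_one, Matrix.cons_val_one, Matrix.cons_val_fin_one]; split_ifs
        · exact hw x
        · norm_num)
    simp only [Fin.prod_univ_two, Matrix.cons_val_zero, Matrix.cons_val_one,
      Matrix.cons_val_fin_one, Fintype.card_prod] at h
    rw [← Fintype.sum_extend_by_zero]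
    rw [sq, ← Nat.cast_mul]
    refine le_of_eq_of_le (congrArg _ (sum_congr rfl fun ω' _ => ?_)) h
    by_cases h1 : ω'.1 ∈ A <;> by_cases h2 : ω'.2 ∈ B <;> simp [h1, h2, mem_product, π']
  have h2 : |∑ ω' ∈ A ×ˢ B, (fiberAvg π' f ω' - fiberAvg π f ω') * (u ω'.1 * w ω'.2)| ≤
      ε / 2 * (#A * #B) := by
    calc _ ≤ ∑ ω' ∈ A ×ˢ B, (ε / 4 + (fiberAvg π' f ω' - fiberAvg π f ω') ^ 2 / ε) := by
          refine (abs_sum_le_sum_abs _ _).trans (sum_le_sum fun ω' _ => ?_)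
          set t := fiberAvg π' f ω' - fiberAvg π f ω'
          have huw : |u ω'.1 * w ω'.2| ≤ 1 := by
            rw [abs_of_nonneg (mul_nonneg (hu _).1 (hw _).1)]
            exact mul_le_one₀ (hu _).2 (hw _).1 (hw _).2
          rw [abs_mul]
          refine (mul_le_of_le_one_right (abs_nonneg t) huw).trans ?_
          have : ε / 4 + t ^ 2 / ε - |t| = (|t| - ε / 2) ^ 2 / ε := by
            rw [← sq_abs t]; field_simp; ring
          have : 0 ≤ (|t| - ε / 2) ^ 2 / ε := by positivity
          linarith
      _ = ε / 4 * (#A * #B) +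
          (∑ ω' ∈ A ×ˢ B, (fiberAvg π' f ω' - fiberAvg π f ω') ^ 2) / ε := by
          rw [sum_add_distrib, sum_const, card_product, nsmul_eq_mul, sum_div, mul_comm]
          push_cast
          rfl
      _ ≤ ε / 4 * (#A * #B) + (ε ^ 2 / 4 * (#A * #B)) / ε := by gcongr
      _ = _ := by field_simp; ring
  have h3 : ∑ x ∈ A, ∑ y ∈ B, (f (x, y) - fiberAvg π f ω) * (u x * w y) =
      ∑ ω' ∈ A ×ˢ B, (f ω' - fiberAvg π' f ω') * (u ω'.1 * w ω'.2) +
      ∑ ω' ∈ A ×ˢ B, (fiberAvg π' f ω' - fiberAvg π f ω') * (u ω'.1 * w ω'.2) := by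
    rw [← sum_add_distrib, ← sum_product']
    refine sum_congr rfl fun ω' hω' => ?_
    rw [← hfib] at hω'
    rw [← fiberAvg_congr f (mem_filter.1 hω').2]
    ring
  rw [h3]
  refine (abs_add_le _ _).trans ?_
  linarith

end RegularPairs

/-- A bounded vertex partition regularizing all colour classes of a pair colouring at once. -/
lemma exists_regular_partition (m : ℕ) {ε θ : ℝ} (hε : 0 < ε) (hθ : 0 < θ) :
    ∃ L : ℕ, ∃ β : ℝ, 0 < β ∧ ∀ (V : Type) [Fintype V] (P : V × V → Fin m),
      ∃ Q : V → Fin L, ∀ B : Finset (V × V),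
        (∀ ω ∈ B, ¬ GoodPair ε (θ / (4 * (m + 1))) β P Q ω.1 ω.2) →
          (#B : ℝ) ≤ θ * Fintype.card V ^ 2 := by
  classical
  set b : ℕ → ℝ := fun k => θ / (8 * (k + 1)) with hb
  have hb0 : ∀ k, 0 < b k := fun k => by positivity
  have hη0 : ∀ k, 0 < ε * b k ^ 2 / 2 := fun k => by have := hb0 k; positivity
  choose G hG using fun k => exists_uniform_refinement 2 m k (hη0 k)
  set κ := θ * ε ^ 2 / 16 with hκ
  have hκ0 : 0 < κ := by positivity
  obtain ⟨K, hK⟩ := exists_small_increment G 1 ⌈m / κ⌉₊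
  refine ⟨K, b K, hb0 K, ?_⟩
  intro V _ P
  set n : ℝ := (Fintype.card V : ℝ) with hn
  have hn0 : 0 ≤ n := Nat.cast_nonneg _
  set p : Fin 2 → V × V → V := ![Prod.fst, Prod.snd] with hp
  set f : Fin m → V × V → ℝ := fun c ω => if P ω = c then 1 else 0 with hf
  have f0 : ∀ c ω, 0 ≤ f c ω := fun c ω => by simp only [hf]; split_ifs <;> norm_num
  have f1 : ∀ c ω, f c ω ≤ 1 := fun c ω => by simp only [hf]; split_ifs <;> norm_num
  have hcard : (Fintype.card (V × V) : ℝ) = n ^ 2 := by rw [Fintype.card_prod]; push_cast; ring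
  obtain ⟨k, hk, Q, -, Q', hU, hr, hE⟩ := hK V
    (fun k Q => ∑ c, energy (label p Q) (f c)) (κ * n ^ 2)
    (fun k k' Q Q' => ∀ c, Uniform p Q' (f c) (ε * b k ^ 2 / 2))
    (by positivity) (fun k Q => sum_nonneg fun _ _ => energy_nonneg _ _)
    (fun k Q => by
      calc ∑ c, energy (label p Q) (f c) ≤ ∑ _c : Fin m, (Fintype.card (V × V) : ℝ) :=
            sum_le_sum fun c _ => energy_le_card _ (f0 c) (f1 c)
        _ = m / κ * (κ * n ^ 2) := by
            rw [hcard]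
            simp only [sum_const, card_univ, Fintype.card_fin, nsmul_eq_mul]; field_simp
        _ ≤ _ := mul_le_mul_of_nonneg_right (Nat.le_ceil _) (by positivity))
    (fun k Q => by
      obtain ⟨Q', h1, h2⟩ := hG k V (V × V) p f f0 f1 Q
      exact ⟨Q', h2, h1⟩) (fun _ => 0)
  set π := label p Q
  set π' := label p Q'
  have hrl : ∀ ω ω', π' ω = π' ω' → π ω = π ω' := by
    intro ω ω' h
    rw [label_eq_iff] at h ⊢
    exact fun i => hr _ _ (h i)
  set s : V × V → ℝ := fun ω => ∑ c, (fiberAvg π' (f c) ω - fiberAvg π (f c) ω) ^ 2 with hs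
  have hs0 : ∀ ω, 0 ≤ s ω := fun ω => sum_nonneg fun _ _ => sq_nonneg _
  have hssum : ∑ ω, s ω ≤ κ * n ^ 2 := by
    rw [hs, sum_comm]
    simp_rw [sum_sq_fiberAvg_sub hrl, sum_sub_distrib]
    linarith
  have hbK : b K ≤ b k := by
    have : (k : ℝ) ≤ K := by exact_mod_cast hk
    exact div_le_div_of_nonneg_left hθ.le (by positivity) (by linarith)
  set B₁ : Finset (V × V) := {ω | ε ^ 2 / 4 < fiberAvg π s ω} with hB₁
  set B₂ : Finset (V × V) := {ω | fiberAvg π (f (P ω)) ω < θ / (4 * (m + 1))} with hB₂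
  set S : Finset V := {x | (#(cell Q (Q x)) : ℝ) < b k * n} with hS
  have c1 : (#B₁ : ℝ) ≤ θ / 4 * n ^ 2 := by
    have h := card_lt_fiberAvg_mul_le π hs0 (ε ^ 2 / 4)
    have h2 : (#B₁ : ℝ) * (ε ^ 2 / 4) ≤ θ / 4 * n ^ 2 * (ε ^ 2 / 4) := by
      refine (h.trans hssum).trans_eq ?_
      rw [hκ]; ring
    exact le_of_mul_le_mul_right h2 (by positivity)
  have c2 : (#B₂ : ℝ) ≤ θ / 4 * n ^ 2 := by
    have h1 : ∀ c, ∑ ω with fiberAvg π (f c) ω < θ / (4 * (m + 1)), f c ω ≤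
        θ / (4 * (m + 1)) * n ^ 2 := fun c => by
      rw [← hcard]; exact sum_fiberAvg_lt_le π (f c) (by positivity)
    have h2 : (#B₂ : ℝ) = ∑ c, ∑ ω with fiberAvg π (f c) ω < θ / (4 * (m + 1)), f c ω := by
      simp_rw [sum_filter]
      rw [sum_comm, hB₂, card_filter]
      push_cast
      refine sum_congr rfl fun ω _ => ?_
      rw [sum_eq_single (P ω)]
      · simp [hf]
      · intro c _ hc
        simp [hf, hc.symm]
      · simp
    rw [h2]
    calc _ ≤ ∑ _c : Fin m, θ / (4 * (m + 1)) * n ^ 2 := sum_le_sum fun c _ => h1 c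
      _ = θ / 4 * n ^ 2 * (m / (m + 1)) := by
        simp only [sum_const, card_univ, Fintype.card_fin, nsmul_eq_mul]; field_simp
      _ ≤ θ / 4 * n ^ 2 * 1 := by
        refine mul_le_mul_of_nonneg_left ?_ (by positivity)
        rw [div_le_one (by positivity)]; linarith
      _ = _ := mul_one _
  have c3 : (#S : ℝ) ≤ θ / 8 * n := by
    refine (card_small_cell_le Q (mul_nonneg (hb0 k).le hn0)).trans ?_
    calc (k : ℝ) * (b k * n) = θ / 8 * n * (k / (k + 1)) := by rw [hb]; field_simp
      _ ≤ θ / 8 * n * 1 := by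
        refine mul_le_mul_of_nonneg_left ?_ (by positivity)
        rw [div_le_one (by positivity)]; linarith
      _ = _ := mul_one _
  refine ⟨Fin.castLE hk ∘ Q, ?_⟩
  have hcell : ∀ x, cell (Fin.castLE hk ∘ Q) ((Fin.castLE hk ∘ Q) x) = cell Q (Q x) := by
    intro x; ext y; simp [mem_cell]
  intro B hB
  have hsub : B ⊆ (B₁ ∪ B₂) ∪ (S ×ˢ univ ∪ univ ×ˢ S) := by
    intro ω hω
    by_contra hcon
    simp only [mem_union, mem_product, mem_univ, and_true, true_and, not_or] at hcon
    obtain ⟨⟨n1, n2⟩, n3, n4⟩ := hcon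
    simp only [hB₁, hB₂, hS, mem_filter, mem_univ, true_and, not_lt] at n1 n2 n3 n4
    refine hB ω hω ⟨?_, ?_, fiberAvg π (f (P ω)) ω, n2, fiberAvg_le_one _ (f1 _) _, ?_⟩
    · rw [hcell]; exact (mul_le_mul_of_nonneg_right hbK hn0).trans n3
    · rw [hcell]; exact (mul_le_mul_of_nonneg_right hbK hn0).trans n4
    · rw [hcell, hcell]
      refine regOn_of_uniform hε (hU (P ω)) ω ?_ ?_
      · calc ε * b k ^ 2 / 2 * (Fintype.card V : ℝ) ^ 2 = ε / 2 * ((b k * n) * (b k * n)) := by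
              rw [← hn]; ring
          _ ≤ _ := by
              have := mul_nonneg (hb0 k).le hn0
              gcongr
      · refine le_trans ?_ n1
        simp only [fiberAvg]
        gcongr with ω' _
        exact single_le_sum (f := fun c => (fiberAvg π' (f c) ω' - fiberAvg π (f c) ω') ^ 2)
          (fun _ _ => sq_nonneg _) (mem_univ (P ω))
  have hle : #B ≤ #B₁ + #B₂ + (#S * Fintype.card V + Fintype.card V * #S) := by
    refine (card_le_card hsub).trans ((card_union_le _ _).trans (add_le_add (card_union_le _ _)
      ((card_union_le _ _).trans ?_)))
    simp [card_product]
  have hle' : (#B : ℝ) ≤ #B₁ + #B₂ + (#S * n + n * #S) := by rw [hn]; exact_mod_cast hle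
  have c4 := mul_le_mul_of_nonneg_right c3 hn0
  have : 0 ≤ θ * n ^ 2 := by positivity
  nlinarith

section Counting

lemma mul_mem_unit {a b : ℝ} (ha : 0 ≤ a ∧ a ≤ 1) (hb : 0 ≤ b ∧ b ≤ 1) :
    0 ≤ a * b ∧ a * b ≤ 1 :=
  ⟨mul_nonneg ha.1 hb.1, mul_le_one₀ ha.2 hb.1 hb.2⟩

variable {V : Type}

lemma RegOn.abs_sum_le {ι : Type*} {ε e : ℝ} {A B : Finset V} {D : V → V → ℝ}
    (h : RegOn ε A B D e) (J : Finset ι) {U W : V → ι → ℝ} (hU : ∀ x j, 0 ≤ U x j ∧ U x j ≤ 1)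
    (hW : ∀ x j, 0 ≤ W x j ∧ W x j ≤ 1) :
    |∑ j ∈ J, ∑ x ∈ A, ∑ y ∈ B, (D x y - e) * (U x j * W y j)| ≤ ε * (#A * #B) * #J := by
  calc _ ≤ ∑ j ∈ J, ε * (#A * #B) := (abs_sum_le_sum_abs _ _).trans
        (sum_le_sum fun j _ => h (U · j) (W · j) (hU · j) (hW · j))
    _ = _ := by rw [sum_const, nsmul_eq_mul, mul_comm]

lemma sum_rotate (A B C : Finset V) (F : V → V → V → ℝ) :
    ∑ x ∈ A, ∑ y ∈ B, ∑ z ∈ C, F x y z = ∑ z ∈ C, ∑ x ∈ A, ∑ y ∈ B, F x y z :=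
  (sum_congr rfl fun _ _ => sum_comm).trans sum_comm

lemma triangle_count {ε a b c : ℝ} {A B C : Finset V} {D₁ D₂ D₃ : V → V → ℝ}
    (hD₂ : ∀ x y, 0 ≤ D₂ x y ∧ D₂ x y ≤ 1)
    (hD₃ : ∀ x y, 0 ≤ D₃ x y ∧ D₃ x y ≤ 1) (h₁ : RegOn ε A B D₁ a) (h₂ : RegOn ε A C D₂ b)
    (h₃ : RegOn ε B C D₃ c) (ha : 0 ≤ a ∧ a ≤ 1) (hb : 0 ≤ b ∧ b ≤ 1) :
    (a * b * c - 3 * ε) * (#A * #B * #C) ≤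
      ∑ x ∈ A, ∑ y ∈ B, ∑ z ∈ C, D₁ x y * D₂ x z * D₃ y z := by
  have t₁ : |∑ x ∈ A, ∑ y ∈ B, ∑ z ∈ C, (D₁ x y - a) * (D₂ x z * D₃ y z)| ≤
      ε * (#A * #B) * #C := by
    rw [sum_rotate]
    exact h₁.abs_sum_le C hD₂ hD₃
  have t₂ : |∑ x ∈ A, ∑ y ∈ B, ∑ z ∈ C, (D₂ x z - b) * (a * D₃ y z)| ≤
      ε * (#A * #C) * #B := by
    rw [sum_comm]
    exact h₂.abs_sum_le B (U := fun _ _ => a) (W := fun z y => D₃ y z) (fun _ _ => ha)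
      fun z y => hD₃ y z
  have t₃ : |∑ x ∈ A, ∑ y ∈ B, ∑ z ∈ C, (D₃ y z - c) * (a * b)| ≤
      ε * (#B * #C) * #A :=
    h₃.abs_sum_le A (U := fun _ _ => a) (W := fun _ _ => b) (fun _ _ => ha) fun _ _ => hb
  have key : ∑ x ∈ A, ∑ y ∈ B, ∑ z ∈ C, D₁ x y * D₂ x z * D₃ y z =
      ∑ x ∈ A, ∑ y ∈ B, ∑ z ∈ C, (D₁ x y - a) * (D₂ x z * D₃ y z) +
      ∑ x ∈ A, ∑ y ∈ B, ∑ z ∈ C, (D₂ x z - b) * (a * D₃ y z) +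
      ∑ x ∈ A, ∑ y ∈ B, ∑ z ∈ C, (D₃ y z - c) * (a * b) +
      ∑ _x ∈ A, ∑ _y ∈ B, ∑ _z ∈ C, a * b * c := by
    simp_rw [← sum_add_distrib]
    refine sum_congr rfl fun x _ => sum_congr rfl fun y _ => sum_congr rfl fun z _ => ?_
    ring
  have key₂ : ∑ _x ∈ A, ∑ _y ∈ B, ∑ _z ∈ C, a * b * c = a * b * c * (#A * #B * #C) := by
    simp only [sum_const, nsmul_eq_mul]
    ring
  rw [key, key₂]
  have := neg_le_of_abs_le t₁
  have := neg_le_of_abs_le t₂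
  have := neg_le_of_abs_le t₃
  linarith

lemma sum_comm_yzxt (A B C E : Finset V) (F : V → V → V → V → ℝ) :
    ∑ x ∈ A, ∑ y ∈ B, ∑ z ∈ C, ∑ t ∈ E, F x y z t =
      ∑ j ∈ B ×ˢ C, ∑ x ∈ A, ∑ t ∈ E, F x j.1 j.2 t := by
  simp_rw [← sum_product' B C]
  rw [sum_comm]

lemma sum_comm_xzyt (A B C E : Finset V) (F : V → V → V → V → ℝ) :
    ∑ x ∈ A, ∑ y ∈ B, ∑ z ∈ C, ∑ t ∈ E, F x y z t =
      ∑ j ∈ A ×ˢ C, ∑ y ∈ B, ∑ t ∈ E, F j.1 y j.2 t := by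
  rw [sum_product]
  exact sum_congr rfl fun x _ => sum_comm

lemma star_count {ε a b c : ℝ} {A B C E : Finset V} {D₁ D₂ D₃ : V → V → ℝ} {φ : V → V → V → ℝ}
    (hφ : ∀ x y z, 0 ≤ φ x y z ∧ φ x y z ≤ 1)
    (hD₂ : ∀ x y, 0 ≤ D₂ x y ∧ D₂ x y ≤ 1)
    (hD₃ : ∀ x y, 0 ≤ D₃ x y ∧ D₃ x y ≤ 1) (h₁ : RegOn ε A E D₁ a) (h₂ : RegOn ε B E D₂ b)
    (h₃ : RegOn ε C E D₃ c) (ha : 0 ≤ a ∧ a ≤ 1) (hb : 0 ≤ b ∧ b ≤ 1) :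
    |∑ x ∈ A, ∑ y ∈ B, ∑ z ∈ C, ∑ t ∈ E, φ x y z * (D₁ x t * D₂ y t * D₃ z t) -
      a * b * c * #E * ∑ x ∈ A, ∑ y ∈ B, ∑ z ∈ C, φ x y z| ≤
      3 * ε * (#A * #B * #C * #E) := by
  have t₁ : |∑ x ∈ A, ∑ y ∈ B, ∑ z ∈ C, ∑ t ∈ E,
      (D₁ x t - a) * (φ x y z * (D₂ y t * D₃ z t))| ≤ ε * (#A * #E) * #(B ×ˢ C) := by
    rw [sum_comm_yzxt]
    exact h₁.abs_sum_le (B ×ˢ C) (U := fun x j => φ x j.1 j.2)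
      (W := fun t j => D₂ j.1 t * D₃ j.2 t) (fun _ _ => hφ _ _ _)
      fun _ _ => mul_mem_unit (hD₂ _ _) (hD₃ _ _)
  have t₂ : |∑ x ∈ A, ∑ y ∈ B, ∑ z ∈ C, ∑ t ∈ E,
      (D₂ y t - b) * (a * φ x y z * D₃ z t)| ≤ ε * (#B * #E) * #(A ×ˢ C) := by
    rw [sum_comm_xzyt]
    exact h₂.abs_sum_le (A ×ˢ C) (U := fun y j => a * φ j.1 y j.2)
      (W := fun t j => D₃ j.2 t) (fun _ _ => mul_mem_unit ha (hφ _ _ _))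
      fun _ _ => hD₃ _ _
  have t₃ : |∑ x ∈ A, ∑ y ∈ B, ∑ z ∈ C, ∑ t ∈ E,
      (D₃ z t - c) * (a * φ x y z * b)| ≤ ε * (#C * #E) * #(A ×ˢ B) := by
    rw [← sum_product' A B]
    exact h₃.abs_sum_le (A ×ˢ B) (U := fun z j => a * φ j.1 j.2 z)
      (W := fun _ _ => b) (fun _ _ => mul_mem_unit ha (hφ _ _ _))
      fun _ _ => hb
  have key : ∑ x ∈ A, ∑ y ∈ B, ∑ z ∈ C, ∑ t ∈ E, φ x y z * (D₁ x t * D₂ y t * D₃ z t) =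
      ∑ x ∈ A, ∑ y ∈ B, ∑ z ∈ C, ∑ t ∈ E, (D₁ x t - a) * (φ x y z * (D₂ y t * D₃ z t)) +
      ∑ x ∈ A, ∑ y ∈ B, ∑ z ∈ C, ∑ t ∈ E, (D₂ y t - b) * (a * φ x y z * D₃ z t) +
      ∑ x ∈ A, ∑ y ∈ B, ∑ z ∈ C, ∑ t ∈ E, (D₃ z t - c) * (a * φ x y z * b) +
      ∑ x ∈ A, ∑ y ∈ B, ∑ z ∈ C, ∑ _t ∈ E, a * b * c * φ x y z := by
    simp_rw [← sum_add_distrib]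
    refine sum_congr rfl fun x _ => sum_congr rfl fun y _ => sum_congr rfl fun z _ =>
      sum_congr rfl fun t _ => ?_
    ring
  have key₂ : ∑ x ∈ A, ∑ y ∈ B, ∑ z ∈ C, ∑ _t ∈ E, a * b * c * φ x y z =
      a * b * c * #E * ∑ x ∈ A, ∑ y ∈ B, ∑ z ∈ C, φ x y z := by
    simp_rw [sum_const, nsmul_eq_mul, mul_sum]
    refine sum_congr rfl fun x _ => sum_congr rfl fun y _ => sum_congr rfl fun z _ => ?_
    ring
  rw [key, key₂, add_sub_cancel_right]
  refine (abs_add_three _ _ _).trans ?_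
  rw [card_product] at t₁ t₂ t₃
  push_cast at t₁ t₂ t₃
  linarith

/-- Passing to a common neighbour of all three vertices keeps a bad set of triples sparse. -/
lemma star_density {ε a b c : ℝ} {A B C E : Finset V} {D₁ D₂ D₃ : V → V → ℝ}
    {φ ψ : V → V → V → ℝ} (hε : 0 ≤ ε)
    (hφ : ∀ x y z, 0 ≤ φ x y z ∧ φ x y z ≤ 1) (hψ : ∀ x y z, 0 ≤ ψ x y z ∧ ψ x y z ≤ 1)
    (hD₂ : ∀ x y, 0 ≤ D₂ x y ∧ D₂ x y ≤ 1)
    (hD₃ : ∀ x y, 0 ≤ D₃ x y ∧ D₃ x y ≤ 1) (h₁ : RegOn ε A E D₁ a) (h₂ : RegOn ε B E D₂ b)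
    (h₃ : RegOn ε C E D₃ c) (ha : 0 ≤ a ∧ a ≤ 1) (hb : 0 ≤ b ∧ b ≤ 1) (hc : 0 ≤ c)
    (h : ∑ x ∈ A, ∑ y ∈ B, ∑ z ∈ C, ψ x y z ≤ 1 / 8 * ∑ x ∈ A, ∑ y ∈ B, ∑ z ∈ C, φ x y z) :
    ∑ x ∈ A, ∑ y ∈ B, ∑ z ∈ C, ∑ t ∈ E, ψ x y z * (D₁ x t * D₂ y t * D₃ z t) ≤
      1 / 8 * ∑ x ∈ A, ∑ y ∈ B, ∑ z ∈ C, ∑ t ∈ E, φ x y z * (D₁ x t * D₂ y t * D₃ z t) +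
        4 * ε * (#A * #B * #C * #E) := by
  have h₄ := abs_le.1 (star_count hφ hD₂ hD₃ h₁ h₂ h₃ ha hb)
  have h₅ := abs_le.1 (star_count hψ hD₂ hD₃ h₁ h₂ h₃ ha hb)
  have h₆ : 0 ≤ a * b * c * #E := mul_nonneg (mul_nonneg (mul_nonneg ha.1 hb.1) hc)
    (Nat.cast_nonneg _)
  have h₇ := mul_le_mul_of_nonneg_left h h₆
  have h₈ : 0 ≤ ε * ((#A : ℝ) * #B * #C * #E) := by positivity
  linarith [h₄.1, h₅.2]

/-- In a regular four-partite configuration most copies of `K₄` avoid bad triples. -/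
lemma k4_count {ε τ : ℝ} (hε : 0 ≤ ε) (hτ : 0 ≤ τ) {A : Fin 4 → Finset V}
    {D : Fin 4 → Fin 4 → V → V → ℝ} {e : Fin 4 → Fin 4 → ℝ} {B : V → V → V → ℝ}
    (hD : ∀ i j x y, 0 ≤ D i j x y ∧ D i j x y ≤ 1)
    (hreg : ∀ i j, i < j → RegOn ε (A i) (A j) (D i j) (e i j))
    (he : ∀ i j, i < j → τ ≤ e i j ∧ e i j ≤ 1)
    (hB : ∀ x y z, 0 ≤ B x y z ∧ B x y z ≤ 1)
    (hBD : ∀ i j k, i < j → j < k →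
      ∑ x ∈ A i, ∑ y ∈ A j, ∑ z ∈ A k, B x y z * (D i j x y * D i k x z * D j k y z) ≤
        1 / 8 * ∑ x ∈ A i, ∑ y ∈ A j, ∑ z ∈ A k, D i j x y * D i k x z * D j k y z) :
    (τ ^ 6 / 2 - 19 * ε) * (#(A 0) * #(A 1) * #(A 2) * #(A 3)) ≤
      ∑ x ∈ A 0, ∑ y ∈ A 1, ∑ z ∈ A 2, ∑ t ∈ A 3,
        (1 - B x y z - B x y t - B x z t - B y z t) *
          (D 0 1 x y * D 0 2 x z * D 0 3 x t * D 1 2 y z * D 1 3 y t * D 2 3 z t) := by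
  have he' : ∀ i j, i < j → 0 ≤ e i j ∧ e i j ≤ 1 := fun i j h =>
    ⟨hτ.trans (he i j h).1, (he i j h).2⟩
  have hφ : ∀ i j k x y z, 0 ≤ D i j x y * D i k x z * D j k y z ∧
      D i j x y * D i k x z * D j k y z ≤ 1 := fun i j k x y z =>
    mul_mem_unit (mul_mem_unit (hD _ _ _ _) (hD _ _ _ _)) (hD _ _ _ _)
  have hψ : ∀ i j k x y z, 0 ≤ B x y z * (D i j x y * D i k x z * D j k y z) ∧
      B x y z * (D i j x y * D i k x z * D j k y z) ≤ 1 := fun i j k x y z =>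
    mul_mem_unit (hB _ _ _) (hφ _ _ _ _ _ _)
  set K : V → V → V → V → ℝ := fun x y z t =>
    D 0 1 x y * D 0 2 x z * D 0 3 x t * D 1 2 y z * D 1 3 y t * D 2 3 z t with hK
  set T := ∑ x ∈ A 0, ∑ y ∈ A 1, ∑ z ∈ A 2, ∑ t ∈ A 3, K x y z t with hT
  set M : ℝ := (#(A 0) : ℝ) * #(A 1) * #(A 2) * #(A 3) with hM
  have hM0 : 0 ≤ M := by positivity
  have l01 : (0 : Fin 4) < 1 := by decide
  have l02 : (0 : Fin 4) < 2 := by decide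
  have l03 : (0 : Fin 4) < 3 := by decide
  have l12 : (1 : Fin 4) < 2 := by decide
  have l13 : (1 : Fin 4) < 3 := by decide
  have l23 : (2 : Fin 4) < 3 := by decide
  have b₁ : ∑ x ∈ A 0, ∑ y ∈ A 1, ∑ z ∈ A 2, ∑ t ∈ A 3, B x y z * K x y z t ≤
      1 / 8 * T + 4 * ε * M := by
    have h := star_density (E := A 3) hε (hφ 0 1 2) (hψ 0 1 2) (hD 1 3) (hD 2 3)
      (hreg 0 3 l03) (hreg 1 3 l13) (hreg 2 3 l23) (he' 0 3 l03) (he' 1 3 l13) (he' 2 3 l23).1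
      (hBD 0 1 2 l01 l12)
    refine le_of_eq_of_le ?_ (h.trans_eq ?_)
    · refine sum_congr rfl fun x _ => sum_congr rfl fun y _ => sum_congr rfl fun z _ =>
        sum_congr rfl fun t _ => ?_
      simp only [hK]; ring
    · congr 2
      refine sum_congr rfl fun x _ => sum_congr rfl fun y _ => sum_congr rfl fun z _ =>
        sum_congr rfl fun t _ => ?_
      simp only [hK]; ring
  have b₂ : ∑ x ∈ A 0, ∑ y ∈ A 1, ∑ z ∈ A 2, ∑ t ∈ A 3, B x y t * K x y z t ≤
      1 / 8 * T + 4 * ε * M := by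
    have h := star_density (E := A 2) hε (hφ 0 1 3) (hψ 0 1 3) (hD 1 2) (fun x y => hD 2 3 y x)
      (hreg 0 2 l02) (hreg 1 2 l12) (hreg 2 3 l23).flip (he' 0 2 l02) (he' 1 2 l12)
      (he' 2 3 l23).1 (hBD 0 1 3 l01 l13)
    have o : ∀ F : V → V → V → V → ℝ, ∑ x ∈ A 0, ∑ y ∈ A 1, ∑ t ∈ A 3, ∑ z ∈ A 2, F x y z t =
        ∑ x ∈ A 0, ∑ y ∈ A 1, ∑ z ∈ A 2, ∑ t ∈ A 3, F x y z t := fun F =>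
      sum_congr rfl fun x _ => sum_congr rfl fun y _ => sum_comm
    rw [hT, ← o, ← o K]
    refine le_of_eq_of_le ?_ (h.trans_eq ?_)
    · refine sum_congr rfl fun x _ => sum_congr rfl fun y _ => sum_congr rfl fun z _ =>
        sum_congr rfl fun t _ => ?_
      simp only [hK]; ring
    · congr 1
      · congr 1
        refine sum_congr rfl fun x _ => sum_congr rfl fun y _ => sum_congr rfl fun z _ =>
          sum_congr rfl fun t _ => ?_
        simp only [hK]; ring
      · rw [hM]; ring
  have b₃ : ∑ x ∈ A 0, ∑ y ∈ A 1, ∑ z ∈ A 2, ∑ t ∈ A 3, B x z t * K x y z t ≤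
      1 / 8 * T + 4 * ε * M := by
    have h := star_density (E := A 1) hε (hφ 0 2 3) (hψ 0 2 3) (fun x y => hD 1 2 y x)
      (fun x y => hD 1 3 y x) (hreg 0 1 l01) (hreg 1 2 l12).flip (hreg 1 3 l13).flip
      (he' 0 1 l01) (he' 1 2 l12) (he' 1 3 l13).1 (hBD 0 2 3 l02 l23)
    have o : ∀ F : V → V → V → V → ℝ, ∑ x ∈ A 0, ∑ z ∈ A 2, ∑ t ∈ A 3, ∑ y ∈ A 1, F x y z t =
        ∑ x ∈ A 0, ∑ y ∈ A 1, ∑ z ∈ A 2, ∑ t ∈ A 3, F x y z t := fun F =>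
      sum_congr rfl fun x _ => sum_rotate (A 2) (A 3) (A 1) fun z t y => F x y z t
    rw [hT, ← o, ← o K]
    refine le_of_eq_of_le ?_ (h.trans_eq ?_)
    · refine sum_congr rfl fun x _ => sum_congr rfl fun y _ => sum_congr rfl fun z _ =>
        sum_congr rfl fun t _ => ?_
      simp only [hK]; ring
    · congr 1
      · congr 1
        refine sum_congr rfl fun x _ => sum_congr rfl fun y _ => sum_congr rfl fun z _ =>
          sum_congr rfl fun t _ => ?_
        simp only [hK]; ring
      · rw [hM]; ring
  have b₄ : ∑ x ∈ A 0, ∑ y ∈ A 1, ∑ z ∈ A 2, ∑ t ∈ A 3, B y z t * K x y z t ≤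
      1 / 8 * T + 4 * ε * M := by
    have h := star_density (E := A 0) hε (hφ 1 2 3) (hψ 1 2 3) (fun x y => hD 0 2 y x)
      (fun x y => hD 0 3 y x) (hreg 0 1 l01).flip (hreg 0 2 l02).flip (hreg 0 3 l03).flip
      (he' 0 1 l01) (he' 0 2 l02) (he' 0 3 l03).1 (hBD 1 2 3 l12 l23)
    have o : ∀ F : V → V → V → V → ℝ, ∑ y ∈ A 1, ∑ z ∈ A 2, ∑ t ∈ A 3, ∑ x ∈ A 0, F x y z t =
        ∑ x ∈ A 0, ∑ y ∈ A 1, ∑ z ∈ A 2, ∑ t ∈ A 3, F x y z t := fun F =>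
      (sum_congr rfl fun y _ => sum_rotate (A 2) (A 3) (A 0) fun z t x => F x y z t).trans
        sum_comm
    rw [hT, ← o, ← o K]
    refine le_of_eq_of_le ?_ (h.trans_eq ?_)
    · refine sum_congr rfl fun x _ => sum_congr rfl fun y _ => sum_congr rfl fun z _ =>
        sum_congr rfl fun t _ => ?_
      simp only [hK]; ring
    · congr 1
      · congr 1
        refine sum_congr rfl fun x _ => sum_congr rfl fun y _ => sum_congr rfl fun z _ =>
          sum_congr rfl fun t _ => ?_
        simp only [hK]; ring
      · rw [hM]; ring
  have hTM : (τ ^ 6 - 6 * ε) * M ≤ T := by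
    have h₁ := triangle_count (hD 0 2) (hD 1 2) (hreg 0 1 l01) (hreg 0 2 l02) (hreg 1 2 l12)
      (he' 0 1 l01) (he' 0 2 l02)
    have h₂ := (abs_le.1 (star_count (hφ 0 1 2) (hD 1 3) (hD 2 3) (hreg 0 3 l03) (hreg 1 3 l13)
      (hreg 2 3 l23) (he' 0 3 l03) (he' 1 3 l13))).1
    have h₃ : ∑ x ∈ A 0, ∑ y ∈ A 1, ∑ z ∈ A 2, ∑ t ∈ A 3,
        D 0 1 x y * D 0 2 x z * D 1 2 y z * (D 0 3 x t * D 1 3 y t * D 2 3 z t) = T := by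
      refine sum_congr rfl fun x _ => sum_congr rfl fun y _ => sum_congr rfl fun z _ =>
        sum_congr rfl fun t _ => ?_
      simp only [hK]; ring
    rw [h₃] at h₂
    have hq := mul_mem_unit (mul_mem_unit (he' 0 3 l03) (he' 1 3 l13)) (he' 2 3 l23)
    set q := e 0 3 * e 1 3 * e 2 3
    have h₄ := mul_le_mul_of_nonneg_left h₁ (mul_nonneg hq.1 (Nat.cast_nonneg (α := ℝ) #(A 3)))
    have h₅ : q * (3 * ε * M) ≤ 3 * ε * M := mul_le_of_le_one_left (by positivity) hq.2
    have h₆ : τ ^ 6 ≤ q * (e 0 1 * e 0 2 * e 1 2) := by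
      have g : ∀ i j, i < j → τ ≤ e i j := fun i j h => (he i j h).1
      have g' : ∀ i j, i < j → 0 ≤ e i j := fun i j h => (he' i j h).1
      calc τ ^ 6 = τ * τ * τ * (τ * τ * τ) := by ring
        _ ≤ e 0 3 * e 1 3 * e 2 3 * (e 0 1 * e 0 2 * e 1 2) := by
          have := g 0 1 l01
          have := g 0 2 l02
          have := g 0 3 l03
          have := g 1 2 l12
          have := g 1 3 l13
          have := g 2 3 l23
          have := g' 0 1 l01
          have := g' 0 2 l02
          have := g' 0 3 l03
          have := g' 1 2 l12
          have := g' 1 3 l13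
          have := g' 2 3 l23
          gcongr
    have h₇ := mul_le_mul_of_nonneg_right h₆ hM0
    have h₈ : q * #(A 3) * ((e 0 1 * e 0 2 * e 1 2 - 3 * ε) * (#(A 0) * #(A 1) * #(A 2))) =
        q * (e 0 1 * e 0 2 * e 1 2) * M - q * (3 * ε * M) := by rw [hM]; ring
    linarith
  have key : ∑ x ∈ A 0, ∑ y ∈ A 1, ∑ z ∈ A 2, ∑ t ∈ A 3,
      (1 - B x y z - B x y t - B x z t - B y z t) * K x y z t = T -
      ∑ x ∈ A 0, ∑ y ∈ A 1, ∑ z ∈ A 2, ∑ t ∈ A 3, B x y z * K x y z t -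
      ∑ x ∈ A 0, ∑ y ∈ A 1, ∑ z ∈ A 2, ∑ t ∈ A 3, B x y t * K x y z t -
      ∑ x ∈ A 0, ∑ y ∈ A 1, ∑ z ∈ A 2, ∑ t ∈ A 3, B x z t * K x y z t -
      ∑ x ∈ A 0, ∑ y ∈ A 1, ∑ z ∈ A 2, ∑ t ∈ A 3, B y z t * K x y z t := by
    simp_rw [hT, ← sum_sub_distrib]
    refine sum_congr rfl fun x _ => sum_congr rfl fun y _ => sum_congr rfl fun z _ =>
      sum_congr rfl fun t _ => ?_
    ring
  rw [key]
  linarith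

lemma abs_sum_cell_le [Fintype V] {f g : V → V → V → ℝ} {ε : ℝ}
    (hU : ∀ u v w : V → V → ℝ, (∀ x y, 0 ≤ u x y ∧ u x y ≤ 1) → (∀ x y, 0 ≤ v x y ∧ v x y ≤ 1) →
      (∀ x y, 0 ≤ w x y ∧ w x y ≤ 1) →
      |∑ x, ∑ y, ∑ z, (f x y z - g x y z) * (u x y * v x z * w y z)| ≤
        ε * Fintype.card V ^ 3)
    (A B C E : Finset V) {u v w : V → V → V → ℝ} (hu : ∀ t x y, 0 ≤ u t x y ∧ u t x y ≤ 1)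
    (hv : ∀ t x y, 0 ≤ v t x y ∧ v t x y ≤ 1) (hw : ∀ t x y, 0 ≤ w t x y ∧ w t x y ≤ 1) :
    |∑ t ∈ E, ∑ x ∈ A, ∑ y ∈ B, ∑ z ∈ C,
      (f x y z - g x y z) * (u t x y * v t x z * w t y z)| ≤ ε * Fintype.card V ^ 4 := by
  classical
  have hε : 0 ≤ ε * (Fintype.card V : ℝ) ^ 3 :=
    (abs_nonneg _).trans (hU (u := fun _ _ => 0) (v := fun _ _ => 0) (w := fun _ _ => 0)
      (by simp) (by simp) (by simp))
  have hind : ∀ (p : Prop) [Decidable p] (a : ℝ), 0 ≤ a ∧ a ≤ 1 →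
      0 ≤ (if p then a else 0) ∧ (if p then a else 0) ≤ 1 := by
    intro p _ a ha
    split_ifs
    · exact ha
    · norm_num
  calc _ ≤ ∑ t ∈ E, ε * (Fintype.card V : ℝ) ^ 3 := by
        refine (abs_sum_le_sum_abs _ _).trans (sum_le_sum fun t _ => ?_)
        have h := hU (fun x y => if x ∈ A then u t x y else 0)
          (fun x z => if z ∈ C then v t x z else 0) (fun y z => if y ∈ B then w t y z else 0)
          (fun x y => hind _ _ (hu t x y)) (fun x y => hind _ _ (hv t x y))
          (fun x y => hind _ _ (hw t x y))
        refine le_of_eq_of_le (congrArg _ ?_) h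
        rw [← Fintype.sum_extend_by_zero]
        refine sum_congr rfl fun x _ => ?_
        by_cases hx : x ∈ A
        · rw [if_pos hx, ← Fintype.sum_extend_by_zero]
          refine sum_congr rfl fun y _ => ?_
          by_cases hy : y ∈ B
          · rw [if_pos hy, ← Fintype.sum_extend_by_zero]
            refine sum_congr rfl fun z _ => ?_
            by_cases hz : z ∈ C <;> simp [hx, hy, hz]
          · simp [hy]
        · simp [hx]
    _ = #E * (ε * (Fintype.card V : ℝ) ^ 3) := by rw [sum_const, nsmul_eq_mul]
    _ ≤ Fintype.card V * (ε * (Fintype.card V : ℝ) ^ 3) := by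
        refine mul_le_mul_of_nonneg_right ?_ hε
        exact_mod_cast card_le_univ E
    _ = _ := by ring

/-- Counting lemma for simplices in a regular configuration. -/
lemma simplex_count [Fintype V] {ε ε' τ δ : ℝ} (hε : 0 ≤ ε) (hτ : 0 ≤ τ) (hδ : 0 ≤ δ)
    {A : Fin 4 → Finset V}
    {D : Fin 4 → Fin 4 → V → V → ℝ} {e : Fin 4 → Fin 4 → ℝ} {f g : V → V → V → ℝ}
    (hf : ∀ x y z, 0 ≤ f x y z ∧ f x y z ≤ 1) (hg : ∀ x y z, 0 ≤ g x y z ∧ g x y z ≤ 1)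
    (hU : ∀ u v w : V → V → ℝ, (∀ x y, 0 ≤ u x y ∧ u x y ≤ 1) → (∀ x y, 0 ≤ v x y ∧ v x y ≤ 1) →
      (∀ x y, 0 ≤ w x y ∧ w x y ≤ 1) →
      |∑ x, ∑ y, ∑ z, (f x y z - g x y z) * (u x y * v x z * w y z)| ≤
        ε' * Fintype.card V ^ 3)
    (hD : ∀ i j x y, 0 ≤ D i j x y ∧ D i j x y ≤ 1)
    (hreg : ∀ i j, i < j → RegOn ε (A i) (A j) (D i j) (e i j))
    (he : ∀ i j, i < j → τ ≤ e i j ∧ e i j ≤ 1)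
    (hBD : ∀ i j k, i < j → j < k →
      ∑ x ∈ A i, ∑ y ∈ A j, ∑ z ∈ A k,
        (if g x y z < δ then 1 else 0) * (D i j x y * D i k x z * D j k y z) ≤
        1 / 8 * ∑ x ∈ A i, ∑ y ∈ A j, ∑ z ∈ A k, D i j x y * D i k x z * D j k y z) :
    δ ^ 4 * ((τ ^ 6 / 2 - 19 * ε) * (#(A 0) * #(A 1) * #(A 2) * #(A 3))) -
        4 * (ε' * Fintype.card V ^ 4) ≤
      ∑ x, ∑ y, ∑ z, ∑ t, f x y z * f x y t * f x z t * f y z t := by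
  set B : V → V → V → ℝ := fun x y z => if g x y z < δ then 1 else 0 with hB
  have hB01 : ∀ x y z, 0 ≤ B x y z ∧ B x y z ≤ 1 := by
    intro x y z; simp only [hB]; split_ifs <;> norm_num
  have hk4 := mul_le_mul_of_nonneg_left (k4_count hε hτ hD hreg he hB01 hBD) (pow_nonneg hδ 4)
  set K : V → V → V → V → ℝ := fun x y z t =>
    D 0 1 x y * D 0 2 x z * D 0 3 x t * D 1 2 y z * D 1 3 y t * D 2 3 z t with hK
  have hK01 : ∀ x y z t, 0 ≤ K x y z t ∧ K x y z t ≤ 1 := fun x y z t =>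
    mul_mem_unit (mul_mem_unit (mul_mem_unit (mul_mem_unit (mul_mem_unit (hD _ _ _ _)
      (hD _ _ _ _)) (hD _ _ _ _)) (hD _ _ _ _)) (hD _ _ _ _)) (hD _ _ _ _)
  have hlow : δ ^ 4 * ∑ x ∈ A 0, ∑ y ∈ A 1, ∑ z ∈ A 2, ∑ t ∈ A 3,
      (1 - B x y z - B x y t - B x z t - B y z t) * K x y z t ≤
      ∑ x ∈ A 0, ∑ y ∈ A 1, ∑ z ∈ A 2, ∑ t ∈ A 3,
        (g x y z * g x y t * g x z t * g y z t) * K x y z t := by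
    simp_rw [mul_sum]
    refine sum_le_sum fun x _ => sum_le_sum fun y _ => sum_le_sum fun z _ =>
      sum_le_sum fun t _ => ?_
    rw [← mul_assoc]
    refine mul_le_mul_of_nonneg_right ?_ (hK01 x y z t).1
    have hgood : ∀ a b c, B a b c = 0 → δ ≤ g a b c := by
      intro a b c h
      by_contra hlt
      simp [hB, not_le.1 hlt] at h
    have hbad : ∀ a b c, B a b c = 0 ∨ B a b c = 1 := by
      intro a b c; simp only [hB]; split_ifs <;> simp
    have hg0 : 0 ≤ g x y z * g x y t * g x z t * g y z t :=
      mul_nonneg (mul_nonneg (mul_nonneg (hg _ _ _).1 (hg _ _ _).1) (hg _ _ _).1) (hg _ _ _).1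
    by_cases hall : B x y z = 0 ∧ B x y t = 0 ∧ B x z t = 0 ∧ B y z t = 0
    · obtain ⟨h₁, h₂, h₃, h₄⟩ := hall
      rw [h₁, h₂, h₃, h₄]
      have h₁ := hgood _ _ _ h₁
      have h₂ := hgood _ _ _ h₂
      have h₃ := hgood _ _ _ h₃
      have h₄ := hgood _ _ _ h₄
      calc δ ^ 4 * (1 - 0 - 0 - 0 - 0) = δ * δ * δ * δ := by ring
        _ ≤ g x y z * g x y t * g x z t * g y z t := by
          have := (hg x y z).1
          have := (hg x y t).1
          have := (hg x z t).1
          gcongr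
    · refine (mul_nonpos_of_nonneg_of_nonpos (pow_nonneg hδ 4) ?_).trans hg0
      have h₁ := (hB01 x y z).1
      have h₂ := (hB01 x y t).1
      have h₃ := (hB01 x z t).1
      have h₄ := (hB01 y z t).1
      rcases hbad x y z with h | h
      · rcases hbad x y t with h' | h'
        · rcases hbad x z t with h'' | h''
          · rcases hbad y z t with h''' | h'''
            · exact absurd ⟨h, h', h'', h'''⟩ hall
            · linarith
          · linarith
        · linarith
      · linarith
  have s₁ := abs_sum_cell_le hU (A 0) (A 1) (A 2) (A 3)
    (u := fun t x y => f x y t * D 0 1 x y) (v := fun t x z => f x z t * (D 0 2 x z * D 0 3 x t))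
    (w := fun t y z => f y z t * (D 1 2 y z * (D 1 3 y t * D 2 3 z t)))
    (fun _ _ _ => mul_mem_unit (hf _ _ _) (hD _ _ _ _))
    (fun _ _ _ => mul_mem_unit (hf _ _ _) (mul_mem_unit (hD _ _ _ _) (hD _ _ _ _)))
    (fun _ _ _ => mul_mem_unit (hf _ _ _)
      (mul_mem_unit (hD _ _ _ _) (mul_mem_unit (hD _ _ _ _) (hD _ _ _ _))))
  have s₂ := abs_sum_cell_le hU (A 0) (A 1) (A 3) (A 2)
    (u := fun z x y => g x y z * D 0 1 x y) (v := fun z x t => f x z t * (D 0 3 x t * D 0 2 x z))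
    (w := fun z y t => f y z t * (D 1 3 y t * (D 1 2 y z * D 2 3 z t)))
    (fun _ _ _ => mul_mem_unit (hg _ _ _) (hD _ _ _ _))
    (fun _ _ _ => mul_mem_unit (hf _ _ _) (mul_mem_unit (hD _ _ _ _) (hD _ _ _ _)))
    (fun _ _ _ => mul_mem_unit (hf _ _ _)
      (mul_mem_unit (hD _ _ _ _) (mul_mem_unit (hD _ _ _ _) (hD _ _ _ _))))
  have s₃ := abs_sum_cell_le hU (A 0) (A 2) (A 3) (A 1)
    (u := fun y x z => g x y z * (D 0 2 x z * D 0 1 x y)) (v := fun y x t => g x y t * D 0 3 x t)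
    (w := fun y z t => f y z t * (D 2 3 z t * (D 1 2 y z * D 1 3 y t)))
    (fun _ _ _ => mul_mem_unit (hg _ _ _) (mul_mem_unit (hD _ _ _ _) (hD _ _ _ _)))
    (fun _ _ _ => mul_mem_unit (hg _ _ _) (hD _ _ _ _))
    (fun _ _ _ => mul_mem_unit (hf _ _ _)
      (mul_mem_unit (hD _ _ _ _) (mul_mem_unit (hD _ _ _ _) (hD _ _ _ _))))
  have s₄ := abs_sum_cell_le hU (A 1) (A 2) (A 3) (A 0)
    (u := fun x y z => g x y z * (D 1 2 y z * (D 0 1 x y * D 0 2 x z)))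
    (v := fun x y t => g x y t * (D 1 3 y t * D 0 3 x t))
    (w := fun x z t => g x z t * D 2 3 z t)
    (fun _ _ _ => mul_mem_unit (hg _ _ _)
      (mul_mem_unit (hD _ _ _ _) (mul_mem_unit (hD _ _ _ _) (hD _ _ _ _))))
    (fun _ _ _ => mul_mem_unit (hg _ _ _) (mul_mem_unit (hD _ _ _ _) (hD _ _ _ _)))
    (fun _ _ _ => mul_mem_unit (hg _ _ _) (hD _ _ _ _))
  have o₁ : ∀ F : V → V → V → V → ℝ, ∑ t ∈ A 3, ∑ x ∈ A 0, ∑ y ∈ A 1, ∑ z ∈ A 2, F x y z t =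
      ∑ x ∈ A 0, ∑ y ∈ A 1, ∑ z ∈ A 2, ∑ t ∈ A 3, F x y z t := fun F => by
    rw [sum_comm]
    exact sum_congr rfl fun x _ => (sum_rotate (A 1) (A 2) (A 3) (F x)).symm
  have o₂ : ∀ F : V → V → V → V → ℝ, ∑ z ∈ A 2, ∑ x ∈ A 0, ∑ y ∈ A 1, ∑ t ∈ A 3, F x y z t =
      ∑ x ∈ A 0, ∑ y ∈ A 1, ∑ z ∈ A 2, ∑ t ∈ A 3, F x y z t := fun F =>
    (sum_rotate (A 0) (A 1) (A 2) fun x y z => ∑ t ∈ A 3, F x y z t).symm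
  have o₃ : ∀ F : V → V → V → V → ℝ, ∑ y ∈ A 1, ∑ x ∈ A 0, ∑ z ∈ A 2, ∑ t ∈ A 3, F x y z t =
      ∑ x ∈ A 0, ∑ y ∈ A 1, ∑ z ∈ A 2, ∑ t ∈ A 3, F x y z t := fun F => sum_comm
  rw [o₁] at s₁
  rw [o₂ fun x y z t => _] at s₂
  rw [o₃ fun x y z t => _] at s₃
  have key : ∑ x ∈ A 0, ∑ y ∈ A 1, ∑ z ∈ A 2, ∑ t ∈ A 3,
        (f x y z * f x y t * f x z t * f y z t) * K x y z t =
      ∑ x ∈ A 0, ∑ y ∈ A 1, ∑ z ∈ A 2, ∑ t ∈ A 3,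
        (g x y z * g x y t * g x z t * g y z t) * K x y z t +
      ∑ x ∈ A 0, ∑ y ∈ A 1, ∑ z ∈ A 2, ∑ t ∈ A 3, (f x y z - g x y z) *
        (f x y t * D 0 1 x y * (f x z t * (D 0 2 x z * D 0 3 x t)) *
          (f y z t * (D 1 2 y z * (D 1 3 y t * D 2 3 z t)))) +
      ∑ x ∈ A 0, ∑ y ∈ A 1, ∑ z ∈ A 2, ∑ t ∈ A 3, (f x y t - g x y t) *
        (g x y z * D 0 1 x y * (f x z t * (D 0 3 x t * D 0 2 x z)) *
          (f y z t * (D 1 3 y t * (D 1 2 y z * D 2 3 z t)))) +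
      ∑ x ∈ A 0, ∑ y ∈ A 1, ∑ z ∈ A 2, ∑ t ∈ A 3, (f x z t - g x z t) *
        (g x y z * (D 0 2 x z * D 0 1 x y) * (g x y t * D 0 3 x t) *
          (f y z t * (D 2 3 z t * (D 1 2 y z * D 1 3 y t)))) +
      ∑ x ∈ A 0, ∑ y ∈ A 1, ∑ z ∈ A 2, ∑ t ∈ A 3, (f y z t - g y z t) *
        (g x y z * (D 1 2 y z * (D 0 1 x y * D 0 2 x z)) *
          (g x y t * (D 1 3 y t * D 0 3 x t)) * (g x z t * D 2 3 z t)) := by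
    simp_rw [← sum_add_distrib]
    refine sum_congr rfl fun x _ => sum_congr rfl fun y _ => sum_congr rfl fun z _ =>
      sum_congr rfl fun t _ => ?_
    simp only [hK]
    ring
  have hf0 : ∀ x y z t, 0 ≤ f x y z * f x y t * f x z t * f y z t := fun x y z t =>
    mul_nonneg (mul_nonneg (mul_nonneg (hf _ _ _).1 (hf _ _ _).1) (hf _ _ _).1) (hf _ _ _).1
  have hup : ∑ x ∈ A 0, ∑ y ∈ A 1, ∑ z ∈ A 2, ∑ t ∈ A 3,
        (f x y z * f x y t * f x z t * f y z t) * K x y z t ≤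
      ∑ x, ∑ y, ∑ z, ∑ t, f x y z * f x y t * f x z t * f y z t := by
    calc _ ≤ ∑ x ∈ A 0, ∑ y ∈ A 1, ∑ z ∈ A 2, ∑ t ∈ A 3,
          f x y z * f x y t * f x z t * f y z t :=
        sum_le_sum fun x _ => sum_le_sum fun y _ => sum_le_sum fun z _ =>
          sum_le_sum fun t _ => mul_le_of_le_one_right (hf0 _ _ _ _) (hK01 _ _ _ _).2
      _ ≤ ∑ x, ∑ y ∈ A 1, ∑ z ∈ A 2, ∑ t ∈ A 3, f x y z * f x y t * f x z t * f y z t :=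
        sum_le_sum_of_subset_of_nonneg (subset_univ _) fun _ _ _ => sum_nonneg fun _ _ =>
          sum_nonneg fun _ _ => sum_nonneg fun _ _ => hf0 _ _ _ _
      _ ≤ ∑ x, ∑ y, ∑ z ∈ A 2, ∑ t ∈ A 3, f x y z * f x y t * f x z t * f y z t :=
        sum_le_sum fun _ _ => sum_le_sum_of_subset_of_nonneg (subset_univ _) fun _ _ _ =>
          sum_nonneg fun _ _ => sum_nonneg fun _ _ => hf0 _ _ _ _
      _ ≤ ∑ x, ∑ y, ∑ z, ∑ t ∈ A 3, f x y z * f x y t * f x z t * f y z t :=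
        sum_le_sum fun _ _ => sum_le_sum fun _ _ =>
          sum_le_sum_of_subset_of_nonneg (subset_univ _) fun _ _ _ =>
          sum_nonneg fun _ _ => hf0 _ _ _ _
      _ ≤ _ := sum_le_sum fun _ _ => sum_le_sum fun _ _ => sum_le_sum fun _ _ =>
          sum_le_sum_of_subset_of_nonneg (subset_univ _) fun _ _ _ => hf0 _ _ _ _
  have := neg_le_of_abs_le s₁
  have := neg_le_of_abs_le s₂
  have := neg_le_of_abs_le s₃
  have := neg_le_of_abs_le s₄
  linarith

end Counting

section Triples

/-- The three pairs contained in an ordered triple. -/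
def pairs {V : Type} : Fin 3 → V × V × V → V × V :=
  ![fun ω => (ω.1, ω.2.1), fun ω => (ω.1, ω.2.2), fun ω => (ω.2.1, ω.2.2)]

lemma label_pairs_iff {V : Type} {κ : Type*} {R : V × V → κ} {x y z x' y' z' : V} :
    label pairs R (x, y, z) = label pairs R (x', y', z') ↔
      R (x, y) = R (x', y') ∧ R (x, z) = R (x', z') ∧ R (y, z) = R (y', z') := by
  rw [label_eq_iff, Fin.forall_fin_succ, Fin.forall_fin_two]
  simp [pairs]

variable {V : Type} [Fintype V]

lemma card_triples : (Fintype.card (V × V × V) : ℝ) = (Fintype.card V : ℝ) ^ 3 := by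
  rw [Fintype.card_prod, Fintype.card_prod]; push_cast; ring

lemma Uniform.abs_sum_pairs_le {m : ℕ} {P : V × V → Fin m} {f : V × V × V → ℝ} {ε : ℝ}
    (h : Uniform pairs P f ε) {u v w : V → V → ℝ} (hu : ∀ x y, 0 ≤ u x y ∧ u x y ≤ 1)
    (hv : ∀ x y, 0 ≤ v x y ∧ v x y ≤ 1) (hw : ∀ x y, 0 ≤ w x y ∧ w x y ≤ 1) :
    |∑ x, ∑ y, ∑ z, (f (x, y, z) - fiberAvg (label pairs P) f (x, y, z)) *
      (u x y * v x z * w y z)| ≤ ε * Fintype.card V ^ 3 := by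
  have h1 := h ![fun q => u q.1 q.2, fun q => v q.1 q.2, fun q => w q.1 q.2] (by
    intro i q
    fin_cases i
    exacts [hu _ _, hv _ _, hw _ _])
  simp only [Fintype.sum_prod_type, Fin.prod_univ_three, card_triples] at h1
  exact h1

lemma sum_cells_eq {m k : ℕ} (P : V × V → Fin m) (Q : V → Fin k) (x y z : V)
    (F : V × V × V → ℝ) :
    ∑ x' ∈ cell Q (Q x), ∑ y' ∈ cell Q (Q y), ∑ z' ∈ cell Q (Q z), F (x', y', z') *
      ((if P (x', y') = P (x, y) then 1 else 0) * (if P (x', z') = P (x, z) then 1 else 0) *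
        (if P (y', z') = P (y, z) then 1 else 0)) =
    ∑ ω with label pairs (fun q => (P q, Q q.1, Q q.2)) ω =
      label pairs (fun q => (P q, Q q.1, Q q.2)) (x, y, z), F ω := by
  rw [sum_filter, Fintype.sum_prod_type]
  simp only [Fintype.sum_prod_type, cell, sum_filter]
  refine sum_congr rfl fun x' _ => ?_
  by_cases hx : Q x' = Q x
  · rw [if_pos hx]
    refine sum_congr rfl fun y' _ => ?_
    by_cases hy : Q y' = Q y
    · rw [if_pos hy]
      refine sum_congr rfl fun z' _ => ?_
      simp only [label_pairs_iff, Prod.mk.injEq, hx, hy, true_and, and_true]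
      split_ifs <;> simp_all
    · rw [if_neg hy]
      refine (sum_eq_zero fun z' _ => if_neg ?_).symm
      simp [label_pairs_iff, hy]
  · rw [if_neg hx]
    refine (sum_eq_zero fun y' _ => sum_eq_zero fun z' _ => if_neg ?_).symm
    simp [label_pairs_iff, hx]

lemma card_filter_pair_le (p : V → V → Prop) [DecidableRel p]
    {C : ℝ} (h : (#{q : V × V | p q.1 q.2} : ℝ) ≤ C * Fintype.card V ^ 2) (i : Fin 3) :
    ∑ ω : V × V × V, (if p (pairs i ω).1 (pairs i ω).2 then (1 : ℝ) else 0) ≤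
      C * Fintype.card V ^ 3 := by
  have e : (#{q : V × V | p q.1 q.2} : ℝ) = ∑ x, ∑ y, if p x y then (1 : ℝ) else 0 := by
    rw [card_filter]
    push_cast
    rw [Fintype.sum_prod_type]
  have key : ∑ ω : V × V × V, (if p (pairs i ω).1 (pairs i ω).2 then (1 : ℝ) else 0) =
      Fintype.card V * #{q : V × V | p q.1 q.2} := by
    rw [e]
    fin_cases i
    · simp only [pairs, Fintype.sum_prod_type]
      rw [mul_sum]
      refine sum_congr rfl fun x _ => ?_
      rw [mul_sum]
      refine sum_congr rfl fun y _ => ?_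
      simp
    · simp only [pairs, Fintype.sum_prod_type]
      simp [mul_sum]
    · simp only [pairs, Fintype.sum_prod_type]
      simp
  rw [key]
  calc _ ≤ (Fintype.card V : ℝ) * (C * Fintype.card V ^ 2) := by gcongr
    _ = _ := by ring

/-- Around `(x, y, z)` the function `f` has density at least `2δ`, and the finer averages are
rarely far from this density. -/
def GoodTriple {m m' k : ℕ} (δ : ℝ) (f : V × V × V → ℝ) (P : V × V → Fin m)
    (P' : V × V → Fin m') (Q : V → Fin k) (ω : V × V × V) : Prop :=
  2 * δ ≤ fiberAvg (label pairs fun q => (P q, Q q.1, Q q.2)) f ω ∧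
    fiberAvg (label pairs fun q => (P q, Q q.1, Q q.2))
      (fun ω => if δ ≤ |fiberAvg (label pairs P') f ω -
        fiberAvg (label pairs fun q => (P q, Q q.1, Q q.2)) f ω| then 1 else 0) ω ≤ 1 / 8

lemma GoodTriple.sum_low_le {m m' k : ℕ} {δ : ℝ} {f : V × V × V → ℝ} {P : V × V → Fin m}
    {P' : V × V → Fin m'} {Q : V → Fin k} {x y z : V} (h : GoodTriple δ f P P' Q (x, y, z)) :
    ∑ x' ∈ cell Q (Q x), ∑ y' ∈ cell Q (Q y), ∑ z' ∈ cell Q (Q z),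
      (if fiberAvg (label pairs P') f (x', y', z') < δ then 1 else 0) *
      ((if P (x', y') = P (x, y) then 1 else 0) * (if P (x', z') = P (x, z) then 1 else 0) *
        (if P (y', z') = P (y, z) then 1 else 0)) ≤
    1 / 8 * ∑ x' ∈ cell Q (Q x), ∑ y' ∈ cell Q (Q y), ∑ z' ∈ cell Q (Q z),
      (if P (x', y') = P (x, y) then (1 : ℝ) else 0) * (if P (x', z') = P (x, z) then 1 else 0) *
        (if P (y', z') = P (y, z) then 1 else 0) := by
  have h1 := sum_cells_eq P Q x y z
    (fun ω => if fiberAvg (label pairs P') f ω < δ then 1 else 0)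
  have h2 := sum_cells_eq P Q x y z (fun _ => 1)
  simp only [one_mul] at h2
  rw [h1, h2]
  set π := label pairs (fun q : V × V => (P q, Q q.1, Q q.2))
  have h3 := mul_le_mul_of_nonneg_right h.2 (card_fiber_pos π (x, y, z)).le
  rw [fiberAvg_mul_card] at h3
  simp only [sum_const, nsmul_eq_mul, mul_one]
  refine le_trans (sum_le_sum fun ω hω => ?_) h3
  have h4 : 2 * δ ≤ fiberAvg π f ω := by
    rw [fiberAvg_congr f (mem_filter.1 hω).2]
    exact h.1
  split_ifs with h5 h6
  · exact le_rfl
  · refine absurd ?_ h6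
    rw [abs_sub_comm]
    exact le_trans (by linarith) (le_abs_self _)
  · exact zero_le_one
  · exact le_rfl

lemma sum_not_goodTriple_le {m m' k : ℕ} {δ κ : ℝ} (hδ : 0 < δ) {f : V × V × V → ℝ}
    (hf : ∀ ω, 0 ≤ f ω ∧ f ω ≤ 1) {P : V × V → Fin m} {P' : V × V → Fin m'} {Q : V → Fin k}
    (hr : ∀ q q', P' q = P' q' → P q = P q' ∧ Q q.1 = Q q'.1 ∧ Q q.2 = Q q'.2)
    (hE : energy (label pairs P') f ≤ energy (label pairs P) f + κ * Fintype.card V ^ 3)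
    [DecidablePred (GoodTriple δ f P P' Q)] :
    ∑ ω with ¬ GoodTriple δ f P P' Q ω, f ω ≤
      (2 * δ + 8 * κ / δ ^ 2) * Fintype.card V ^ 3 := by
  classical
  set π := label pairs (fun q : V × V => (P q, Q q.1, Q q.2)) with hπ
  set g := fiberAvg (label pairs P') f with hg
  set b : V × V × V → ℝ := fun ω => if δ ≤ |g ω - fiberAvg π f ω| then 1 else 0 with hb
  have hb0 : ∀ ω, 0 ≤ b ω := fun ω => by simp only [hb]; split_ifs <;> norm_num
  have r1 : ∀ ω ω', label pairs P' ω = label pairs P' ω' → π ω = π ω' := by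
    intro ω ω' h
    rw [hπ, label_eq_iff]
    rw [label_eq_iff] at h
    intro i
    obtain ⟨h1, h2, h3⟩ := hr _ _ (h i)
    simp only [h1, h2, h3]
  have r2 : ∀ ω ω', π ω = π ω' → label pairs P ω = label pairs P ω' := by
    intro ω ω' h
    rw [hπ, label_eq_iff] at h
    rw [label_eq_iff]
    exact fun i => (Prod.mk.inj (h i)).1
  have s1 : ∑ ω, (g ω - fiberAvg π f ω) ^ 2 ≤ κ * Fintype.card V ^ 3 := by
    rw [hg, sum_sq_fiberAvg_sub r1]
    have := energy_mono r2 f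
    linarith
  have s2 : δ ^ 2 * ∑ ω, b ω ≤ κ * Fintype.card V ^ 3 := by
    rw [mul_sum]
    refine le_trans (sum_le_sum fun ω _ => ?_) s1
    simp only [hb]
    split_ifs with h
    · rw [mul_one, ← sq_abs (g ω - _)]
      gcongr
    · rw [mul_zero]; positivity
  have s3 := card_lt_fiberAvg_mul_le π hb0 (1 / 8)
  have s4 := sum_fiberAvg_lt_le π f (t := 2 * δ) (by positivity)
  rw [card_triples] at s4
  have s5 : ∑ ω with ¬ GoodTriple δ f P P' Q ω, f ω ≤
      ∑ ω with fiberAvg π f ω < 2 * δ, f ω + ∑ ω with 1 / 8 < fiberAvg π b ω, f ω := by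
    rw [sum_filter, sum_filter, sum_filter, ← sum_add_distrib]
    refine sum_le_sum fun ω _ => ?_
    have := (hf ω).1
    by_cases h2 : fiberAvg π f ω < 2 * δ
    · rw [if_pos h2]
      split_ifs <;> linarith
    · by_cases h3 : 1 / 8 < fiberAvg π b ω
      · rw [if_pos h3]
        split_ifs <;> linarith
      · rw [if_neg (not_not.2 ⟨not_lt.1 h2, not_lt.1 h3⟩), if_neg h2, if_neg h3, add_zero]
  have s6 : ∑ ω with 1 / 8 < fiberAvg π b ω, f ω ≤ #{ω | 1 / 8 < fiberAvg π b ω} := by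
    refine (sum_le_sum fun ω _ => (hf ω).2).trans_eq ?_
    simp
  have s7 : ∑ ω, b ω ≤ κ / δ ^ 2 * Fintype.card V ^ 3 := by
    rw [div_mul_eq_mul_div, le_div_iff₀ (by positivity), mul_comm]
    exact s2
  calc _ ≤ 2 * δ * Fintype.card V ^ 3 + 8 * (κ / δ ^ 2 * Fintype.card V ^ 3) := by linarith
    _ = _ := by ring

/-- A regular partition of a weighted `3`-graph: the triples outside a set of small weight have
the property that four vertices spanning only such triples witness many simplices. -/
lemma count_of_regular {m m' k : ℕ} {β δ θ κ τ : ℝ} (hβ : 0 < β) (hδ : 0 < δ) (hτ : 0 < τ)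
    {f : V × V × V → ℝ} (hf : ∀ ω, 0 ≤ f ω ∧ f ω ≤ 1)
    {P : V × V → Fin m} {P' : V × V → Fin m'} {Q : V → Fin k}
    (hQ : ∀ B : Finset (V × V), (∀ ω ∈ B, ¬ GoodPair (τ ^ 6 / 76) τ β P Q ω.1 ω.2) →
      (#B : ℝ) ≤ θ * Fintype.card V ^ 2)
    (hr : ∀ q q', P' q = P' q' → P q = P q' ∧ Q q.1 = Q q'.1 ∧ Q q.2 = Q q'.2)
    (hU : Uniform pairs P' f (δ ^ 4 * τ ^ 6 * β ^ 4 / 32))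
    (hE : energy (label pairs P') f ≤ energy (label pairs P) f + κ * Fintype.card V ^ 3) :
    ∃ T : Finset (V × V × V),
      ∑ ω ∈ T, f ω ≤ (3 * θ + 2 * δ + 8 * κ / δ ^ 2) * Fintype.card V ^ 3 ∧
      ∀ x : Fin 4 → V, (∀ i j l, i < j → j < l → (x i, x j, x l) ∉ T) →
        δ ^ 4 * τ ^ 6 * β ^ 4 / 8 * Fintype.card V ^ 4 ≤
          ∑ x, ∑ y, ∑ z, ∑ t, f (x, y, z) * f (x, y, t) * f (x, z, t) * f (y, z, t) := by
  classical
  set p : V → V → Prop := fun x y => ¬ GoodPair (τ ^ 6 / 76) τ β P Q x y with hp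
  have hB := hQ {q | p q.1 q.2} fun ω hω => (mem_filter.1 hω).2
  refine ⟨({ω | ∃ i, p (pairs i ω).1 (pairs i ω).2} : Finset _) ∪
    ({ω | ¬ GoodTriple δ f P P' Q ω} : Finset _), ?_, ?_⟩
  · have h1 := card_filter_pair_le p hB
    have h2 := sum_not_goodTriple_le hδ hf hr hE
    have h3 : ∑ ω with ∃ i, p (pairs i ω).1 (pairs i ω).2, f ω ≤
        ∑ i, ∑ ω, if p (pairs i ω).1 (pairs i ω).2 then (1 : ℝ) else 0 := by
      rw [sum_comm, sum_filter]
      refine sum_le_sum fun ω _ => ?_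
      split_ifs with h
      · obtain ⟨i, hi⟩ := h
        refine (hf ω).2.trans (le_trans ?_ (single_le_sum (f := fun i =>
          if p (pairs i ω).1 (pairs i ω).2 then (1 : ℝ) else 0) (fun i _ => ?_) (mem_univ i)))
        · rw [if_pos hi]
        · split_ifs <;> norm_num
      · exact sum_nonneg fun i _ => by split_ifs <;> norm_num
    have h4 := sum_le_sum fun i (_ : i ∈ univ) => h1 i
    rw [sum_const, card_univ, Fintype.card_fin, nsmul_eq_mul] at h4
    have h5 := sum_union_inter (s₁ := ({ω | ∃ i, p (pairs i ω).1 (pairs i ω).2} : Finset _))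
      (s₂ := {ω | ¬ GoodTriple δ f P P' Q ω}) (f := f)
    have h6 : 0 ≤ ∑ ω ∈ ({ω | ∃ i, p (pairs i ω).1 (pairs i ω).2} : Finset _) ∩
      ({ω | ¬ GoodTriple δ f P P' Q ω} : Finset _), f ω := sum_nonneg fun ω _ => (hf ω).1
    push_cast at h4
    linarith
  · intro x hx
    have hgood : ∀ i j l, i < j → j < l → (∀ c, GoodPair (τ ^ 6 / 76) τ β P Q
        (pairs c (x i, x j, x l)).1 (pairs c (x i, x j, x l)).2) ∧
        GoodTriple δ f P P' Q (x i, x j, x l) := by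
      intro i j l hij hjl
      have := hx i j l hij hjl
      simpa [hp] using this
    have hpair : ∀ i j, i < j → GoodPair (τ ^ 6 / 76) τ β P Q (x i) (x j) := by
      intro i j hij
      rcases lt_or_ge j 3 with hj | hj
      · exact (hgood i j 3 hij hj).1 0
      · obtain rfl : j = 3 := le_antisymm (Fin.le_last j) hj
        rcases eq_or_ne i 0 with rfl | hi
        · exact (hgood 0 1 3 (by decide) (by decide)).1 1
        · exact (hgood 0 i 3 (Fin.pos_of_ne_zero hi) hij).1 2
    have he : ∀ i j, ∃ e : ℝ, i < j → τ ≤ e ∧ e ≤ 1 ∧ RegOn (τ ^ 6 / 76)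
        (cell Q (Q (x i))) (cell Q (Q (x j)))
        (fun x' y' => if P (x', y') = P (x i, x j) then 1 else 0) e := by
      intro i j
      by_cases hij : i < j
      · obtain ⟨-, -, e, h⟩ := hpair i j hij
        exact ⟨e, fun _ => h⟩
      · exact ⟨0, fun h => absurd h hij⟩
    choose e he using he
    have hcount := simplex_count (ε := τ ^ 6 / 76) (ε' := δ ^ 4 * τ ^ 6 * β ^ 4 / 32)
      (by positivity) hτ.le hδ.le
      (A := fun i => cell Q (Q (x i)))
      (D := fun i j x' y' => if P (x', y') = P (x i, x j) then 1 else 0) (e := e)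
      (f := fun x y z => f (x, y, z))
      (g := fun x y z => fiberAvg (label pairs P') f (x, y, z))
      (fun _ _ _ => hf _)
      (fun _ _ _ => ⟨fiberAvg_nonneg _ (fun ω => (hf ω).1) _,
        fiberAvg_le_one _ (fun ω => (hf ω).2) _⟩)
      (fun u v w => hU.abs_sum_pairs_le)
      (fun _ _ _ _ => by split_ifs <;> norm_num)
      (fun i j hij => (he i j hij).2.2) (fun i j hij => ⟨(he i j hij).1, (he i j hij).2.1⟩)
      (fun i j l hij hjl => (hgood i j l hij hjl).2.sum_low_le)
    refine le_trans ?_ hcount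
    have hn : 0 ≤ β * (Fintype.card V : ℝ) := by positivity
    have c0 := (hpair 0 1 (by decide)).1
    have c1 := (hpair 0 1 (by decide)).2.1
    have c2 := (hpair 0 2 (by decide)).2.1
    have c3 := (hpair 0 3 (by decide)).2.1
    have hM : (β * Fintype.card V) * (β * Fintype.card V) * (β * Fintype.card V) *
        (β * Fintype.card V) ≤ (#(cell Q (Q (x 0))) * #(cell Q (Q (x 1))) *
        #(cell Q (Q (x 2))) * #(cell Q (Q (x 3))) : ℝ) := by gcongr
    have hM' := mul_le_mul_of_nonneg_left hM (show 0 ≤ δ ^ 4 * (τ ^ 6 / 4) by positivity)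
    calc _ = δ ^ 4 * (τ ^ 6 / 4) * ((β * Fintype.card V) * (β * Fintype.card V) *
          (β * Fintype.card V) * (β * Fintype.card V)) -
          4 * (δ ^ 4 * τ ^ 6 * β ^ 4 / 32 * Fintype.card V ^ 4) := by ring
      _ ≤ _ := sub_le_sub_right hM' _
      _ = _ := by ring

end Triples

lemma exists_pos_le_of_le (h : ℕ → ℝ) (h0 : ∀ k, 0 < h k) (K : ℕ) :
    ∃ c, 0 < c ∧ ∀ k ≤ K, c ≤ h k := by
  obtain ⟨k₀, -, hk₀⟩ := exists_min_image (range (K + 1)) h ⟨0, by simp⟩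
  exact ⟨h k₀, h0 k₀, fun k hk => hk₀ k (by simpa [Nat.lt_succ_iff] using hk)⟩

/-- Removal in weighted form: outside a set of ordered triples of small weight, four vertices
spanning only remaining triples force many simplices. -/
lemma exists_weighted_removal {a : ℝ} (ha : 0 < a) :
    ∃ c, 0 < c ∧ ∀ (V : Type) [Fintype V] (f : V × V × V → ℝ), (∀ ω, 0 ≤ f ω ∧ f ω ≤ 1) →
      ∃ T : Finset (V × V × V), ∑ ω ∈ T, f ω ≤ a * Fintype.card V ^ 3 ∧
        ∀ x : Fin 4 → V, (∀ i j l, i < j → j < l → (x i, x j, x l) ∉ T) →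
          c * Fintype.card V ^ 4 ≤
            ∑ x, ∑ y, ∑ z, ∑ t, f (x, y, z) * f (x, y, t) * f (x, z, t) * f (y, z, t) := by
  obtain ⟨θ, hθ⟩ : ∃ θ, θ = a / 6 := ⟨_, rfl⟩
  obtain ⟨δ, hδ⟩ : ∃ δ, δ = a / 8 := ⟨_, rfl⟩
  obtain ⟨κ, hκ⟩ : ∃ κ, κ = a * δ ^ 2 / 32 := ⟨_, rfl⟩
  have hθ0 : 0 < θ := by rw [hθ]; positivity
  have hδ0 : 0 < δ := by rw [hδ]; positivity
  have hκ0 : 0 < κ := by rw [hκ]; positivity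
  obtain ⟨τ, hτ⟩ : ∃ τ : ℕ → ℝ, τ = fun k : ℕ => θ / (4 * ((k : ℝ) + 1)) := ⟨_, rfl⟩
  have hτ0 : ∀ k, 0 < τ k := fun k => by rw [hτ]; positivity
  choose L β hβ hL using fun k => exists_regular_partition k
    (show 0 < τ k ^ 6 / 76 by have := hτ0 k; positivity) hθ0
  choose G hG using fun k => exists_uniform_refinement 3 1 (k * (L k * L k))
    (show 0 < δ ^ 4 * τ k ^ 6 * β k ^ 4 / 32 by have := hτ0 k; have := hβ k; positivity)
  obtain ⟨K, hK⟩ := exists_small_increment G 1 ⌈1 / κ⌉₊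
  obtain ⟨c, hc, hcK⟩ := exists_pos_le_of_le (fun k => δ ^ 4 * τ k ^ 6 * β k ^ 4 / 8)
    (fun k => by have := hτ0 k; have := hβ k; positivity) K
  refine ⟨c, hc, fun V _ f hf => ?_⟩
  obtain ⟨k, hk, P, -, P', ⟨Q, hQ, hr, hU⟩, -, hE⟩ := hK (V × V)
    (fun k P => energy (label pairs P) f) (κ * Fintype.card V ^ 3)
    (fun k k' P P' => ∃ Q : V → Fin (L k),
      (∀ B : Finset (V × V), (∀ ω ∈ B, ¬ GoodPair (τ k ^ 6 / 76) (τ k) (β k) P Q ω.1 ω.2) →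
        (#B : ℝ) ≤ θ * Fintype.card V ^ 2) ∧
      (∀ q q', P' q = P' q' → P q = P q' ∧ Q q.1 = Q q'.1 ∧ Q q.2 = Q q'.2) ∧
      Uniform pairs P' f (δ ^ 4 * τ k ^ 6 * β k ^ 4 / 32))
    (by positivity) (fun k P => energy_nonneg _ _)
    (fun k P => by
      calc energy (label pairs P) f ≤ Fintype.card (V × V × V) :=
            energy_le_card _ (fun ω => (hf ω).1) fun ω => (hf ω).2
        _ = 1 / κ * (κ * Fintype.card V ^ 3) := by rw [card_triples]; field_simp
        _ ≤ _ := mul_le_mul_of_nonneg_right (Nat.le_ceil _) (by positivity))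
    (fun k P => by
      obtain ⟨Q, hQ⟩ := hL k V P
      obtain ⟨P', h1, h2⟩ := hG k (V × V) (V × V × V) pairs (fun _ => f)
        (fun _ ω => (hf ω).1) (fun _ ω => (hf ω).2)
        fun q => finProdFinEquiv (P q, finProdFinEquiv (Q q.1, Q q.2))
      have h3 : ∀ q q', P' q = P' q' → P q = P q' ∧ Q q.1 = Q q'.1 ∧ Q q.2 = Q q'.2 := by
        intro q q' h
        simpa using h1 q q' h
      refine ⟨P', ⟨Q, ?_, h3, h2 0⟩, fun q q' h => (h3 q q' h).1⟩
      simpa only [hτ] using hQ) (fun _ => 0)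
  obtain ⟨T, hT, hx⟩ := count_of_regular (hβ k) hδ0 (hτ0 k) hf hQ hr hU hE
  refine ⟨T, hT.trans_eq ?_, fun x h => le_trans ?_ (hx x h)⟩
  · congr 1
    rw [hκ, hθ, hδ]
    field_simp
    norm_num
  · have := hcK k hk
    gcongr

section Hypergraph

variable {V : Type} [Fintype V] [DecidableEq V] {H : Finset (Finset V)}

/-- The four-element sets all of whose triples are edges. -/
def simplices (H : Finset (Finset V)) : Finset (Finset V) :=
  {S ∈ univ.powersetCard 4 | ∀ e ∈ S.powersetCard 3, e ∈ H}

lemma mem_simplices_of_triples (hH : ∀ e ∈ H, #e = 3) {x y z t : V} (h₁ : {x, y, z} ∈ H)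
    (h₂ : {x, y, t} ∈ H) (h₃ : {x, z, t} ∈ H) (h₄ : {y, z, t} ∈ H) :
    {x, y, z, t} ∈ simplices H := by
  obtain ⟨hxy, hxz, hyz⟩ := card_triple_eq_three_iff.1 (hH _ h₁)
  obtain ⟨-, hxt, hyt⟩ := card_triple_eq_three_iff.1 (hH _ h₂)
  obtain ⟨-, -, hzt⟩ := card_triple_eq_three_iff.1 (hH _ h₃)
  have h4 : #({x, y, z, t} : Finset V) = 4 :=
    card_eq_four.2 ⟨x, y, z, t, hxy, hxz, hxt, hyz, hyt, hzt, rfl⟩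
  refine mem_filter.2 ⟨mem_powersetCard.2 ⟨subset_univ _, h4⟩, fun e he => ?_⟩
  obtain ⟨he, he3⟩ := mem_powersetCard.1 he
  obtain ⟨v, hv⟩ := card_eq_one.1 (show #({x, y, z, t} \ e) = 1 by
    rw [card_sdiff_of_subset he, h4, he3])
  have he' : e = {x, y, z, t} \ {v} := by rw [← hv, Finset.sdiff_sdiff_eq_self he]
  have hvm : v ∈ ({x, y, z, t} : Finset V) \ e := by rw [hv]; exact mem_singleton_self v
  have hvm' := (mem_sdiff.1 hvm).1
  simp only [mem_insert, mem_singleton] at hvm'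
  have key : ∀ s ∈ H, (∀ w, w ∈ s ↔ w ∈ ({x, y, z, t} : Finset V) ∧ w ≠ v) → e ∈ H := by
    intro s hs h
    convert hs
    ext w
    rw [he', h, mem_sdiff, mem_singleton]
  rcases hvm' with rfl | rfl | rfl | rfl
  · exact key _ h₄ fun w => by simp only [mem_insert, mem_singleton]; grind
  · exact key _ h₃ fun w => by simp only [mem_insert, mem_singleton]; grind
  · exact key _ h₂ fun w => by simp only [mem_insert, mem_singleton]; grind
  · exact key _ h₁ fun w => by simp only [mem_insert, mem_singleton]; grind

/-- The indicator function of the ordered edges. -/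
def edgeIndicator (H : Finset (Finset V)) (ω : V × V × V) : ℝ :=
  if {ω.1, ω.2.1, ω.2.2} ∈ H then 1 else 0

lemma sum_edgeIndicator_le (hH : ∀ e ∈ H, #e = 3) :
    ∑ x, ∑ y, ∑ z, ∑ t, edgeIndicator H (x, y, z) * edgeIndicator H (x, y, t) *
      edgeIndicator H (x, z, t) * edgeIndicator H (y, z, t) ≤ 256 * (#(simplices H) : ℝ) := by
  set N : Finset (V × V × V × V) := {q | {q.1, q.2.1, q.2.2.1} ∈ H ∧ {q.1, q.2.1, q.2.2.2} ∈ H ∧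
    {q.1, q.2.2.1, q.2.2.2} ∈ H ∧ {q.2.1, q.2.2.1, q.2.2.2} ∈ H} with hN
  have h1 : ∑ x, ∑ y, ∑ z, ∑ t, edgeIndicator H (x, y, z) * edgeIndicator H (x, y, t) *
      edgeIndicator H (x, z, t) * edgeIndicator H (y, z, t) = #N := by
    rw [hN, card_filter]
    push_cast
    simp only [Fintype.sum_prod_type, edgeIndicator]
    refine sum_congr rfl fun x _ => sum_congr rfl fun y _ => sum_congr rfl fun z _ =>
      sum_congr rfl fun t _ => ?_
    split_ifs <;> simp_all
  have h2 : #N ≤ 256 * #(simplices H) := by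
    refine card_le_mul_card_image_of_maps_to
      (f := fun q : V × V × V × V => ({q.1, q.2.1, q.2.2.1, q.2.2.2} : Finset V)) ?_ 256 ?_
    · intro q hq
      obtain ⟨-, h₁, h₂, h₃, h₄⟩ := mem_filter.1 hq
      exact mem_simplices_of_triples hH h₁ h₂ h₃ h₄
    · intro S hS
      have hS4 : #S = 4 := (mem_powersetCard.1 (mem_filter.1 hS).1).2
      calc _ ≤ #(S ×ˢ S ×ˢ S ×ˢ S) := by
            refine card_le_card fun q hq => ?_
            obtain ⟨-, rfl⟩ := mem_filter.1 hq
            simp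
        _ = 256 := by simp [card_product, hS4]
  rw [h1]
  exact_mod_cast h2

end Hypergraph

end SimplexRemoval

/-- **Theorem 1.6 (Frankl–Rödl): the simplex removal lemma for 3-uniform hypergraphs.**
For every `a > 0` there exists `c > 0` such that if a 3-uniform hypergraph `H` on a vertex set
`V` with `n` vertices contains at most `c·n^4` simplices (sets of four vertices all four of
whose triples are edges), then one can remove at most `a·n^3` edges from `H` so that the
resulting hypergraph contains no simplex. -/
theorem simplex_removal_three_uniform (a : ℝ) (ha : 0 < a) :
    ∃ c : ℝ, 0 < c ∧
      ∀ (V : Type) [Fintype V] [DecidableEq V] (H : Finset (Finset V)),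
        (∀ e ∈ H, e.card = 3) →
        ((((univ : Finset V).powersetCard 4).filter
            (fun S => ∀ e ∈ S.powersetCard 3, e ∈ H)).card : ℝ) ≤
          c * (Fintype.card V : ℝ) ^ 4 →
        ∃ H' ⊆ H, ((H \ H').card : ℝ) ≤ a * (Fintype.card V : ℝ) ^ 3 ∧
          ∀ S ∈ (univ : Finset V).powersetCard 4, ¬ ∀ e ∈ S.powersetCard 3, e ∈ H' := by
  obtain ⟨c, hc, hrem⟩ := SimplexRemoval.exists_weighted_removal ha
  refine ⟨c / 512, by positivity, fun V _ _ H hH hS => ?_⟩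
  obtain ⟨T, hT, hcount⟩ := hrem V (SimplexRemoval.edgeIndicator H) fun ω => by
    unfold SimplexRemoval.edgeIndicator
    split_ifs <;> norm_num
  refine ⟨{e ∈ H | ∀ ω ∈ T, e ≠ {ω.1, ω.2.1, ω.2.2}}, filter_subset _ _, ?_, ?_⟩
  · refine le_trans ?_ hT
    unfold SimplexRemoval.edgeIndicator
    rw [← sum_filter, sum_const, nsmul_eq_mul, mul_one]
    refine Nat.cast_le.2 (le_trans (card_le_card ?_)
      (card_image_le (f := fun ω : V × V × V => ({ω.1, ω.2.1, ω.2.2} : Finset V))))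
    intro e he
    simp only [mem_sdiff, mem_filter, not_and, not_forall, not_not] at he
    obtain ⟨heH, he⟩ := he
    obtain ⟨ω, hω, rfl⟩ := he heH
    exact mem_image.2 ⟨ω, mem_filter.2 ⟨hω, heH⟩, rfl⟩
  · intro S hS4 hSH
    have hS4' := (mem_powersetCard.1 hS4).2
    set x : Fin 4 → V := fun i => ((S.equivFinOfCardEq hS4').symm i : V) with hx
    have hinj : Function.Injective x :=
      Subtype.val_injective.comp (S.equivFinOfCardEq hS4').symm.injective
    have hlow := hcount x fun i j l hij hjl hmem => by
      have he : ({x i, x j, x l} : Finset V) ∈ S.powersetCard 3 := by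
        refine mem_powersetCard.2 ⟨?_, card_triple_eq_three_iff.2
          ⟨hinj.ne hij.ne, hinj.ne (hij.trans hjl).ne, hinj.ne hjl.ne⟩⟩
        intro v hv
        simp only [mem_insert, mem_singleton] at hv
        rcases hv with rfl | rfl | rfl <;> exact Subtype.prop _
      exact (mem_filter.1 (hSH _ he)).2 _ hmem rfl
    have hup := SimplexRemoval.sum_edgeIndicator_le hH
    have hn : (0 : ℝ) < Fintype.card V := Nat.cast_pos.2 (Fintype.card_pos_iff.2 ⟨x 0⟩)
    have hcn : 0 < c * (Fintype.card V : ℝ) ^ 4 := by positivity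
    have hS' : (#(SimplexRemoval.simplices H) : ℝ) ≤ c / 512 * (Fintype.card V : ℝ) ^ 4 := hS
    linarith
end

section
/- For every δ > 0 there exists N such that every subset A ⊆ [N]^3 of size at least δN^3 contains a quadruple of points of the form {(x,y,z), (x+d,y,z), (x,y+d,z), (x,y,z+d)} with d > 0. (Theorem 1.7.) -/
open Finset

open scoped BigOperators
open Combinatorics

section Density

variable {X Y I : Type*}

lemma indicator_one_nonneg (s : Set X) (x : X) : 0 ≤ s.indicator (1 : X → ℝ) x :=
  Set.indicator_nonneg (fun _ _ ↦ zero_le_one) x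

lemma indicator_one_le_one (s : Set X) (x : X) : s.indicator (1 : X → ℝ) x ≤ 1 :=
  Set.indicator_le_self' (fun _ _ ↦ zero_le_one) x

variable [Fintype X] [Fintype Y] [Fintype I]

/-- The uniform density of a subset of a finite type. -/
noncomputable def setDens (s : Set X) : ℝ := 𝔼 x, s.indicator 1 x

lemma setDens_nonneg (s : Set X) : 0 ≤ setDens s := expect_nonneg fun _ _ ↦ indicator_one_nonneg s _

lemma setDens_le_one (s : Set X) : setDens s ≤ 1 := by
  cases isEmpty_or_nonempty X
  · simp [setDens]
  · exact expect_le univ_nonempty fun _ _ ↦ indicator_one_le_one s _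

lemma setDens_mono {s t : Set X} (h : s ⊆ t) : setDens s ≤ setDens t :=
  expect_le_expect fun _ _ ↦ Set.indicator_le_indicator_of_subset h (fun _ ↦ zero_le_one) _

lemma nonempty_of_setDens_pos {s : Set X} (h : 0 < setDens s) : s.Nonempty := by
  by_contra hs
  simp [Set.not_nonempty_iff_eq_empty.1 hs, setDens] at h

lemma half_le_setDens_of_le_expect [Nonempty X] {f : X → ℝ} (hf : ∀ x, f x ≤ 1) {δ : ℝ}
    (hδ : 0 ≤ δ) (h : δ ≤ 𝔼 x, f x) : δ / 2 ≤ setDens {x | δ / 2 ≤ f x} := by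
  have : 𝔼 x, f x ≤ 𝔼 x : X, (δ / 2 + ({x | δ / 2 ≤ f x} : Set X).indicator 1 x) := by
    refine expect_le_expect fun x _ ↦ ?_
    by_cases hx : δ / 2 ≤ f x
    · simp only [Set.indicator, Set.mem_ofPred_eq, hx, if_true, Pi.one_apply]
      linarith [hf x]
    · simp only [Set.indicator, Set.mem_ofPred_eq, hx, if_false]
      linarith
  rw [expect_add_distrib, Fintype.expect_const] at this
  rw [setDens]
  linarith

lemma exists_div_card_le_setDens (P : I → Set X) {G : Set X} {δ : ℝ} (hδ : 0 < δ)
    (hG : δ ≤ setDens G) (h : ∀ x ∈ G, ∃ i, x ∈ P i) :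
    ∃ i, δ / (Fintype.card I + 1) ≤ setDens (P i) := by
  have hle : setDens G ≤ ∑ i, setDens (P i) := by
    simp only [setDens]
    rw [← expect_sum_comm]
    refine expect_le_expect fun x _ ↦ ?_
    by_cases hx : x ∈ G
    · obtain ⟨i, hi⟩ := h x hx
      rw [Set.indicator_of_mem hx]
      calc (1 : X → ℝ) x = (P i).indicator 1 x := (Set.indicator_of_mem hi _).symm
        _ ≤ _ := single_le_sum (f := fun i ↦ (P i).indicator (1 : X → ℝ) x)
          (fun j _ ↦ indicator_one_nonneg (P j) x) (mem_univ i)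
    · rw [Set.indicator_of_notMem hx]
      exact sum_nonneg fun j _ ↦ indicator_one_nonneg (P j) x
  by_contra! hlt
  have hsum := sum_le_sum fun i (_ : i ∈ univ) ↦ (hlt i).le
  rw [sum_const, card_univ, nsmul_eq_mul] at hsum
  have : Fintype.card I * (δ / (Fintype.card I + 1)) < δ := by
    rw [mul_div_assoc', div_lt_iff₀ (by positivity)]
    linarith
  linarith

lemma expect_comp_of_injective {β : Type*} [Fintype β] [Nonempty β] [DecidableEq X]
    [DecidableEq Y] {j : X → Y} (hj : j.Injective) (G : (X → β) → ℝ) :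
    𝔼 w : Y → β, G (w ∘ j) = 𝔼 w, G w := by
  classical
  rw [Fintype.expect_equiv (Equiv.piEquivPiSubtypeProd (· ∈ Set.range j) fun _ ↦ β)
    (fun w ↦ G (w ∘ j)) (fun p ↦ G fun x ↦ p.1 ⟨j x, x, rfl⟩) fun w ↦ rfl, ← univ_product_univ,
    expect_product]
  simp only [Fintype.expect_const]
  exact Fintype.expect_equiv ((Equiv.ofInjective j hj).symm.arrowCongr (Equiv.refl β)) _ _
    fun w ↦ rfl

lemma expect_setDens_comm (R : X → Y → Prop) :
    𝔼 x, setDens {y | R x y} = 𝔼 y, setDens {x | R x y} := expect_comm ..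

end Density

section Cube

variable {α β : Type*} [Fintype α] [Fintype β]

lemma expect_append {m n : ℕ} (f : (Fin (m + n) → α) → ℝ) :
    𝔼 x, f x = 𝔼 y, 𝔼 z, f (Fin.append y z) := by
  rw [← Fintype.expect_equiv (Fin.appendEquiv m n) (fun p ↦ f (Fin.append p.1 p.2)) f fun _ ↦ rfl,
    ← univ_product_univ, expect_product]

lemma setDens_append {m n : ℕ} (D : Set (Fin (m + n) → α)) :
    setDens D = 𝔼 y, setDens {z | Fin.append y z ∈ D} := expect_append _

lemma setDens_append' {m n : ℕ} (D : Set (Fin (m + n) → α)) :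
    setDens D = 𝔼 z, setDens {y | Fin.append y z ∈ D} := (expect_append _).trans (expect_comm ..)

lemma expect_prod_pow (g : α → ℝ) (n : ℕ) : 𝔼 t : Fin n → α, ∏ i, g (t i) = (𝔼 a, g a) ^ n := by
  rw [expect_pow, Fintype.piFinset_univ]

end Cube

namespace Combinatorics

section
variable {α β η κ ι : Type*}

instance [Finite α] [Finite ι] : Finite (Line α ι) :=
  Finite.of_injective Line.idxFun fun _ _ ↦ Line.ext

instance [Finite η] [Finite α] [Finite ι] : Finite (Subspace η α ι) :=
  Finite.of_injective Subspace.idxFun fun _ _ ↦ Subspace.ext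

namespace Subspace

lemma injective (V : Subspace η α ι) : Function.Injective V := fun x y h ↦ by
  ext e
  obtain ⟨i, hi⟩ := V.proper e
  simpa [apply_inr hi] using congrFun h i

/-- The composition of two combinatorial subspaces. -/
def comp (V : Subspace κ α ι) (W : Subspace η α κ) : Subspace η α ι where
  idxFun i := (V.idxFun i).elim Sum.inl W.idxFun
  proper e := by
    obtain ⟨j, hj⟩ := W.proper e
    obtain ⟨i, hi⟩ := V.proper j
    exact ⟨i, by simp [hi, hj]⟩

@[simp] lemma comp_apply (V : Subspace κ α ι) (W : Subspace η α κ) (x : η → α) :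
    V.comp W x = V (W x) := by
  ext i
  rcases h : V.idxFun i with a | j <;> simp [comp, coe_apply, h]

/-- The image of a combinatorial line under a combinatorial subspace. -/
def mapLine (V : Subspace η α ι) (l : Line α η) : Line α ι where
  idxFun i := (V.idxFun i).elim some l.idxFun
  proper := by
    obtain ⟨j, hj⟩ := l.proper
    obtain ⟨i, hi⟩ := V.proper j
    exact ⟨i, by simp [hi, hj]⟩

@[simp] lemma mapLine_apply (V : Subspace η α ι) (l : Line α η) (a : α) :
    V.mapLine l a = V (l a) := by
  ext i
  rcases h : V.idxFun i with a | j <;> simp [mapLine, coe_apply, h]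

/-- Change the letters occurring in the constant coordinates of a combinatorial subspace. -/
def mapAlphabet (V : Subspace η α ι) (f : α → β) : Subspace η β ι where
  idxFun i := (V.idxFun i).map f id
  proper e := (V.proper e).imp fun i hi ↦ by simp [hi]

@[simp] lemma mapAlphabet_comp (V : Subspace η α ι) (f : α → β) (x : η → α) :
    V.mapAlphabet f (f ∘ x) = f ∘ V x := by
  ext i
  rcases h : V.idxFun i with a | j <;> simp [mapAlphabet, coe_apply, h]

lemma comp_apply_congr {γ : Type*} (V : Subspace η α ι) (f : α → γ) {x y : η → α}
    (h : f ∘ x = f ∘ y) : f ∘ V x = f ∘ V y := by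
  ext i
  rcases hi : V.idxFun i with a | j
  · simp [coe_apply, hi]
  · simpa [coe_apply, hi] using congrFun h j

lemma expect_indicator_range [Fintype α] [Nonempty α] [Fintype η] [Fintype κ] [DecidableEq η]
    [DecidableEq κ] (V : Subspace η α κ) (h : (κ → α) → ℝ) :
    𝔼 y, (Set.range V).indicator h y =
      Fintype.card (η → α) / Fintype.card (κ → α) * 𝔼 x, h (V x) := by
  classical
  have hsum : ∑ y, (Set.range V).indicator h y = ∑ x, h (V x) := by
    rw [← Finset.sum_image (s := univ) (g := V) (f := h) fun x _ y _ hxy ↦ V.injective hxy,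
      ← Finset.sum_indicator_subset h (subset_univ _)]
    simp
  rw [Fintype.expect_eq_sum_div_card, Fintype.expect_eq_sum_div_card, hsum]
  field_simp

variable {m n p q : ℕ}

/-- The product of two combinatorial subspaces. -/
def append (V : Subspace (Fin p) α (Fin m)) (W : Subspace (Fin q) α (Fin n)) :
    Subspace (Fin (p + q)) α (Fin (m + n)) where
  idxFun := Fin.append (fun i ↦ (V.idxFun i).map id (Fin.castAdd q))
    fun i ↦ (W.idxFun i).map id (Fin.natAdd p)
  proper e := by
    induction e using Fin.addCases with
    | left e => exact (V.proper e).elim fun i hi ↦ ⟨Fin.castAdd n i, by simp [hi]⟩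
    | right e => exact (W.proper e).elim fun i hi ↦ ⟨Fin.natAdd m i, by simp [hi]⟩

@[simp] lemma append_append (V : Subspace (Fin p) α (Fin m)) (W : Subspace (Fin q) α (Fin n))
    (x : Fin p → α) (y : Fin q → α) :
    V.append W (Fin.append x y) = Fin.append (V x) (W y) := by
  ext i
  induction i using Fin.addCases with
  | left i => rcases h : V.idxFun i with a | j <;> simp [append, coe_apply, h]
  | right i => rcases h : W.idxFun i with a | j <;> simp [append, coe_apply, h]

/-- The subspace of a cube on which the first coordinates are fixed. -/
def fixLeft (y : Fin m → α) : Subspace (Fin n) α (Fin (m + n)) where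
  idxFun := Fin.append (Sum.inl ∘ y) Sum.inr
  proper e := ⟨Fin.natAdd m e, by simp⟩

@[simp] lemma fixLeft_apply (y : Fin m → α) (z : Fin n → α) : fixLeft y z = Fin.append y z := by
  ext i
  induction i using Fin.addCases <;> simp [fixLeft, coe_apply]

/-- The subspace of a cube on which the last coordinates are fixed. -/
def fixRight (z : Fin n → α) : Subspace (Fin m) α (Fin (m + n)) where
  idxFun := Fin.append Sum.inr (Sum.inl ∘ z)
  proper e := ⟨Fin.castAdd n e, by simp⟩

@[simp] lemma fixRight_apply (z : Fin n → α) (y : Fin m → α) : fixRight z y = Fin.append y z := by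
  ext i
  induction i using Fin.addCases <;> simp [fixRight, coe_apply]

end Subspace

/-- Every subset of density at least `δ` of a cube `α^n` of large dimension contains a
combinatorial line. -/
def DensityHalesJewettAt (α : Type*) [Fintype α] (δ : ℝ) : Prop :=
  ∃ N, ∀ n ≥ N, ∀ D : Set (Fin n → α), δ ≤ setDens D → ∃ l : Line α (Fin n), ∀ a, l a ∈ D

/-- The density Hales-Jewett property for the alphabet `α`. -/
def DensityHalesJewett (α : Type*) [Fintype α] : Prop :=
  ∀ δ > 0, DensityHalesJewettAt α δ

/-- A set of words over `Option α` is insensitive at `a` if membership does not change when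
letters `none` and `some a` are exchanged. -/
def Insensitive (a : α) (E : Set (ι → Option α)) : Prop :=
  ∀ x y : ι → Option α, (Option.getD · a) ∘ x = (Option.getD · a) ∘ y → x ∈ E → y ∈ E

lemma Insensitive.preimage {a : α} {E : Set (ι → Option α)} (hE : Insensitive a E)
    (V : Subspace η (Option α) ι) : Insensitive a {x | V x ∈ E} :=
  fun _ _ hxy hx ↦ hE _ _ (V.comp_apply_congr _ hxy) hx

lemma Insensitive.compl {a : α} {E : Set (ι → Option α)} (hE : Insensitive a E) :
    Insensitive a Eᶜ :=
  fun x y hxy hx hy ↦ hx (hE y x hxy.symm hy)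

lemma exists_line_append {m n : ℕ} (w : Fin m → Option α) (hw : ∃ i, w i = none)
    (y : Fin n → Option α) : ∃ l : Line (Option α) (Fin (m + n)),
      l none = Fin.append w y ∧ ∀ a, l (some a) = Fin.append (some ∘ (Option.getD · a) ∘ w) y := by
  obtain ⟨i, hi⟩ := hw
  refine ⟨⟨Fin.append (Option.map some ∘ w) (some ∘ y), Fin.castAdd n i, by simp [hi]⟩, ?_,
    fun a ↦ ?_⟩
  all_goals
    ext1 e
    induction e using Fin.addCases with
    | left e => cases h : w e <;> simp [Line.coe_apply, h]
    | right e => simp [Line.coe_apply]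

lemma setDens_forall_ne_none [Fintype α] (n : ℕ) :
    setDens {w : Fin n → Option α | ∀ i, w i ≠ none} =
    (setDens ({none}ᶜ : Set (Option α))) ^ n := by
  classical
  rw [setDens, setDens, ← expect_prod_pow]
  refine expect_congr rfl fun w _ ↦ ?_
  by_cases hw : ∀ i, w i ≠ none
  · simp [Set.indicator, hw]
  · rw [Set.indicator_of_notMem (s := {w : Fin n → Option α | ∀ i, w i ≠ none}) hw]
    obtain ⟨i, hi⟩ := not_forall_not.1 hw
    exact (prod_eq_zero (mem_univ i) (by simp [hi])).symm

lemma DensityHalesJewettAt.mono [Fintype α] {δ δ' : ℝ} (h : DensityHalesJewettAt α δ)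
    (hδ : δ ≤ δ') :
    DensityHalesJewettAt α δ' :=
  h.imp fun _ hN n hn D hD ↦ hN n hn D (hδ.trans hD)

lemma densityHalesJewett_of_unique [Fintype α] [Unique α] : DensityHalesJewett α := by
  refine fun δ hδ ↦ ⟨1, fun n hn D hD ↦ ?_⟩
  obtain ⟨x, hx⟩ := nonempty_of_setDens_pos (hδ.trans_le hD)
  have : Nonempty (Fin n) := ⟨⟨0, hn⟩⟩
  exact ⟨Line.diagonal α (Fin n), fun a ↦ by rwa [Subsingleton.elim (Line.diagonal α _ a) x]⟩

variable [Fintype α] [Nonempty α]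

lemma DensityHalesJewett.exists_subspace (hα : DensityHalesJewett α) (m : ℕ) :
    ∀ δ > (0 : ℝ), ∃ N, ∀ n ≥ N, ∀ D : Set (Fin n → α), δ ≤ setDens D →
      ∃ V : Subspace (Fin m) α (Fin n), ∀ x, V x ∈ D := by
  induction m with
  | zero =>
    intro δ hδ
    refine ⟨0, fun n _ D hD ↦ ?_⟩
    obtain ⟨y, hy⟩ := nonempty_of_setDens_pos (hδ.trans_le hD)
    exact ⟨⟨fun i ↦ .inl (y i), fun e ↦ e.elim0⟩, fun x ↦ hy⟩
  | succ m ih =>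
    intro δ hδ
    obtain ⟨N₁, hN₁⟩ := hα (δ / 2) (by positivity)
    have := Fintype.ofFinite (Line α (Fin N₁))
    obtain ⟨N₂, hN₂⟩ := ih (δ / 2 / (Fintype.card (Line α (Fin N₁)) + 1)) (by positivity)
    refine ⟨N₂ + N₁, fun n hn D hD ↦ ?_⟩
    obtain ⟨k, rfl⟩ : ∃ k, n = k + N₁ := ⟨n - N₁, by omega⟩
    rw [setDens_append] at hD
    have hG := half_le_setDens_of_le_expect (fun _ ↦ setDens_le_one _) hδ.le hD
    obtain ⟨l, hl⟩ := exists_div_card_le_setDens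
      (fun l : Line α (Fin N₁) ↦ {y : Fin k → α | ∀ a, Fin.append y (l a) ∈ D})
      (half_pos hδ) hG (fun y hy ↦ hN₁ N₁ le_rfl _ hy)
    obtain ⟨V, hV⟩ := hN₂ k (by omega) _ hl
    refine ⟨V.append (l.toSubspaceUnit.reindex (Equiv.ofUnique Unit (Fin 1)) (.refl _)
      (.refl _)), fun x ↦ ?_⟩
    obtain ⟨⟨y, z⟩, rfl⟩ := (Fin.appendEquiv m 1).surjective x
    have hz : l.toSubspaceUnit.reindex (Equiv.ofUnique Unit (Fin 1)) (.refl _) (.refl _) z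
        = l (z 0) := by
      ext i
      simp only [Subspace.reindex_apply, Line.toSubspaceUnit_apply]
      rfl
    change Subspace.toFun _ (Fin.append y z) ∈ D
    rw [Subspace.append_append, hz]
    exact hV y (z 0)

lemma exists_restrict {T β : Type*} [Fintype T] [Nonempty T] [Fintype β] [Nonempty β] {s : β → T}
    (hs : s.Injective) (k : ℕ) {ε : ℝ} (hε : 0 < ε) :
    ∃ N, ∀ n ≥ N, ∀ F : (Fin n → T) → ℝ, (∀ t, F t ≤ 1) → ε ≤ 𝔼 t, F t →
      ∃ k' ≥ k, ∃ V : Subspace (Fin k') T (Fin n), ε / 2 ≤ 𝔼 w : Fin k' → β, F (V (s ∘ w)) := by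
  classical
  set g : T → ℝ := fun τ ↦ if τ ∈ Set.range s then 1 / 2 else 1 with hg
  have hg0 : ∀ τ, 0 ≤ g τ := fun τ ↦ by simp only [hg]; split_ifs <;> norm_num
  have hg1 : 𝔼 τ, g τ < 1 := by
    refine expect_lt (fun τ _ ↦ by simp only [hg]; split_ifs <;> norm_num)
      ⟨s (Classical.arbitrary β), mem_univ _, ?_⟩
    simp only [hg, Set.mem_range_self, if_true]
    norm_num
  obtain ⟨N, hN⟩ := exists_pow_lt_of_lt_one (show 0 < ε / 4 / 2 ^ k by positivity) hg1
  refine ⟨N, fun n hn F hF1 hF ↦ ?_⟩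
  let J : (Fin n → T) → Finset (Fin n) := fun t ↦ {i | t i ∈ Set.range s}
  let V : ∀ t, Subspace (Fin #(J t)) T (Fin n) := fun t ↦
    { idxFun := fun i ↦ if h : i ∈ J t then .inr ((J t).equivFin ⟨i, h⟩) else .inl (t i)
      proper := fun e ↦ ⟨(J t).equivFin.symm e, by simp⟩ }
  have key : 𝔼 t, F t = 𝔼 t, 𝔼 w : Fin #(J t) → β, F (V t (s ∘ w)) := by
    let σ : T × β → T × β := fun p ↦
      if h : p.1 ∈ Set.range s then (s p.2, h.choose) else p
    have hσ : Function.Involutive σ := by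
      rintro ⟨τ, b⟩
      by_cases h : τ ∈ Set.range s
      · have h' : s b ∈ Set.range s := ⟨b, rfl⟩
        simp only [σ, h, h', dif_pos]
        exact Prod.ext h.choose_spec (hs h'.choose_spec)
      · simp only [σ, h, dif_neg, not_false_eq_true]
    let Ψ : (Fin n → T) × (Fin n → β) → (Fin n → T) × (Fin n → β) := fun p ↦
      (fun i ↦ (σ (p.1 i, p.2 i)).1, fun i ↦ (σ (p.1 i, p.2 i)).2)
    have hΨ : Function.Involutive Ψ := fun p ↦ by
      refine Prod.ext (funext fun i ↦ ?_) (funext fun i ↦ ?_) <;> simp [Ψ, hσ _]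
    have hswap : 𝔼 p : (Fin n → T) × (Fin n → β), F (Ψ p).1
        = 𝔼 p : (Fin n → T) × (Fin n → β), F p.1 :=
      Fintype.expect_equiv hΨ.toPerm _ _ fun p ↦ rfl
    rw [← univ_product_univ, expect_product, expect_product] at hswap
    simp only [Fintype.expect_const] at hswap
    rw [← hswap]
    refine expect_congr rfl fun t _ ↦ ?_
    rw [← expect_comp_of_injective (j := fun e ↦ ((J t).equivFin.symm e : Fin n))
      (Subtype.val_injective.comp (Equiv.injective _))]
    refine expect_congr rfl fun w _ ↦ congrArg F (funext fun i ↦ ?_)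
    by_cases h : t i ∈ Set.range s
    · have h' : i ∈ J t := by simpa [J] using h
      have : (V t).idxFun i = .inr ((J t).equivFin ⟨i, h'⟩) := by simp only [V, h', dif_pos]
      rw [Subspace.apply_inr this]
      simp only [Ψ, σ, h, dif_pos, Function.comp_apply, Equiv.symm_apply_apply]
    · have h' : i ∉ J t := by simpa [J] using h
      have : (V t).idxFun i = .inl (t i) := by simp only [V, h', dif_neg, not_false_eq_true]
      rw [Subspace.apply_inl this]
      simp only [Ψ, σ, h, dif_neg, not_false_eq_true]
  by_contra! hcon
  have hpt : ∀ t, 𝔼 w : Fin #(J t) → β, F (V t (s ∘ w)) ≤ ε / 2 + 2 ^ k * ∏ i, g (t i) := by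
    intro t
    have hprod : ∏ i, g (t i) = (1 / 2) ^ #(J t) := by
      simp only [hg]
      rw [prod_ite, prod_const_one, mul_one, prod_const]
    rcases le_or_gt k #(J t) with h | h
    · refine (hcon _ h (V t)).le.trans (le_add_of_nonneg_right ?_)
      exact mul_nonneg (by positivity) (prod_nonneg fun i _ ↦ hg0 _)
    · refine (expect_le univ_nonempty fun w _ ↦ hF1 _).trans ?_
      rw [hprod, one_div, inv_pow, ← div_eq_mul_inv]
      have : (1 : ℝ) ≤ 2 ^ k / 2 ^ #(J t) := by
        rw [one_le_div (by positivity)]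
        exact pow_le_pow_right₀ (by norm_num) h.le
      linarith
  have hle := (key ▸ hF).trans (expect_le_expect fun t _ ↦ hpt t)
  rw [expect_add_distrib, Fintype.expect_const, ← mul_expect, expect_prod_pow] at hle
  have hpow : (𝔼 τ, g τ) ^ n < ε / 4 / 2 ^ k :=
    (pow_le_pow_of_le_one (expect_nonneg fun τ _ ↦ hg0 τ) hg1.le hn).trans_lt hN
  rw [lt_div_iff₀ (by positivity)] at hpow
  linarith

lemma Insensitive.exists_subspace (hα : DensityHalesJewett α) (a : α) (m : ℕ) {δ : ℝ}
    (hδ : 0 < δ) : ∃ N, ∀ n ≥ N, ∀ E : Set (Fin n → Option α), Insensitive a E →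
      δ ≤ setDens E → ∃ V : Subspace (Fin m) (Option α) (Fin n), ∀ x, V x ∈ E := by
  obtain ⟨k, hk⟩ := hα.exists_subspace m (δ / 2) (half_pos hδ)
  obtain ⟨N, hN⟩ := exists_restrict (Option.some_injective α) k hδ
  refine ⟨N, fun n hn E hE hdE ↦ ?_⟩
  obtain ⟨k', hk', V, hV⟩ := hN n hn _ (indicator_one_le_one E) hdE
  obtain ⟨W, hW⟩ := hk k' hk' {w | V (some ∘ w) ∈ E} hV
  refine ⟨V.comp (W.mapAlphabet some), fun x ↦ ?_⟩
  refine hE _ _ ?_ (hW ((Option.getD · a) ∘ x))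
  rw [Subspace.comp_apply]
  refine V.comp_apply_congr _ ?_
  rw [← Subspace.mapAlphabet_comp]
  refine Subspace.comp_apply_congr _ _ ?_
  ext i
  simp

lemma Insensitive.exists_increment (hα : DensityHalesJewett α) (a : α) (m : ℕ) {ρ : ℝ}
    (hρ : 0 < ρ) : ∃ N, ∀ n ≥ N, ∀ (g : (Fin n → Option α) → ℝ) (E : Set (Fin n → Option α)),
      (∀ x, g x ≤ 1) → Insensitive a E → ρ ≤ 𝔼 x, E.indicator g x →
        ∃ V : Subspace (Fin m) (Option α) (Fin n), ρ / 2 ≤ 𝔼 x, g (V x) := by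
  classical
  obtain ⟨N, hN⟩ := Insensitive.exists_subspace hα a m (show 0 < ρ / 8 by positivity)
  have := Fintype.ofFinite (Subspace (Fin m) (Option α) (Fin N))
  set K := Fintype.card (Subspace (Fin m) (Option α) (Fin N))
  set q : ℝ := (Fintype.card (Fin m → Option α)) / (Fintype.card (Fin N → Option α)) with hq
  have hq0 : 0 < q := by positivity
  set c : ℝ := min 1 (q * (ρ / 8 / (K + 1))) with hc
  have hc0 : 0 < c := by positivity
  have hc1 : c ≤ 1 := min_le_left _ _
  obtain ⟨r, hr⟩ := exists_pow_lt_of_lt_one (show 0 < ρ / 8 by positivity)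
    (show 1 - c < 1 by linarith)
  have hind : ∀ n (g : (Fin n → Option α) → ℝ) (E : Set (Fin n → Option α)), (∀ x, g x ≤ 1) →
      𝔼 x, E.indicator g x ≤ setDens E := fun n g E hg ↦
    expect_le_expect fun x _ ↦ Set.indicator_le_indicator (hg x)
  have main : ∀ r n, r * N ≤ n → ∀ (g : (Fin n → Option α) → ℝ) (E : Set (Fin n → Option α)),
      (∀ x, g x ≤ 1) → Insensitive a E →
      (∀ V : Subspace (Fin m) (Option α) (Fin n), 𝔼 x, g (V x) ≤ ρ / 2) →
      𝔼 x, E.indicator g x ≤ ρ / 4 + ((1 - c) ^ r + ρ / 2) * setDens E := by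
    intro r
    induction r with
    | zero =>
      intro n _ g E hg hE hV
      rw [pow_zero]
      linarith [hind n g E hg, mul_nonneg hρ.le (setDens_nonneg E)]
    | succ r ih =>
      intro n hn g E hg hE hV
      obtain ⟨k, rfl⟩ : ∃ k, n = N + k := ⟨n - N, by rw [add_mul] at hn; omega⟩
      have hpow : 0 ≤ (1 - c) ^ r := pow_nonneg (by linarith) _
      rcases le_total (setDens E) (ρ / 4) with hsmall | hlarge
      · have : 0 ≤ ((1 - c) ^ (r + 1) + ρ / 2) * setDens E :=
          mul_nonneg (add_nonneg (pow_nonneg (by linarith) _) (by positivity)) (setDens_nonneg E)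
        linarith [hind _ g E hg]
      rw [setDens_append'] at hlarge
      have hG := half_le_setDens_of_le_expect (fun _ ↦ setDens_le_one _) (by positivity) hlarge
      rw [show ρ / 4 / 2 = ρ / 8 by ring] at hG
      obtain ⟨V, hVZ⟩ := exists_div_card_le_setDens
        (fun V : Subspace (Fin m) (Option α) (Fin N) ↦
          {z : Fin k → Option α | ∀ x, Fin.append (V x) z ∈ E}) (by positivity) hG
        (fun z hz ↦ hN N le_rfl _
          (by simpa using hE.preimage (Subspace.fixRight (m := N) z)) hz)
      set Z := {z : Fin k → Option α | ∀ x, Fin.append (V x) z ∈ E} with hZ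
      let B : Set (Fin (N + k) → Option α) :=
        {p | (fun i ↦ p (Fin.castAdd k i)) ∈ Set.range V ∧ (fun i ↦ p (Fin.natAdd N i)) ∈ Z}
      have hB : ∀ y z, Fin.append y z ∈ B ↔ y ∈ Set.range V ∧ z ∈ Z := fun y z ↦ by simp [B]
      have hBE : B ⊆ E := fun p hp ↦ by
        obtain ⟨⟨y, z⟩, rfl⟩ := (Fin.appendEquiv N k).surjective p
        obtain ⟨⟨x, rfl⟩, hz⟩ := (hB y z).1 hp
        exact hz x
      have hBexp : ∀ f : (Fin (N + k) → Option α) → ℝ, 𝔼 p, B.indicator f p =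
          q * 𝔼 z, Z.indicator (fun z ↦ 𝔼 x, f (Fin.append (V x) z)) z := fun f ↦ by
        have : ∀ y, 𝔼 z, B.indicator f (Fin.append y z) = (Set.range V).indicator
            (fun y ↦ 𝔼 z, Z.indicator (fun z ↦ f (Fin.append y z)) z) y := fun y ↦ by
          by_cases hy : y ∈ Set.range V <;> simp [Set.indicator, hB, hy]
        rw [expect_append]
        simp_rw [this]
        rw [V.expect_indicator_range, expect_comm]
        congr 1
        refine expect_congr rfl fun z _ ↦ ?_
        by_cases hz : z ∈ Z <;> simp [Set.indicator, hz]
      have hBdens : setDens B = q * setDens Z := by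
        rw [setDens, hBexp]
        simp only [Pi.one_apply, Fintype.expect_const]
        rfl
      have hBg : 𝔼 p, B.indicator g p ≤ ρ / 2 * setDens B := by
        rw [hBexp, hBdens, mul_left_comm]
        gcongr
        rw [setDens, mul_expect]
        refine expect_le_expect fun z _ ↦ ?_
        by_cases hz : z ∈ Z
        · simpa [Set.indicator, hz] using hV ((Subspace.fixRight z).comp V)
        · simp [Set.indicator, hz]
      have hrest : 𝔼 p, (E \ B).indicator g p ≤
          ρ / 4 + ((1 - c) ^ r + ρ / 2) * setDens (E \ B) := by
        rw [expect_append, setDens_append, mul_expect]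
        nth_rw 1 [← Fintype.expect_const (ι := Fin N → Option α) (ρ / 4)]
        rw [← expect_add_distrib]
        refine expect_le_expect fun y _ ↦ ?_
        refine ih k (by rw [add_mul] at hn; omega) (fun z ↦ g (Fin.append y z))
          {z | Fin.append y z ∈ E \ B} (fun z ↦ hg _) ?_ fun W ↦ ?_
        · have hEy : ∀ z z' : Fin k → Option α,
              (Option.getD · a) ∘ z = (Option.getD · a) ∘ z' → ∀ y : Fin N → Option α,
                Fin.append y z ∈ E → Fin.append y z' ∈ E := fun z z' hzz' y hz ↦
            hE _ _ (by simpa using (Subspace.fixLeft y).comp_apply_congr _ hzz') hz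
          refine fun z z' hzz' hz ↦ ⟨hEy z z' hzz' y hz.1, fun hz' ↦ hz.2 ?_⟩
          rw [hB] at hz' ⊢
          exact ⟨hz'.1, fun x ↦ hEy z' z hzz'.symm _ (hz'.2 x)⟩
        · simpa using hV ((Subspace.fixLeft y).comp W)
      have hsplit : ∀ f : (Fin (N + k) → Option α) → ℝ, 𝔼 p, E.indicator f p =
          𝔼 p, B.indicator f p + 𝔼 p, (E \ B).indicator f p := fun f ↦ by
        rw [← expect_add_distrib]
        refine expect_congr rfl fun p _ ↦ ?_
        by_cases hpB : p ∈ B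
        · simp [Set.indicator, hpB, hBE hpB]
        · simp [Set.indicator, hpB]
      have hdens : setDens E = setDens B + setDens (E \ B) := hsplit 1
      have hcB : c ≤ setDens B := by
        rw [hBdens]
        exact (min_le_right _ _).trans (by gcongr)
      have hcE : c * setDens E ≤ setDens B :=
        (mul_le_of_le_one_right hc0.le (setDens_le_one E)).trans hcB
      rw [hsplit g, pow_succ]
      have : setDens (E \ B) ≤ (1 - c) * setDens E := by linarith
      have := mul_le_mul_of_nonneg_left this hpow
      rw [hdens] at this ⊢
      linarith
  refine ⟨r * N, fun n hn g E hg hE hρE ↦ ?_⟩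
  by_contra! hV
  have h1 := main r n hn g E hg hE fun V ↦ (hV V).le
  have h2 : ((1 - c) ^ r + ρ / 2) * setDens E ≤ (1 - c) ^ r + ρ / 2 :=
    mul_le_of_le_one_right (add_nonneg (pow_nonneg (by linarith) _) (by positivity))
      (setDens_le_one E)
  linarith

lemma DensityHalesJewett.exists_expect_pos_of_insensitive (hα : DensityHalesJewett α)
    (A : Finset α) (m : ℕ) : ∀ ρ > (0 : ℝ), ∃ N, ∀ n ≥ N, ∀ (g : (Fin n → Option α) → ℝ)
      (E : α → Set (Fin n → Option α)), (∀ x, g x ≤ 1) → (∀ a, Insensitive a (E a)) →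
      ρ ≤ 𝔼 x, {x | ∀ a ∈ A, x ∈ E a}.indicator g x →
        ∃ k ≥ m, ∃ V : Subspace (Fin k) (Option α) (Fin n), 0 < 𝔼 x, g (V x) := by
  classical
  induction A using Finset.induction with
  | empty =>
    intro ρ hρ
    refine ⟨m, fun n hn g E _ _ h ↦ ⟨n, hn, ⟨.inr, fun e ↦ ⟨e, rfl⟩⟩, hρ.trans_le ?_⟩⟩
    exact (by simpa [Set.indicator] using h : ρ ≤ 𝔼 x, g x)
  | insert a A _ ih =>
    intro ρ hρ
    obtain ⟨N, hN⟩ := ih (ρ / 2) (half_pos hρ)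
    obtain ⟨N', hN'⟩ := Insensitive.exists_increment hα a N hρ
    refine ⟨N', fun n hn g E hg hE h ↦ ?_⟩
    obtain ⟨V, hV⟩ := hN' n hn ({x | ∀ a ∈ A, x ∈ E a}.indicator g) (E a)
      (fun x ↦ Set.indicator_apply_le' (fun _ ↦ hg x) fun _ ↦ zero_le_one) (hE a)
      (h.trans_eq <| expect_congr rfl fun x _ ↦ by
        rw [Set.indicator_indicator]
        congr 1
        ext x
        simp)
    obtain ⟨k, hk, W, hW⟩ := hN N le_rfl (fun x ↦ g (V x)) (fun a ↦ {x | V x ∈ E a})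
      (fun x ↦ hg _) (fun a ↦ (hE a).preimage V) hV
    exact ⟨k, hk, V.comp W, by simpa using hW⟩

lemma DensityHalesJewett.exists_expect_pos_of_compl (hα : DensityHalesJewett α) (m : ℕ) {ρ : ℝ}
    (hρ : 0 < ρ) : ∃ N, ∀ n ≥ N, ∀ (g : (Fin n → Option α) → ℝ)
      (C : α → Set (Fin n → Option α)), (∀ x, g x ≤ 1) → (∀ a, Insensitive a (C a)) →
      ρ ≤ 𝔼 x, {x | ∀ a, x ∈ C a}ᶜ.indicator g x →
        ∃ k ≥ m, ∃ V : Subspace (Fin k) (Option α) (Fin n), 0 < 𝔼 x, g (V x) := by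
  classical
  obtain ⟨N, hN⟩ := hα.exists_expect_pos_of_insensitive univ m
    (ρ / Fintype.card (Finset α)) (by positivity)
  refine ⟨N, fun n hn g C hg hC hρg ↦ ?_⟩
  let E : Finset α → α → Set (Fin n → Option α) := fun P a ↦ if a ∈ P then C a else (C a)ᶜ
  have hE : ∀ P x, (∀ a ∈ univ, x ∈ E P a) ↔ P = univ.filter (x ∈ C ·) := fun P x ↦ by
    rw [Finset.ext_iff]
    refine forall_congr' fun a ↦ ?_
    by_cases ha : a ∈ P <;> simp [E, ha]
  have hsplit : ∑ P ∈ univ.erase univ, 𝔼 x, {x | ∀ a ∈ univ, x ∈ E P a}.indicator g x =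
      𝔼 x, {x | ∀ a, x ∈ C a}ᶜ.indicator g x := by
    rw [← expect_sum_comm]
    refine expect_congr rfl fun x _ ↦ ?_
    simp only [Set.indicator, Set.mem_ofPred_eq, hE, sum_ite_eq']
    simp [Finset.filter_eq_self]
  obtain ⟨P, hP⟩ : ∃ P, ρ / Fintype.card (Finset α) ≤
      𝔼 x, {x | ∀ a ∈ univ, x ∈ E P a}.indicator g x := by
    by_contra! hlt
    have hle := sum_le_sum fun P (_ : P ∈ univ.erase univ) ↦ (hlt P).le
    rw [hsplit, sum_const, card_erase_of_mem (mem_univ _), card_univ, nsmul_eq_mul] at hle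
    have hcard : ((Fintype.card (Finset α) - 1 : ℕ) : ℝ) < Fintype.card (Finset α) := by
      exact_mod_cast Nat.sub_lt Fintype.card_pos one_pos
    have := mul_lt_mul_of_pos_right hcard
      (show 0 < ρ / Fintype.card (Finset α) by positivity)
    rw [mul_div_cancel₀ _ (by positivity)] at this
    linarith
  refine hN n hn g (E P) hg (fun a ↦ ?_) hP
  by_cases ha : a ∈ P
  · simpa [E, ha] using hC a
  · simpa [E, ha] using (hC a).compl

lemma DensityHalesJewett.exists_correlation (hα : DensityHalesJewett α) {δ : ℝ} (hδ : 0 < δ) :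
    ∃ θ > (0 : ℝ), ∀ k, ∃ M, ∀ n, ∀ D : Set (Fin (M + n) → Option α),
      (∀ x, δ ≤ setDens {y | Fin.append x y ∈ D}) →
      ∃ k' ≥ k, ∃ W : Subspace (Fin k') (Option α) (Fin M),
        θ ≤ 𝔼 w, setDens {y | ∀ a, Fin.append (some ∘ (Option.getD · a) ∘ W w) y ∈ D} := by
  classical
  obtain ⟨m, hm⟩ := hα (δ / 2) (half_pos hδ)
  have := Fintype.ofFinite (Line α (Fin m))
  have hθ : 0 < δ / 2 / (Fintype.card (Line α (Fin m)) + 1) := by positivity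
  choose j hj using fun l : Line α (Fin m) ↦ l.proper
  let s : Line α (Fin m) → Option α → α ⊕ Fin m := fun l o ↦ o.elim (.inr (j l)) .inl
  have hs : ∀ l, (s l).Injective := fun l x y h ↦ by
    cases x <;> cases y <;> simp_all [s]
  refine ⟨_, half_pos hθ, fun k ↦ ?_⟩
  choose N hN using fun l ↦ exists_restrict (hs l) k hθ
  refine ⟨univ.sup N, fun n D hD ↦ ?_⟩
  let f : (Fin m → α) → α ⊕ Fin m → Option α := fun w ↦ Sum.elim some (some ∘ w)
  have hexp : δ ≤ 𝔼 p : (Fin (univ.sup N) → α ⊕ Fin m) × (Fin n → Option α),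
      setDens {w | Fin.append (f w ∘ p.1) p.2 ∈ D} := by
    rw [← univ_product_univ, expect_product]
    refine le_expect univ_nonempty fun t _ ↦ ?_
    have := expect_setDens_comm fun y w ↦ Fin.append (f w ∘ t) y ∈ D
    rw [this]
    exact le_expect univ_nonempty fun w _ ↦ hD _
  obtain ⟨l, hl⟩ := exists_div_card_le_setDens
    (fun l : Line α (Fin m) ↦ {p : (Fin (univ.sup N) → α ⊕ Fin m) × (Fin n → Option α) |
      ∀ a, Fin.append (f (l a) ∘ p.1) p.2 ∈ D}) (half_pos hδ)
    (half_le_setDens_of_le_expect (fun _ ↦ setDens_le_one _) hδ.le hexp)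
    fun p hp ↦ hm m le_rfl _ hp
  rw [setDens, ← univ_product_univ, expect_product] at hl
  obtain ⟨k', hk', V, hV⟩ := hN l _ (le_sup (mem_univ l)) _
    (fun t ↦ setDens_le_one {y | ∀ a, Fin.append (f (l a) ∘ t) y ∈ D}) hl
  let u : α ⊕ Fin m → Option α := Sum.elim some l.idxFun
  have hu : ∀ a, f (l a) = some ∘ (Option.getD · a) ∘ u := fun a ↦ by
    ext1 (b | i) <;> simp [f, u, Line.apply_def]
  have hus : ∀ o, u (s l o) = o := fun o ↦ by cases o <;> simp [u, s, hj]
  refine ⟨k', hk', V.mapAlphabet u, hV.trans_eq (expect_congr rfl fun w _ ↦ ?_)⟩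
  have hw : V.mapAlphabet u w = u ∘ V (s l ∘ w) := by
    rw [← Subspace.mapAlphabet_comp]
    congr 1
    ext1 i
    exact (hus _).symm
  rw [hw]
  simp only [hu, Function.comp_assoc]

lemma DensityHalesJewett.exists_sub (hα : DensityHalesJewett α) {δ : ℝ} (hδ : 0 < δ)
    (h : ∀ ε > 0, DensityHalesJewettAt (Option α) (δ + ε)) :
    ∃ γ > 0, DensityHalesJewettAt (Option α) (δ - γ) := by
  classical
  obtain ⟨θ, hθ, hcorr⟩ := hα.exists_correlation (half_pos hδ)
  obtain ⟨e, he⟩ : ∃ e, e = δ * θ / 8 := ⟨_, rfl⟩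
  have he0 : 0 < e := by rw [he]; positivity
  obtain ⟨n₀, hn₀⟩ := h (2 * e) (by positivity)
  obtain ⟨n₁, hn₁⟩ := hα.exists_expect_pos_of_compl n₀ (show 0 < 4 * e by positivity)
  have hq : setDens ({none}ᶜ : Set (Option α)) < 1 :=
    expect_lt (fun _ _ ↦ indicator_one_le_one _ _) ⟨none, mem_univ _, by simp⟩
  obtain ⟨r, hr⟩ := exists_pow_lt_of_lt_one he0 hq
  obtain ⟨M, hM⟩ := hcorr (max n₁ r)
  set B : ℝ := (Fintype.card (Fin M → Option α) : ℝ)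
  have hB : 0 < B := by positivity
  set c := min e (δ / 2) with hc
  have hc0 : 0 < c := by positivity
  obtain ⟨γ, hγ⟩ : ∃ γ, γ = c / (2 * B) := ⟨_, rfl⟩
  have hγ0 : 0 < γ := by rw [hγ]; positivity
  have hBγ : B * (2 * γ) = c := by rw [hγ]; field_simp
  obtain ⟨N, hN⟩ := h γ hγ0
  refine ⟨γ, hγ0, M + N, fun n hn D hD ↦ ?_⟩
  obtain ⟨k, rfl⟩ : ∃ k, n = M + k := ⟨n - M, by omega⟩
  by_contra! hfree
  have hupper : ∀ x : Fin M → Option α,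
      setDens {y : Fin k → Option α | Fin.append x y ∈ D} ≤ δ + γ := by
    intro x
    by_contra! hx
    obtain ⟨l, hl⟩ := hN k (by omega) _ hx.le
    obtain ⟨a, ha⟩ := hfree ((Subspace.fixLeft x).mapLine l)
    exact ha (by simpa using hl a)
  have hlower : ∀ x : Fin M → Option α,
      δ - c ≤ setDens {y : Fin k → Option α | Fin.append x y ∈ D} := by
    intro x
    rw [setDens_append, Fintype.expect_eq_sum_div_card, le_div_iff₀ hB,
      ← add_sum_erase _ _ (mem_univ x)] at hD
    have hsum := sum_le_sum fun y (_ : y ∈ univ.erase x) ↦ hupper y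
    rw [sum_const, card_erase_of_mem (mem_univ _), card_univ, nsmul_eq_mul,
      Nat.cast_pred Fintype.card_pos] at hsum
    linarith
  obtain ⟨k', hk', W, hW⟩ := hM k D fun x ↦
    (by linarith [min_le_right e (δ / 2)] : _ ≤ δ - c).trans (hlower x)
  obtain ⟨y, hy⟩ : ∃ y : Fin k → Option α,
      δ - c + δ * θ ≤ setDens {w | Fin.append (W w) y ∈ D} +
      δ * setDens {w | ∀ a, Fin.append (some ∘ (Option.getD · a) ∘ W w) y ∈ D} := by
    have hle : δ - c + δ * θ ≤ 𝔼 y : Fin k → Option α, (setDens {w | Fin.append (W w) y ∈ D} +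
        δ * setDens {w | ∀ a, Fin.append (some ∘ (Option.getD · a) ∘ W w) y ∈ D}) := by
      rw [expect_setDens_comm] at hW
      rw [expect_add_distrib, ← mul_expect,
        ← expect_setDens_comm fun w (y : Fin k → Option α) ↦ Fin.append (W w) y ∈ D]
      gcongr
      exact le_expect univ_nonempty fun w _ ↦ hlower _
    simpa using exists_le_of_le_expect univ_nonempty hle
  let C : α → Set (Fin k' → Option α) := fun a ↦
    {w | Fin.append (some ∘ (Option.getD · a) ∘ W w) y ∈ D}
  have hC : ∀ a, Insensitive a (C a) := fun a w w' hww' hw ↦ by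
    simpa only [C, Set.mem_ofPred_eq, W.comp_apply_congr _ hww'] using hw
  set D' := {w | Fin.append (W w) y ∈ D}
  set S := {w | ∀ a, w ∈ C a}
  have hinter : setDens (D' ∩ S) ≤ e := by
    refine (setDens_mono (t := {w | ∀ i, w i ≠ none}) fun w hw i hi ↦ ?_).trans ?_
    · obtain ⟨j, hj⟩ := W.proper i
      obtain ⟨l, hl, hl'⟩ := exists_line_append (W w) ⟨j, by rw [Subspace.apply_inr hj, hi]⟩ y
      obtain ⟨a | a, ha⟩ := hfree l
      · exact ha (hl ▸ hw.1)
      · exact ha (hl' a ▸ hw.2 a)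
    · rw [setDens_forall_ne_none]
      exact (pow_le_pow_of_le_one (setDens_nonneg _) hq.le
        ((le_max_right _ _).trans hk')).trans hr.le
  set g : (Fin k' → Option α) → ℝ := fun w ↦ D'.indicator 1 w - (δ + 2 * e) with hg
  have hexp : 4 * e ≤ 𝔼 w, Sᶜ.indicator g w := by
    have hsplit : 𝔼 w, Sᶜ.indicator g w =
        setDens D' - setDens (D' ∩ S) - (δ + 2 * e) * (1 - setDens S) := by
      have h1 : (1 : ℝ) = 𝔼 w : Fin k' → Option α, 1 := (Fintype.expect_const _).symm
      nth_rw 1 [h1]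
      simp only [setDens]
      rw [← expect_sub_distrib, ← expect_sub_distrib, mul_expect, ← expect_sub_distrib]
      refine expect_congr rfl fun w _ ↦ ?_
      by_cases hwS : w ∈ S <;> by_cases hwD : w ∈ D' <;> simp [hg, hwS, hwD]
    rw [hsplit]
    have h1 := setDens_le_one S
    have h0 := setDens_nonneg S
    have hce : c ≤ e := min_le_left _ _
    change _ ≤ setDens D' + δ * setDens S at hy
    linarith [mul_nonneg he0.le h0]
  obtain ⟨p, hp, V, hV⟩ := hn₁ k' ((le_max_left _ _).trans hk') g C
    (fun w ↦ by linarith [indicator_one_le_one D' w]) hC hexp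
  have hV' : δ + 2 * e ≤ setDens {x | V x ∈ D'} := by
    simp only [hg] at hV
    rw [expect_sub_distrib, Fintype.expect_const] at hV
    exact (sub_pos.1 hV).le
  obtain ⟨l, hl⟩ := hn₀ p hp _ hV'
  obtain ⟨a, ha⟩ := hfree ((Subspace.fixRight y).mapLine (W.mapLine (V.mapLine l)))
  exact ha (by simpa [D'] using hl a)

theorem DensityHalesJewett.option (hα : DensityHalesJewett α) : DensityHalesJewett (Option α) := by
  intro δ hδ
  by_contra hfail
  let s := {δ | DensityHalesJewettAt (Option α) δ}
  have hs : ∀ x ∈ s, δ ≤ x := fun x hx ↦ by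
    by_contra! hlt
    exact hfail (hx.mono hlt.le)
  have hbdd : BddBelow s := ⟨δ, hs⟩
  have hne : s.Nonempty := ⟨2, 0, fun n _ D hD ↦ by linarith [setDens_le_one D]⟩
  obtain ⟨γ, hγ, h⟩ := hα.exists_sub (hδ.trans_le (le_csInf hne hs)) fun ε hε ↦ by
    obtain ⟨x, hx, hlt⟩ := exists_lt_of_csInf_lt hne (lt_add_of_pos_right (sInf s) hε)
    exact DensityHalesJewettAt.mono hx hlt.le
  linarith [csInf_le hbdd h]

end

end Combinatorics

lemma exists_div_card_le_setDens_translate {G Y : Type*} [AddCommGroup G] [Fintype Y] [Nonempty Y]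
    (c : Y → G) (A S : Finset G) (hS : S.Nonempty) (h : ∀ w, ∀ p ∈ A, p - c w ∈ S) :
    ∃ s, (#A : ℝ) / #S ≤ setDens {w | s + c w ∈ A} := by
  classical
  have hle : (#A : ℝ) / #S ≤ 𝔼 s ∈ S, setDens {w | s + c w ∈ A} := by
    simp only [setDens]
    rw [expect_comm]
    refine le_expect univ_nonempty fun w _ ↦ ?_
    rw [expect_eq_sum_div_card]
    gcongr
    simp only [Set.indicator, Set.mem_ofPred_eq, Pi.one_apply]
    rw [sum_boole]
    refine mod_cast card_le_card_of_injOn (· - c w) (fun p hp ↦ ?_)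
      (sub_left_injective.injOn)
    simpa using ⟨h w p hp, hp⟩
  obtain ⟨s, -, hs⟩ := exists_le_of_le_expect hS hle
  exact ⟨s, hs⟩

lemma Combinatorics.Line.card_filter_apply_eq {α ι : Type*} [Fintype ι] [DecidableEq α]
    (l : Line α ι) (a b : α) : #{i | l b i = a} =
      #{i | l.idxFun i = some a} + if b = a then #{i | l.idxFun i = none} else 0 := by
  classical
  split_ifs with h
  · subst h
    rw [← card_union_of_disjoint (disjoint_filter.2 fun i _ h ↦ by simp [h]), ← filter_or]
    congr 1
    ext i
    simp only [mem_filter_univ]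
    cases hi : l.idxFun i <;> simp [hi]
  · congr 1
    ext i
    simp only [mem_filter_univ]
    cases hi : l.idxFun i <;> simp [hi, h]

/-- **Theorem 1.7.** For every `δ > 0` there exists `N` such that every subset `A ⊆ [N]^3` of
size at least `δ·N^3` contains a quadruple of points of the form
`(x,y,z), (x+d,y,z), (x,y+d,z), (x,y,z+d)` with `d > 0`. -/
theorem corners_three_dim (δ : ℝ) (hδ : 0 < δ) :
    ∃ N : ℕ, ∀ A : Finset (ℤ × ℤ × ℤ),
      (∀ p ∈ A, (1 ≤ p.1 ∧ p.1 ≤ (N : ℤ)) ∧ (1 ≤ p.2.1 ∧ p.2.1 ≤ (N : ℤ)) ∧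
        (1 ≤ p.2.2 ∧ p.2.2 ≤ (N : ℤ))) →
      δ * (N : ℝ) ^ 3 ≤ (A.card : ℝ) →
      ∃ x y z d : ℤ, 0 < d ∧ (x, y, z) ∈ A ∧ (x + d, y, z) ∈ A ∧ (x, y + d, z) ∈ A ∧
        (x, y, z + d) ∈ A := by
  have hDHJ : DensityHalesJewett (Option (Option (Option Unit))) :=
    densityHalesJewett_of_unique.option.option.option
  obtain ⟨n, hn⟩ := hDHJ (δ / 2) (half_pos hδ)
  set m := n + 1 with hm
  refine ⟨7 * m, fun A hA hcard ↦ ?_⟩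
  let c (a : Option (Option (Option Unit))) (w : Fin m → Option (Option (Option Unit))) : ℤ :=
    #{i | w i = a}
  have hc0 : ∀ a w, 0 ≤ c a w := fun a w ↦ Nat.cast_nonneg _
  have hcm : ∀ a w, c a w ≤ m := fun a w ↦
    Int.ofNat_le.2 ((card_le_univ _).trans_eq (Fintype.card_fin m))
  let S : Finset ℤ := Icc (1 - m) (7 * m)
  have hScard : #S = 8 * m := by
    rw [Int.card_Icc]
    omega
  obtain ⟨⟨x, y, z⟩, hs⟩ := exists_div_card_le_setDens_translate
    (fun w ↦ (c (some (some none)) w, c (some none) w, c none w)) A (S ×ˢ S ×ˢ S)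
    (by simp [S]; omega) fun w p hp ↦ by
      obtain ⟨⟨h1, h2⟩, ⟨h3, h4⟩, h5, h6⟩ := hA p hp
      have := hc0 none w; have := hc0 (some none) w; have := hc0 (some (some none)) w
      have := hcm none w; have := hcm (some none) w; have := hcm (some (some none)) w
      push_cast at h2 h4 h6
      simp only [mem_product, S, mem_Icc, Prod.fst_sub, Prod.snd_sub]
      omega
  have hm0 : (0 : ℝ) < m := by positivity
  have hdens : δ / 2 ≤ (#A : ℝ) / #(S ×ˢ S ×ˢ S) := by
    rw [card_product, card_product, hScard, le_div_iff₀ (by positivity)]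
    push_cast at hcard ⊢
    nlinarith [pow_pos hm0 3]
  obtain ⟨l, hl⟩ := hn m (by omega) _ (hdens.trans hs)
  simp only [Set.mem_ofPred_eq, c, Line.card_filter_apply_eq, Prod.mk_add_mk] at hl
  refine ⟨_, _, _, #{i | l.idxFun i = none}, ?_,
    by simpa using hl (some (some (some ()))), ?_, ?_, ?_⟩
  · obtain ⟨i, hi⟩ := l.proper
    exact mod_cast card_pos.2 ⟨i, by simp [hi]⟩
  · simpa [add_assoc] using hl (some (some none))
  · simpa [add_assoc] using hl (some none)
  · simpa [add_assoc] using hl none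
end

section
/- For every constant a > 0 there exists a constant c > 0 with the following property: if G is any graph with n vertices that contains at most c·n^3 triangles, then it is possible to remove at most a·n^2 edges from G so that the resulting graph is triangle-free. (Theorem 1.3, the triangle removal lemma.) -/
open Finset

/-- **Theorem 1.3: the triangle removal lemma.** For every `a > 0` there exists `c > 0` such
that any graph `G` with `n` vertices containing at most `c·n^3` triangles can be made
triangle-free by removing at most `a·n^2` edges. -/
theorem triangle_removal (a : ℝ) (ha : 0 < a) :
    ∃ c : ℝ, 0 < c ∧
      ∀ (V : Type) [Fintype V] [DecidableEq V] (G : SimpleGraph V) [DecidableRel G.Adj],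
        ((G.cliqueFinset 3).card : ℝ) ≤ c * (Fintype.card V : ℝ) ^ 3 →
        ∃ G' : SimpleGraph V, G' ≤ G ∧ G'.CliqueFree 3 ∧
          ((G.edgeSet \ G'.edgeSet).ncard : ℝ) ≤ a * (Fintype.card V : ℝ) ^ 2 := by
  refine ⟨SimpleGraph.triangleRemovalBound a / 2,
    half_pos (SimpleGraph.triangleRemovalBound_pos ha), ?_⟩
  intro V _ _ G _ hG
  cases isEmpty_or_nonempty V
  · refine ⟨G, le_rfl, fun s hs ↦ ?_, by simp⟩
    simpa [Subsingleton.elim s ∅] using hs.card_eq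
  have hlt : ((G.cliqueFinset 3).card : ℝ) <
      SimpleGraph.triangleRemovalBound a * (Fintype.card V : ℝ) ^ 3 := by
    refine hG.trans_lt ?_
    have := SimpleGraph.triangleRemovalBound_pos ha
    gcongr
    exact half_lt_self this
  obtain ⟨G', hle, _, hcard, hfree⟩ := SimpleGraph.triangle_removal hlt
  refine ⟨G', hle, hfree, ?_⟩
  rw [← SimpleGraph.coe_edgeFinset G, ← SimpleGraph.coe_edgeFinset G', ← coe_sdiff,
    Set.ncard_coe_finset, cast_card_sdiff (SimpleGraph.edgeFinset_mono hle)]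
  exact_mod_cast hcard.le
end

section
/- For every δ > 0 there exists N such that every subset A ⊆ [N]^2 of size at least δN^2 contains a triple of points of the form (x,y), (x+d,y), (x,y+d) with d > 0. (Corollary 1.4, the corners theorem.) -/
open Finset

/-- A set of pairs in `[N]^2` of density `δ` has a large centrally symmetric part. -/
theorem exists_large_card_filter_sub_mem (δ : ℝ) (hδ : 0 < δ) (N : ℕ) (hN : 0 < N)
    (A : Finset (ℤ × ℤ))
    (hA : ∀ p ∈ A, (1 ≤ p.1 ∧ p.1 ≤ (N : ℤ)) ∧ (1 ≤ p.2 ∧ p.2 ≤ (N : ℤ)))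
    (hcard : δ * (N : ℝ) ^ 2 ≤ (A.card : ℝ)) :
    ∃ c : ℤ × ℤ, δ ^ 2 / 4 * (N : ℝ) ^ 2 ≤ ((A.filter fun a ↦ c - a ∈ A).card : ℝ) := by
  have hmaps : ∀ p ∈ A ×ˢ A,
      p.1 + p.2 ∈ Icc (1 : ℤ) (2 * N) ×ˢ Icc (1 : ℤ) (2 * N) := by
    intro p hp
    have h₁ := hA _ (mem_product.1 hp).1
    have h₂ := hA _ (mem_product.1 hp).2
    simp only [mem_product, mem_Icc, Prod.fst_add, Prod.snd_add]
    lia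
  obtain ⟨c, -, hc⟩ := exists_le_card_fiber_of_nsmul_le_card_of_maps_to
    (b := δ ^ 2 / 4 * (N : ℝ) ^ 2) hmaps ⟨(1, 1), by simp; lia⟩ (by
      have hsq : (δ * (N : ℝ) ^ 2) ^ 2 ≤ (A.card : ℝ) ^ 2 := by gcongr
      have hI : (Icc (1 : ℤ) (2 * N)).card = 2 * N := by simp; lia
      rw [card_product, card_product, hI, nsmul_eq_mul]
      push_cast
      linarith)
  refine ⟨c, hc.trans (Nat.cast_le.2 ?_)⟩
  refine card_le_card_of_injOn Prod.fst ?_ ?_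
  · rintro p hp
    simp only [coe_filter, mem_product, Set.mem_ofPred_eq] at hp ⊢
    refine ⟨hp.1.1, ?_⟩
    rw [← hp.2, add_sub_cancel_left]
    exact hp.1.2
  · rintro p hp q hq hpq
    simp only [coe_filter, Set.mem_ofPred_eq] at hp hq
    refine Prod.ext hpq (add_left_cancel (a := p.1) ?_)
    rw [hp.2, hpq, hq.2]

/-- A dense enough subset of `[N]^2` contains a corner, possibly with negative side length. -/
theorem exists_corner_ne_zero (ε : ℝ) (hε : 0 < ε) (N : ℕ) (hN : cornersTheoremBound (ε / 9) ≤ N)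
    (B : Finset (ℤ × ℤ))
    (hB : ∀ p ∈ B, (1 ≤ p.1 ∧ p.1 ≤ (N : ℤ)) ∧ (1 ≤ p.2 ∧ p.2 ≤ (N : ℤ)))
    (hcard : ε * (N : ℝ) ^ 2 ≤ (B.card : ℝ)) :
    ∃ x y d : ℤ, d ≠ 0 ∧ (x, y) ∈ B ∧ (x + d, y) ∈ B ∧ (x, y + d) ∈ B := by
  let C : Finset (ℕ × ℕ) :=
    (range N ×ˢ range N).filter fun q ↦ ((q.1 + 1 : ℤ), (q.2 + 1 : ℤ)) ∈ B
  have hBC : B.card ≤ C.card := by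
    refine card_le_card_of_injOn (fun p ↦ ((p.1 - 1).toNat, (p.2 - 1).toNat)) ?_ ?_
    · intro p hp
      have h := hB p hp
      have h₁ : ((p.1 - 1).toNat + 1 : ℤ) = p.1 := by lia
      have h₂ : ((p.2 - 1).toNat + 1 : ℤ) = p.2 := by lia
      simp only [C, coe_filter, mem_product, mem_range, Set.mem_ofPred_eq, h₁, h₂]
      exact ⟨by lia, hp⟩
    · intro p hp q hq hpq
      have h := hB p hp
      have h' := hB q hq
      simp only [Prod.mk.injEq] at hpq
      exact Prod.ext (by lia) (by lia)
  have hC := corners_theorem_nat hε hN C (filter_subset _ _)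
    (hcard.trans (Nat.cast_le.2 hBC))
  simp only [IsCornerFree, not_forall] at hC
  obtain ⟨x₁, y₁, x₂, y₂, h, hne⟩ := hC
  have h₁ := (mem_filter.1 (mem_coe.1 h.fst_fst_mem)).2
  have h₂ := (mem_filter.1 (mem_coe.1 h.snd_fst_mem)).2
  have h₃ := (mem_filter.1 (mem_coe.1 h.fst_snd_mem)).2
  have hadd := h.add_eq_add
  refine ⟨x₁ + 1, y₁ + 1, x₂ - x₁, by lia, h₁, ?_, ?_⟩
  · convert h₂ using 2
    ring
  · convert h₃ using 2
    lia

/-- **Corollary 1.4: the corners theorem.** For every `δ > 0` there exists `N` such that every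
subset `A ⊆ [N]^2` of size at least `δ·N^2` contains a triple of points of the form
`(x,y), (x+d,y), (x,y+d)` with `d > 0`. -/
theorem corners (δ : ℝ) (hδ : 0 < δ) :
    ∃ N : ℕ, ∀ A : Finset (ℤ × ℤ),
      (∀ p ∈ A, (1 ≤ p.1 ∧ p.1 ≤ (N : ℤ)) ∧ (1 ≤ p.2 ∧ p.2 ≤ (N : ℤ))) →
      δ * (N : ℝ) ^ 2 ≤ (A.card : ℝ) →
      ∃ x y d : ℤ, 0 < d ∧ (x, y) ∈ A ∧ (x + d, y) ∈ A ∧ (x, y + d) ∈ A := by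
  refine ⟨cornersTheoremBound (δ ^ 2 / 4 / 9), fun A hA hcard ↦ ?_⟩
  obtain ⟨c, hc⟩ := exists_large_card_filter_sub_mem δ hδ _
    (by unfold cornersTheoremBound; lia) A hA hcard
  obtain ⟨x, y, d, hd, h₁, h₂, h₃⟩ := exists_corner_ne_zero (δ ^ 2 / 4) (by positivity) _ le_rfl _
    (fun p hp ↦ hA p (mem_filter.1 hp).1) hc
  rw [mem_filter] at h₁ h₂ h₃
  obtain hd | hd := hd.lt_or_gt
  · refine ⟨c.1 - x, c.2 - y, -d, by lia, h₁.2, ?_, ?_⟩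
    · convert h₂.2 using 1
      ext <;> simp; ring
    · convert h₃.2 using 1
      ext <;> simp; ring
  · exact ⟨x, y, d, hd, h₁.1, h₂.1, h₃.1⟩
end

section
/- For every δ > 0 there exists N such that every subset A of {1,2,…,N} of size at least δN contains an arithmetic progression of length 3, i.e., three distinct elements x, x+d, x+2d with d ≠ 0. (Corollary 1.5, Roth's theorem.) -/
open Finset

/-- **Corollary 1.5: Roth's theorem.** For every `δ > 0` there exists `N` such that every
subset `A` of `{1,…,N}` of size at least `δ·N` contains an arithmetic progression of length 3,
i.e. elements `x, x+d, x+2d` with `d ≠ 0`. -/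
theorem roth (δ : ℝ) (hδ : 0 < δ) :
    ∃ N : ℕ, ∀ A : Finset ℤ,
      (∀ x ∈ A, 1 ≤ x ∧ x ≤ (N : ℤ)) →
      δ * (N : ℝ) ≤ (A.card : ℝ) →
      ∃ x d : ℤ, d ≠ 0 ∧ x ∈ A ∧ x + d ∈ A ∧ x + 2 * d ∈ A := by
  classical
  refine ⟨cornersTheoremBound (δ / 3), fun A hA hcard ↦ ?_⟩
  set f : ℤ → ℕ := fun x ↦ (x - 1).toNat
  have f_cast {x : ℤ} (hx : x ∈ A) : (f x : ℤ) = x - 1 :=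
    Int.toNat_of_nonneg (by linarith [(hA x hx).1])
  have f_injOn : Set.InjOn f A := fun x hx y hy hxy ↦ by
    have h₁ := f_cast hx
    have h₂ := f_cast hy
    lia
  have h_not_free : ¬ ThreeAPFree ((A.image f : Finset ℕ) : Set ℕ) := by
    refine roth_3ap_theorem_nat δ hδ le_rfl _ (fun n hn ↦ ?_) ?_
    · obtain ⟨x, hx, rfl⟩ := mem_image.1 hn
      have h₁ := f_cast hx
      have h₂ := (hA x hx).2
      rw [mem_range]
      lia
    · rwa [card_image_of_injOn f_injOn]
  by_contra! h_no_ap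
  refine h_not_free ?_
  rw [coe_image]
  rintro _ ⟨x, hx, rfl⟩ _ ⟨y, hy, rfl⟩ _ ⟨z, hz, rfl⟩ h_add
  by_contra h_ne
  have h₁ := f_cast hx
  have h₂ := f_cast hy
  have h₃ := f_cast hz
  refine h_no_ap x (y - x) (fun h ↦ h_ne ?_) hx ?_ ?_
  · rw [sub_eq_zero.1 h]
  · rwa [add_sub_cancel]
  · rwa [show x + 2 * (y - x) = z by lia]
end

section
/- Let ε > 0. Then there exists a positive integer K_0 such that, given any graph G, the vertex set of G can be partitioned into K ≤ K_0 sets V_1,…,V_K, with sizes differing by at most 1, such that all but at most εK^2 of the pairs (V_i,V_j) are ε-regular. (Theorem 1.1, Szemerédi's regularity lemma.) -/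
open Finset

/-- A pair `(A, B)` of vertex sets of a graph `G` is `ε`-regular if
`|d(A',B') − d(A,B)| ≤ ε` for all `A' ⊆ A`, `B' ⊆ B` with `|A'| ≥ ε|A|` and `|B'| ≥ ε|B|`,
where `d(A,B) = e(A,B)/(|A||B|)` is the edge density. -/
def IsRegularPair {V : Type*} [Fintype V] [DecidableEq V] (G : SimpleGraph V)
    [DecidableRel G.Adj] (ε : ℝ) (A B : Finset V) : Prop :=
  ∀ A' ⊆ A, ∀ B' ⊆ B, ε * (A.card : ℝ) ≤ (A'.card : ℝ) → ε * (B.card : ℝ) ≤ (B'.card : ℝ) →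
    |(G.edgeDensity A' B' : ℝ) - (G.edgeDensity A B : ℝ)| ≤ ε

theorem SimpleGraph.IsUniform.isRegularPair {V : Type*} [Fintype V] [DecidableEq V]
    {G : SimpleGraph V} [DecidableRel G.Adj] {ε : ℝ} {A B : Finset V} (h : G.IsUniform ε A B) :
    IsRegularPair G ε A B := fun A' hA B' hB hA' hB' ↦
  (h hA hB (by rwa [mul_comm]) (by rwa [mul_comm])).le

open scoped Classical in
/-- Index the parts of an equipartition by `Fin K`, bounding the irregular pairs of parts,
diagonal pairs included, by the non-uniform ones. -/
theorem Finpartition.IsEquipartition.exists_fin_indexing {V : Type*} [Fintype V] [DecidableEq V]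
    (G : SimpleGraph V) [DecidableRel G.Adj] {P : Finpartition (univ : Finset V)}
    (hP : P.IsEquipartition) (ε : ℝ) :
    ∃ Q : Fin #P.parts → Finset V,
      (∀ i j, i ≠ j → Disjoint (Q i) (Q j)) ∧
      (∀ v : V, ∃ i, v ∈ Q i) ∧
      (∀ i j, ((Q i).card : ℤ) ≤ ((Q j).card : ℤ) + 1) ∧
      {p : Fin #P.parts × Fin #P.parts | ¬ IsRegularPair G ε (Q p.1) (Q p.2)}.ncard ≤
        #{p ∈ P.parts ×ˢ P.parts | ¬ G.IsUniform ε p.1 p.2} := by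
  let e := P.parts.equivFin.symm
  have he : Function.Injective fun i ↦ (e i : Finset V) :=
    Subtype.val_injective.comp e.injective
  refine ⟨fun i ↦ e i, fun i j hij ↦ P.disjoint (e i).2 (e j).2 (he.ne hij), fun v ↦ ?_,
    fun i j ↦ ?_, ?_⟩
  · obtain ⟨A, hA, hv⟩ := P.exists_mem (mem_univ v)
    exact ⟨e.symm ⟨A, hA⟩, by simpa using hv⟩
  · exact_mod_cast hP (e i).2 (e j).2
  · rw [← Set.ncard_coe_finset {p ∈ P.parts ×ˢ P.parts | ¬ G.IsUniform ε p.1 p.2}]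
    refine Set.ncard_le_ncard_of_injOn (fun p ↦ ((e p.1 : Finset V), (e p.2 : Finset V)))
      (fun p hp ↦ ?_) (fun p _ q _ hpq ↦ ?_) (Finset.finite_toSet _)
    · simp only [coe_filter, mem_product, Set.mem_ofPred_eq]
      exact ⟨⟨(e p.1).2, (e p.2).2⟩, fun h ↦ hp h.isRegularPair⟩
    · exact Prod.ext (he (Prod.ext_iff.1 hpq).1) (he (Prod.ext_iff.1 hpq).2)

open scoped Classical in
theorem Finpartition.card_filter_not_isUniform_le {V : Type*} [DecidableEq V] {A : Finset V}
    (P : Finpartition A) (G : SimpleGraph V) [DecidableRel G.Adj] (ε : ℝ) :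
    #{p ∈ P.parts ×ˢ P.parts | ¬ G.IsUniform ε p.1 p.2} ≤
      #(P.nonUniforms G ε) + #P.parts := by
  rw [← diag_card P.parts]
  refine (card_le_card fun p hp ↦ ?_).trans (card_union_le _ _)
  obtain ⟨u, v⟩ := p
  simp only [mem_filter, mem_product, mem_union, mk_mem_nonUniforms, mem_diag] at hp ⊢
  tauto

/-- **Theorem 1.1: Szemerédi's regularity lemma.** For every `ε > 0` there exists `K₀` such
that the vertex set of any graph `G` can be partitioned into `K ≤ K₀` sets `V 0, …, V (K-1)`,
with sizes differing by at most 1, such that all but at most `ε·K^2` of the pairs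
`(V i, V j)` are `ε`-regular. -/
theorem szemeredi_regularity_lemma (ε : ℝ) (hε : 0 < ε) :
    ∃ K₀ : ℕ, 0 < K₀ ∧
      ∀ (V : Type) [Fintype V] [DecidableEq V] (G : SimpleGraph V) [DecidableRel G.Adj],
        ∃ (K : ℕ) (P : Fin K → Finset V), K ≤ K₀ ∧
          (∀ i j, i ≠ j → Disjoint (P i) (P j)) ∧
          (∀ v : V, ∃ i, v ∈ P i) ∧
          (∀ i j, ((P i).card : ℤ) ≤ ((P j).card : ℤ) + 1) ∧
          (({p : Fin K × Fin K | ¬ IsRegularPair G ε (P p.1) (P p.2)}.ncard : ℝ) ≤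
            ε * (K : ℝ) ^ 2) := by
  obtain ⟨l, hl⟩ := exists_nat_ge (2 / ε)
  refine ⟨SzemerediRegularity.bound (ε / 2) l, SzemerediRegularity.bound_pos _ _, ?_⟩
  intro V _ _ G _
  classical
  suffices h : ∃ P : Finpartition (univ : Finset V), P.IsEquipartition ∧
      #P.parts ≤ SzemerediRegularity.bound (ε / 2) l ∧
      (#{p ∈ P.parts ×ˢ P.parts | ¬ G.IsUniform ε p.1 p.2} : ℝ) ≤ ε * (#P.parts : ℝ) ^ 2 by
    obtain ⟨P, hP, hcard, hreg⟩ := h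
    obtain ⟨Q, hdisj, hcover, hsize, hQ⟩ := hP.exists_fin_indexing G ε
    exact ⟨#P.parts, Q, hcard, hdisj, hcover, hsize, le_trans (mod_cast hQ) hreg⟩
  obtain hV | hV := lt_or_ge (Fintype.card V) l
  · refine ⟨⊥, Finpartition.bot_isEquipartition _, ?_, ?_⟩
    · rw [Finpartition.card_bot, card_univ]
      exact hV.le.trans (SzemerediRegularity.le_bound _ _)
    · rw [filter_false_of_mem, card_empty, Nat.cast_zero]
      · positivity
      · rintro ⟨u, v⟩ huv
        obtain ⟨hu, hv⟩ := mem_product.1 huv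
        obtain ⟨a, -, rfl⟩ := Finpartition.mem_bot_iff.1 hu
        obtain ⟨b, -, rfl⟩ := Finpartition.mem_bot_iff.1 hv
        exact not_not.2 (SimpleGraph.isUniform_singleton.2 hε)
  · obtain ⟨P, hP, hlP, hcard, hunif⟩ := szemeredi_regularity G (half_pos hε) hV
    refine ⟨P, hP, hcard, ?_⟩
    have hmono := card_le_card (P.nonUniforms_mono G (half_le_self hε.le))
    have hsplit := P.card_filter_not_isUniform_le G ε
    have hoff : ((#P.parts * (#P.parts - 1) : ℕ) : ℝ) ≤ (#P.parts : ℝ) ^ 2 := by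
      rw [sq]
      exact_mod_cast Nat.mul_le_mul_left _ (Nat.sub_le _ _)
    have hdiag : 2 ≤ #P.parts * ε :=
      (div_le_iff₀ hε).1 (hl.trans (mod_cast hlP))
    calc
      _ ≤ (#(P.nonUniforms G (ε / 2)) : ℝ) + #P.parts := by
        exact_mod_cast hsplit.trans (Nat.add_le_add_right hmono _)
      _ ≤ (#P.parts : ℝ) ^ 2 * (ε / 2) + #P.parts * (#P.parts * ε / 2) := by
        gcongr
        · exact hunif.trans (by gcongr)
        · exact le_mul_of_one_le_right (by positivity) (by linarith)
      _ = ε * (#P.parts : ℝ) ^ 2 := by ring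
end

section
/- For every α > 0 and every k there exists ε > 0 with the following property. Let V_1,…,V_k be sets of vertices in a graph G, and suppose that for each pair (i,j) the pair (V_i,V_j) is ε-regular with density d_{ij}. Let H be a graph with vertex set {x_1,…,x_k}, let v_i ∈ V_i be chosen independently and uniformly at random, and let φ be the map taking x_i to v_i for each i. Then the probability that φ is an isomorphic embedding of H into G differs from ∏_{x_i x_j ∈ E(H)} d_{ij} · ∏_{x_i x_j ∉ E(H)} (1 − d_{ij}) by at most α. (Theorem 1.2, the counting lemma for graphs.) -/
open Finset

/-- On every rectangle inside a regular pair, the number of edges is close to the number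
predicted by the density of the pair. -/
theorem IsRegularPair.abs_sum_sub_le {W : Type*} [Fintype W] [DecidableEq W]
    {G : SimpleGraph W} [DecidableRel G.Adj] {ε : ℝ} {A B A' B' : Finset W}
    (h : IsRegularPair G ε A B) (hε : 0 ≤ ε) (hA : A' ⊆ A) (hB : B' ⊆ B) :
    |∑ x ∈ A', ∑ y ∈ B', ((if G.Adj x y then (1 : ℝ) else 0) - (G.edgeDensity A B : ℝ))|
      ≤ ε * (A.card * B.card) := by
  have hd0 : (0 : ℝ) ≤ (G.edgeDensity A B : ℝ) := by exact_mod_cast G.edgeDensity_nonneg A B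
  have hd1 : (G.edgeDensity A B : ℝ) ≤ 1 := by exact_mod_cast G.edgeDensity_le_one A B
  have hcA : (A'.card : ℝ) ≤ A.card := by exact_mod_cast card_le_card hA
  have hcB : (B'.card : ℝ) ≤ B.card := by exact_mod_cast card_le_card hB
  have trivial_bound :
      |∑ x ∈ A', ∑ y ∈ B', ((if G.Adj x y then (1 : ℝ) else 0) - (G.edgeDensity A B : ℝ))|
        ≤ A'.card * B'.card := by
    calc _ ≤ ∑ x ∈ A', ∑ y ∈ B', (1 : ℝ) := by
          refine (abs_sum_le_sum_abs _ _).trans (sum_le_sum fun x _ => ?_)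
          refine (abs_sum_le_sum_abs _ _).trans (sum_le_sum fun y _ => ?_)
          rw [abs_le]
          split_ifs <;> constructor <;> linarith
      _ = _ := by simp
  by_cases h1 : ε * (A.card : ℝ) ≤ A'.card
  · by_cases h2 : ε * (B.card : ℝ) ≤ B'.card
    · have hr := h A' hA B' hB h1 h2
      have hcount : ∑ x ∈ A', ∑ y ∈ B', (if G.Adj x y then (1 : ℝ) else 0)
          = (G.edgeDensity A' B' : ℝ) * (A'.card * B'.card) := by
        have e : ∑ x ∈ A', ∑ y ∈ B', (if G.Adj x y then (1 : ℝ) else 0)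
            = (G.interedges A' B').card := by
          rw [← sum_product', SimpleGraph.interedges, Rel.interedges, card_filter]
          push_cast
          rfl
        rw [e, SimpleGraph.edgeDensity_def]
        push_cast
        rcases eq_or_ne ((A'.card : ℝ) * B'.card) 0 with h0 | h0
        · rw [h0, mul_zero]
          have := G.card_interedges_le_mul A' B'
          have h0' : A'.card * B'.card = 0 := by exact_mod_cast h0
          exact_mod_cast Nat.le_zero.mp (h0' ▸ this)
        · rw [div_mul_cancel₀ _ h0]
      simp only [sum_sub_distrib]
      rw [hcount]
      simp only [sum_const, nsmul_eq_mul]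
      rw [show (G.edgeDensity A' B' : ℝ) * (A'.card * B'.card)
          - A'.card * (B'.card * (G.edgeDensity A B : ℝ))
          = ((G.edgeDensity A' B' : ℝ) - (G.edgeDensity A B : ℝ)) * (A'.card * B'.card) by ring,
        abs_mul, abs_of_nonneg (by positivity : (0 : ℝ) ≤ A'.card * B'.card)]
      gcongr
    · push Not at h2
      calc _ ≤ (A'.card : ℝ) * B'.card := trivial_bound
        _ ≤ A.card * (ε * B.card) := by gcongr
        _ = _ := by ring
  · push Not at h1
    calc _ ≤ (A'.card : ℝ) * B'.card := trivial_bound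
      _ ≤ (ε * A.card) * B.card := by gcongr
      _ = _ := by ring

/-- Resampling one coordinate of a uniformly random tuple does not change averages. -/
theorem sum_piFinset_sum_update {ι W : Type*} [Fintype ι] [DecidableEq ι]
    (V : ι → Finset W) (i : ι) (F : (ι → W) → ℝ) :
    ∑ v ∈ Fintype.piFinset V, ∑ x ∈ V i, F (Function.update v i x)
      = (V i).card * ∑ v ∈ Fintype.piFinset V, F v := by
  have key : ∑ p ∈ Fintype.piFinset V ×ˢ V i, F (Function.update p.1 i p.2)
      = ∑ p ∈ Fintype.piFinset V ×ˢ V i, F p.1 := by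
    have hmem : ∀ p ∈ Fintype.piFinset V ×ˢ V i,
        (Function.update p.1 i p.2, p.1 i) ∈ Fintype.piFinset V ×ˢ V i := by
      intro p hp
      simp only [mem_product, Fintype.mem_piFinset] at hp ⊢
      refine ⟨fun a => ?_, hp.1 i⟩
      rcases eq_or_ne a i with rfl | ha
      · simpa using hp.2
      · simpa [ha] using hp.1 a
    exact sum_nbij' (fun p => (Function.update p.1 i p.2, p.1 i))
      (fun p => (Function.update p.1 i p.2, p.1 i)) hmem hmem (by simp) (by simp) (by simp)
  rw [sum_product, sum_product] at key
  rw [key]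
  simp [mul_sum]

/-- The discrepancy of one regular pair, weighted by the event that finitely many other pairs
are adjacent or non-adjacent as prescribed by `H`, is small. -/
theorem abs_sum_adj_sub_edgeDensity_le {ι W : Type*} [Fintype ι] [LinearOrder ι]
    [Fintype W] [DecidableEq W] {G : SimpleGraph W} [DecidableRel G.Adj] {ε : ℝ} (hε : 0 ≤ ε)
    {V : ι → Finset W} (H : SimpleGraph ι) [DecidableRel H.Adj] (hV : ∀ i, (V i).Nonempty)
    {q : ι × ι} (hreg : IsRegularPair G ε (V q.1) (V q.2)) (hq : q.1 < q.2)
    {S : Finset (ι × ι)} (hS : ∀ p ∈ S, p.1 < p.2) (hqS : q ∉ S) :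
    open scoped Classical in
    |∑ v ∈ Fintype.piFinset V,
        if ∀ p ∈ S, (H.Adj p.1 p.2 ↔ G.Adj (v p.1) (v p.2)) then
          (if G.Adj (v q.1) (v q.2) then (1 : ℝ) else 0)
            - (G.edgeDensity (V q.1) (V q.2) : ℝ) else 0|
      ≤ ε * ∏ i, ((V i).card : ℝ) := by
  classical
  obtain ⟨i, j⟩ := q
  dsimp only at hreg hq ⊢
  set F : (ι → W) → ℝ := fun v =>
    if ∀ p ∈ S, (H.Adj p.1 p.2 ↔ G.Adj (v p.1) (v p.2)) then
      (if G.Adj (v i) (v j) then (1 : ℝ) else 0) - (G.edgeDensity (V i) (V j) : ℝ) else 0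
    with hF
  have inner (v : ι → W) :
      |∑ x ∈ V i, ∑ y ∈ V j, F (Function.update (Function.update v i x) j y)|
        ≤ ε * ((V i).card * (V j).card) := by
    have hsplit (x y : W) : F (Function.update (Function.update v i x) j y)
        = if ∀ p ∈ S, p.1 ≠ j → p.2 ≠ j → (H.Adj p.1 p.2 ↔
              G.Adj (Function.update v i x p.1) (Function.update v i x p.2)) then
            (if ∀ p ∈ S, (p.1 = j ∨ p.2 = j) → (H.Adj p.1 p.2 ↔
              G.Adj (Function.update v j y p.1) (Function.update v j y p.2)) then
              (if G.Adj x y then (1 : ℝ) else 0) - (G.edgeDensity (V i) (V j) : ℝ) else 0)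
          else 0 := by
      rw [hF, ← ite_and]
      refine if_congr ?_ (by simp [hq.ne]) rfl
      have hj : ∀ p ∈ S, p.1 ≠ j → p.2 ≠ j →
          ((H.Adj p.1 p.2 ↔ G.Adj (Function.update (Function.update v i x) j y p.1)
            (Function.update (Function.update v i x) j y p.2)) ↔
          (H.Adj p.1 p.2 ↔
            G.Adj (Function.update v i x p.1) (Function.update v i x p.2))) := by
        intro p _ h1 h2
        rw [Function.update_of_ne h1, Function.update_of_ne h2]
      have hi : ∀ p ∈ S, (p.1 = j ∨ p.2 = j) →
          ((H.Adj p.1 p.2 ↔ G.Adj (Function.update (Function.update v i x) j y p.1)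
            (Function.update (Function.update v i x) j y p.2)) ↔
          (H.Adj p.1 p.2 ↔
            G.Adj (Function.update v j y p.1) (Function.update v j y p.2))) := by
        intro p hp h
        have hlt := hS p hp
        have h1 : p.1 ≠ i := by
          rintro h1
          rcases h with h | h
          · exact hq.ne (h1.symm.trans h)
          · exact hqS (by rwa [← h1, ← h])
        have h2 : p.2 ≠ i := by
          rintro h2
          rcases h with h | h
          · rw [h, h2] at hlt
            exact lt_asymm hq hlt
          · exact hq.ne (h2.symm.trans h)
        have e : ∀ l, l ≠ i →
            Function.update (Function.update v i x) j y l = Function.update v j y l := by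
          intro l hl
          simp [Function.update_apply, hl]
        rw [e _ h1, e _ h2]
      constructor
      · intro h
        exact ⟨fun p hp h1 h2 => (hj p hp h1 h2).1 (h p hp),
          fun p hp h1 => (hi p hp h1).1 (h p hp)⟩
      · rintro ⟨ha, hb⟩ p hp
        by_cases h : p.1 = j ∨ p.2 = j
        · exact (hi p hp h).2 (hb p hp h)
        · push Not at h
          exact (hj p hp h.1 h.2).2 (ha p hp h.1 h.2)
    have hcond (P : Prop) [Decidable P] (g : W → ℝ) :
        ∑ y ∈ V j, (if P then g y else 0) = if P then ∑ y ∈ V j, g y else 0 := by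
      split_ifs <;> simp
    simp only [hsplit, hcond]
    simp only [← sum_filter]
    exact hreg.abs_sum_sub_le hε (filter_subset _ _) (filter_subset _ _)
  have hi0 : (0 : ℝ) < (V i).card := by exact_mod_cast (hV i).card_pos
  have hj0 : (0 : ℝ) < (V j).card := by exact_mod_cast (hV j).card_pos
  have hresample : ∑ v ∈ Fintype.piFinset V, ∑ x ∈ V i, ∑ y ∈ V j,
      F (Function.update (Function.update v i x) j y)
      = (V i).card * ((V j).card * ∑ v ∈ Fintype.piFinset V, F v) := by
    rw [sum_piFinset_sum_update V i fun w => ∑ y ∈ V j, F (Function.update w j y),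
      sum_piFinset_sum_update V j F]
  have hbound : |∑ v ∈ Fintype.piFinset V, ∑ x ∈ V i, ∑ y ∈ V j,
      F (Function.update (Function.update v i x) j y)|
      ≤ (∏ l, ((V l).card : ℝ)) * (ε * ((V i).card * (V j).card)) := by
    refine (abs_sum_le_sum_abs _ _).trans ((sum_le_sum fun v _ => inner v).trans_eq ?_)
    simp
  rw [hresample, ← mul_assoc, abs_mul,
    abs_of_pos (mul_pos hi0 hj0)] at hbound
  refine le_of_mul_le_mul_left (hbound.trans_eq ?_) (mul_pos hi0 hj0)
  ring

/-- The counting lemma for an arbitrary set of pairs, with a linear error term. -/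
theorem abs_count_sub_prod_le {ι W : Type*} [Fintype ι] [LinearOrder ι]
    [Fintype W] [DecidableEq W] {G : SimpleGraph W} [DecidableRel G.Adj] {ε : ℝ} (hε : 0 ≤ ε)
    {V : ι → Finset W} (H : SimpleGraph ι) [DecidableRel H.Adj] (hV : ∀ i, (V i).Nonempty)
    (hreg : ∀ i j, IsRegularPair G ε (V i) (V j))
    (S : Finset (ι × ι)) (hS : ∀ p ∈ S, p.1 < p.2) :
    open scoped Classical in
    |(∑ v ∈ Fintype.piFinset V,
        if ∀ p ∈ S, (H.Adj p.1 p.2 ↔ G.Adj (v p.1) (v p.2)) then (1 : ℝ) else 0) -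
      (∏ p ∈ S, (if H.Adj p.1 p.2 then (G.edgeDensity (V p.1) (V p.2) : ℝ)
        else 1 - (G.edgeDensity (V p.1) (V p.2) : ℝ))) * ∏ i, ((V i).card : ℝ)|
      ≤ S.card * (ε * ∏ i, ((V i).card : ℝ)) := by
  classical
  induction S using Finset.induction_on with
  | empty => simp
  | insert q S hqS ih =>
    have ih := ih fun p hp => hS p (mem_insert_of_mem hp)
    have hdisc := abs_sum_adj_sub_edgeDensity_le hε H hV (hreg q.1 q.2)
      (hS q (mem_insert_self _ _)) (fun p hp => hS p (mem_insert_of_mem hp)) hqS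
    have hd0 : (0 : ℝ) ≤ (G.edgeDensity (V q.1) (V q.2) : ℝ) := by
      exact_mod_cast G.edgeDensity_nonneg _ _
    have hd1 : (G.edgeDensity (V q.1) (V q.2) : ℝ) ≤ 1 := by
      exact_mod_cast G.edgeDensity_le_one _ _
    rw [prod_insert hqS, card_insert_of_notMem hqS]
    set c : ℝ := if H.Adj q.1 q.2 then (G.edgeDensity (V q.1) (V q.2) : ℝ)
      else 1 - (G.edgeDensity (V q.1) (V q.2) : ℝ) with hc
    set C : ℝ := ∏ p ∈ S, (if H.Adj p.1 p.2 then (G.edgeDensity (V p.1) (V p.2) : ℝ)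
        else 1 - (G.edgeDensity (V p.1) (V p.2) : ℝ))
    set M : ℝ := ∏ i, ((V i).card : ℝ)
    set N : ℝ := ∑ v ∈ Fintype.piFinset V,
        if ∀ p ∈ S, (H.Adj p.1 p.2 ↔ G.Adj (v p.1) (v p.2)) then (1 : ℝ) else 0 with hN
    set D : ℝ := ∑ v ∈ Fintype.piFinset V,
        if ∀ p ∈ S, (H.Adj p.1 p.2 ↔ G.Adj (v p.1) (v p.2)) then
          (if G.Adj (v q.1) (v q.2) then (1 : ℝ) else 0)
            - (G.edgeDensity (V q.1) (V q.2) : ℝ) else 0 with hD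
    have hc1 : |c| ≤ 1 := by
      rw [abs_le, hc]
      split_ifs <;> constructor <;> linarith
    have hstep : (∑ v ∈ Fintype.piFinset V,
        if ∀ p ∈ insert q S, (H.Adj p.1 p.2 ↔ G.Adj (v p.1) (v p.2)) then (1 : ℝ) else 0)
        = (if H.Adj q.1 q.2 then 1 else -1) * D + c * N := by
      rw [hD, hN, mul_sum, mul_sum, ← sum_add_distrib]
      refine sum_congr rfl fun v _ => ?_
      simp only [forall_mem_insert, hc]
      by_cases h3 : ∀ p ∈ S, (H.Adj p.1 p.2 ↔ G.Adj (v p.1) (v p.2))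
      · simp only [ite_and, if_pos h3]
        by_cases h1 : H.Adj q.1 q.2 <;> by_cases h2 : G.Adj (v q.1) (v q.2) <;> simp [h1, h2]
      · simp only [ite_and, if_neg h3]
        simp
    rw [hstep, show (if H.Adj q.1 q.2 then 1 else -1) * D + c * N - c * C * M
      = (if H.Adj q.1 q.2 then 1 else -1) * D + c * (N - C * M) by ring]
    have hsign : |(if H.Adj q.1 q.2 then 1 else -1) * D| = |D| := by
      split_ifs <;> simp
    calc _ ≤ |(if H.Adj q.1 q.2 then 1 else -1) * D| + |c * (N - C * M)| := abs_add_le _ _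
      _ ≤ ε * M + 1 * (S.card * (ε * M)) := by
        rw [hsign, abs_mul]
        gcongr
      _ = _ := by push_cast; ring

/-- **Theorem 1.2: the counting lemma for graphs.** For every `α > 0` and every `k` there
exists `ε > 0` with the following property.  Let `V 0, …, V (k-1)` be (nonempty) sets of
vertices of a graph `G` all pairs of which are `ε`-regular, and let `H` be a graph on
`Fin k`.  If `v i ∈ V i` are chosen independently and uniformly at random, then the
probability that `i ↦ v i` is an isomorphic embedding of `H` into `G` differs from
`∏_{i j adjacent in H} d_{ij} · ∏_{i j non-adjacent in H} (1 − d_{ij})` by at most `α`,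
where `d_{ij}` is the density of the pair `(V i, V j)` and the products are over unordered
pairs of distinct vertices of `H`. -/
theorem graph_counting_lemma (α : ℝ) (hα : 0 < α) (k : ℕ) :
    ∃ ε : ℝ, 0 < ε ∧
      ∀ (W : Type) [Fintype W] [DecidableEq W] (G : SimpleGraph W) [DecidableRel G.Adj]
        (V : Fin k → Finset W) (H : SimpleGraph (Fin k)) [DecidableRel H.Adj],
        (∀ i, (V i).Nonempty) →
        (∀ i j, IsRegularPair G ε (V i) (V j)) →
        |((univ.filter fun v : Fin k → W =>
              (∀ i, v i ∈ V i) ∧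
              ∀ i j, i ≠ j → (H.Adj i j ↔ G.Adj (v i) (v j))).card : ℝ) /
            (∏ i, ((V i).card : ℝ)) -
          ∏ p ∈ univ.filter fun p : Fin k × Fin k => p.1 < p.2,
            (if H.Adj p.1 p.2 then (G.edgeDensity (V p.1) (V p.2) : ℝ)
             else 1 - (G.edgeDensity (V p.1) (V p.2) : ℝ))| ≤ α := by
  classical
  refine ⟨α / (k * k + 1), by positivity, ?_⟩
  intro W _ _ G _ V H _ hV hreg
  have hε : 0 < α / ((k : ℝ) * k + 1) := by positivity
  have hM : 0 < ∏ i, ((V i).card : ℝ) :=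
    prod_pos fun i _ => by exact_mod_cast (hV i).card_pos
  have key := abs_count_sub_prod_le hε.le H hV hreg
    (univ.filter fun p : Fin k × Fin k => p.1 < p.2) (by simp)
  have hcount : ((univ.filter fun v : Fin k → W => (∀ i, v i ∈ V i) ∧
        ∀ i j, i ≠ j → (H.Adj i j ↔ G.Adj (v i) (v j))).card : ℝ)
      = ∑ v ∈ Fintype.piFinset V,
          if ∀ p ∈ univ.filter (fun p : Fin k × Fin k => p.1 < p.2),
            (H.Adj p.1 p.2 ↔ G.Adj (v p.1) (v p.2)) then (1 : ℝ) else 0 := by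
    rw [sum_boole]
    congr 2
    ext v
    simp only [mem_filter, mem_univ, true_and, Fintype.mem_piFinset, Prod.forall]
    refine and_congr_right fun _ => ⟨fun h i j hij => h i j hij.ne, fun h i j hij => ?_⟩
    rcases hij.lt_or_gt with hij | hij
    · exact h i j hij
    · rw [H.adj_comm, G.adj_comm]
      exact h j i hij
  rw [← hcount] at key
  have hcard : (((univ.filter fun p : Fin k × Fin k => p.1 < p.2).card : ℕ) : ℝ) ≤ k * k := by
    have := card_filter_le (univ : Finset (Fin k × Fin k)) fun p => p.1 < p.2
    simp only [card_univ, Fintype.card_prod, Fintype.card_fin] at this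
    exact_mod_cast this
  rw [div_sub' hM.ne', abs_div, abs_of_pos hM, div_le_iff₀ hM, mul_comm (∏ i, _) (∏ p ∈ _, _)]
  refine key.trans ?_
  rw [← mul_assoc]
  refine mul_le_mul_of_nonneg_right ?_ hM.le
  calc _ ≤ ((k : ℝ) * k + 1) * (α / (k * k + 1)) := by gcongr; linarith
    _ = α := by field_simp
end
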